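/- Let G be a triconnected 4-planar graph, T a separating triangle of G, and let out*(T) denote the graph obtained from the closed outside subgraph out⁺(T) by replacing T with a single vertex v_T adjacent to the three outside neighbors of T. Then any subhamiltonian cycle H* of out*(T) can be augmented to a subhamiltonian cycle H of out⁺(T) that contains two edges of T; moreover, if H* crosses every face of out*(T) at most once, then for any prescribed pair of edges e1, e2 of T one can choose the augmentation so that both e1 and e2 lie on H. -/

import Mathlib

open Set

universe u

/-- A topological embedding of a simple graph in the plane: vertices are mapped to
distinct points and every edge is realized by a simple arc joining the images of its
endpoints, such that two arcs of distinct edges meet only in common endpoints and no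
vertex point lies in the interior of an arc. -/
structure PlaneEmbedding {V : Type u} (G : SimpleGraph V) where
  pos : V → ℝ × ℝ
  pos_inj : Function.Injective pos
  arc : ∀ ⦃u v : V⦄, G.Adj u v → Set (ℝ × ℝ)
  arc_symm : ∀ ⦃u v : V⦄ (h : G.Adj u v), arc h.symm = arc h
  arc_curve : ∀ ⦃u v : V⦄ (h : G.Adj u v), ∃ f : ℝ → ℝ × ℝ,
    ContinuousOn f (Set.Icc 0 1) ∧ Set.InjOn f (Set.Icc 0 1) ∧
    f 0 = pos u ∧ f 1 = pos v ∧ f '' Set.Icc 0 1 = arc h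
  arc_inter : ∀ ⦃u v w z : V⦄ (h₁ : G.Adj u v) (h₂ : G.Adj w z),
    s(u, v) ≠ s(w, z) → arc h₁ ∩ arc h₂ ⊆ ({pos u, pos v} ∩ {pos w, pos z} : Set (ℝ × ℝ))
  pos_arc : ∀ ⦃u v : V⦄ (h : G.Adj u v) (w : V), pos w ∈ arc h → w = u ∨ w = v

/-- A graph is planar if it admits a topological embedding in the plane. -/
def SimpleGraph.IsPlanar {V : Type u} (G : SimpleGraph V) : Prop :=
  Nonempty (PlaneEmbedding G)

/-- The point set covered by a plane embedding. -/
def PlaneEmbedding.drawing {V : Type u} {G : SimpleGraph V} (E : PlaneEmbedding G) :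
    Set (ℝ × ℝ) :=
  Set.range E.pos ∪ ⋃ (u : V) (v : V) (h : G.Adj u v), E.arc h

/-- A face of a plane embedding is a connected component of the complement of the drawing. -/
def PlaneEmbedding.IsFace {V : Type u} {G : SimpleGraph V} (E : PlaneEmbedding G)
    (F : Set (ℝ × ℝ)) : Prop :=
  ∃ p, p ∉ E.drawing ∧ F = connectedComponentIn E.drawingᶜ p

/-- A vertex is incident to a face if its point lies on the boundary of the face. -/
def PlaneEmbedding.VertexOnFace {V : Type u} {G : SimpleGraph V} (E : PlaneEmbedding G)
    (v : V) (F : Set (ℝ × ℝ)) : Prop :=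
  E.pos v ∈ closure F

/-- Maximum degree at most `d`. -/
def SimpleGraph.MaxDegreeLE {V : Type u} (G : SimpleGraph V) (d : ℕ) : Prop :=
  ∀ v : V, (G.neighborSet v).ncard ≤ d

/-- A graph is triconnected (3-connected) if it has more than three vertices, is
connected, and stays connected after removing any two vertices. -/
def SimpleGraph.IsTriconnected {V : Type u} (G : SimpleGraph V) : Prop :=
  3 < Nat.card V ∧ G.Connected ∧
    ∀ u v : V, (G.induce {w : V | w ≠ u ∧ w ≠ v}).Connected

/-- A graph is biconnected (2-connected) if it has more than two vertices, is
connected, and stays connected after removing any single vertex. -/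
def SimpleGraph.IsBiconnected {V : Type u} (G : SimpleGraph V) : Prop :=
  2 < Nat.card V ∧ G.Connected ∧ ∀ u : V, (G.induce {w : V | w ≠ u}).Connected

/-- A graph is subhamiltonian if it is a spanning subgraph of a planar hamiltonian graph. -/
def SimpleGraph.IsSubhamiltonian {V : Type u} [Fintype V] (G : SimpleGraph V) : Prop :=
  ∃ H : SimpleGraph V, G ≤ H ∧ H.IsPlanar ∧ (letI := Classical.decEq V; H.IsHamiltonian)

/-- The graph consisting of the edges of the cyclic vertex sequence `σ`. -/
def cyclicSuccGraph {W : Type u} (σ : ZMod (Nat.card W) ≃ W) : SimpleGraph W :=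
  SimpleGraph.fromRel fun u v => ∃ i, u = σ i ∧ v = σ (i + 1)

/-- The cyclic ordering `σ` of all vertices of `G` is a subhamiltonian cycle for `G` if
adding the edges between consecutive vertices of `σ` keeps the graph planar. -/
def SimpleGraph.IsSubhamiltonianCycle {W : Type u} (G : SimpleGraph W)
    (σ : ZMod (Nat.card W) ≃ W) : Prop :=
  SimpleGraph.IsPlanar (G ⊔ cyclicSuccGraph σ)

/-- The edges (pairs of consecutive vertices) of the cyclic sequence `σ`. -/
def cycleEdges {W : Type u} (σ : ZMod (Nat.card W) ≃ W) : Set (Sym2 W) :=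
  {e | ∃ i, e = s(σ i, σ (i + 1))}

/-- The subhamiltonian cycle `σ` crosses the face `F` at position `i` if the two
consecutive vertices `σ i` and `σ (i+1)` are both incident to `F` but not adjacent. -/
def CrossesFaceAt {V : Type u} {G : SimpleGraph V} (E : PlaneEmbedding G)
    (σ : ZMod (Nat.card V) ≃ V) (F : Set (ℝ × ℝ)) (i : ZMod (Nat.card V)) : Prop :=
  E.VertexOnFace (σ i) F ∧ E.VertexOnFace (σ (i + 1)) F ∧ ¬ G.Adj (σ i) (σ (i + 1))

/-- A separating triangle: a triangle whose removal disconnects the graph. -/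
def SimpleGraph.IsSepTriangle {V : Type u} (G : SimpleGraph V) (a b c : V) : Prop :=
  G.Adj a b ∧ G.Adj b c ∧ G.Adj a c ∧
    ¬ (G.induce {v : V | v ≠ a ∧ v ≠ b ∧ v ≠ c}).Connected

section Triangle

variable {V : Type u} {G : SimpleGraph V} (E : PlaneEmbedding G) {a b c : V}

/-- The Jordan curve formed by the drawing of the triangle `a b c`. -/
def triangleDrawing (hab : G.Adj a b) (hbc : G.Adj b c) (hac : G.Adj a c) :
    Set (ℝ × ℝ) :=
  E.arc hab ∪ E.arc hbc ∪ E.arc hac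

/-- The vertices strictly inside the triangle `a b c` (bounded side of the Jordan curve). -/
def insideTriangle (hab : G.Adj a b) (hbc : G.Adj b c) (hac : G.Adj a c) : Set V :=
  {v | v ≠ a ∧ v ≠ b ∧ v ≠ c ∧
    Bornology.IsBounded
      (connectedComponentIn (triangleDrawing E hab hbc hac)ᶜ (E.pos v))}

/-- The vertices strictly outside the triangle `a b c` (unbounded side of the Jordan curve). -/
def outsideTriangle (hab : G.Adj a b) (hbc : G.Adj b c) (hac : G.Adj a c) : Set V :=
  {v | v ≠ a ∧ v ≠ b ∧ v ≠ c ∧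
    ¬ Bornology.IsBounded
      (connectedComponentIn (triangleDrawing E hab hbc hac)ᶜ (E.pos v))}

end Triangle

section ClosedTriangle

variable {V : Type u} {G : SimpleGraph V} (E : PlaneEmbedding G) {a b c : V}

/-- The subgraph of `G` induced by the triangle together with all vertices inside it
is `G.induce (closedInsideTriangle E hab hbc hac)`. -/
def closedInsideTriangle (hab : G.Adj a b) (hbc : G.Adj b c) (hac : G.Adj a c) :
    Set V :=
  insideTriangle E hab hbc hac ∪ {a, b, c}

/-- The subgraph of `G` induced by the triangle together with all vertices outside it
is `G.induce (closedOutsideTriangle E hab hbc hac)`. -/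
def closedOutsideTriangle (hab : G.Adj a b) (hbc : G.Adj b c) (hac : G.Adj a c) :
    Set V :=
  outsideTriangle E hab hbc hac ∪ {a, b, c}

end ClosedTriangle

section OutStar

variable {V : Type u} {G : SimpleGraph V} (E : PlaneEmbedding G) {a b c : V}

/-- The graph obtained from the closed outside subgraph of the triangle `a b c` by
replacing the triangle with a single vertex `v_T` (encoded by `none`) adjacent to the
(at most three) outside neighbors of the triangle vertices. -/
def outStarGraph (hab : G.Adj a b) (hbc : G.Adj b c) (hac : G.Adj a c) :
    SimpleGraph (Option ↥(outsideTriangle E hab hbc hac)) :=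
  SimpleGraph.fromRel fun p q =>
    match p, q with
    | some x, some y => G.Adj ↑x ↑y
    | some x, none => G.Adj ↑x a ∨ G.Adj ↑x b ∨ G.Adj ↑x c
    | none, some y => G.Adj ↑y a ∨ G.Adj ↑y b ∨ G.Adj ↑y c
    | none, none => False

open scoped Classical in
/-- The projection of the closed outside subgraph onto the graph with the triangle
contracted: the triangle vertices are sent to the dummy vertex `none`. -/
noncomputable def outProj (hab : G.Adj a b) (hbc : G.Adj b c) (hac : G.Adj a c) :
    ↥(closedOutsideTriangle E hab hbc hac) → Option ↥(outsideTriangle E hab hbc hac) :=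
  fun v => if h : (v : V) ∈ outsideTriangle E hab hbc hac then some ⟨↑v, h⟩ else none

end OutStar

/-- `σ` is obtained from `σ'` by replacing each point of a fibre of `π` in the cyclic
sequence `σ'` with the whole fibre, traversed contiguously: there is a weakly monotone
cyclic surjection `ρ` of index sets along which `π ∘ σ` agrees with `σ'`. -/
def CoarsensTo {W W' : Type u} (π : W → W') (σ : ZMod (Nat.card W) ≃ W)
    (σ' : ZMod (Nat.card W') ≃ W') : Prop :=
  ∃ ρ : ZMod (Nat.card W) → ZMod (Nat.card W'),
    Function.Surjective ρ ∧ (∀ i, π (σ i) = σ' (ρ i)) ∧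
    ∀ i, ρ (i + 1) = ρ i ∨ ρ (i + 1) = ρ i + 1


namespace TG
open Set Complex Filter Topology

def HasLog (f : ℂ → ℂ) (X : Set ℂ) : Prop :=
  ∃ L : ℂ → ℂ, ContinuousOn L X ∧ ∀ z ∈ X, exp (L z) = f z

noncomputable def mob (p q z : ℂ) : ℂ := (z - p) / (z - q)

def Lk (X : Set ℂ) (p q : ℂ) : Prop := ∃ C, IsPreconnected C ∧ C ⊆ Xᶜ ∧ p ∈ C ∧ q ∈ C

theorem const_of_exp {α : Type*} [TopologicalSpace α] {S : Set α} (hS : IsPreconnected S)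
    {g : α → ℂ} (hg : ContinuousOn g S) (h : ∀ z ∈ S, exp (g z) = 1) {x y : α}
    (hx : x ∈ S) (hy : y ∈ S) : g x = g y := by
  refine hS.induction₂ (fun x y => g x = g y) (fun x hx => ?_)
    (fun _ _ _ _ _ _ h1 h2 => h1.trans h2) (fun _ _ _ _ h => h.symm) hx hy
  have h1 : ∀ᶠ y in 𝓝[S] x, dist (g y) (g x) < 1 :=
    (hg x hx).eventually (Metric.ball_mem_nhds _ one_pos)
  filter_upwards [h1, self_mem_nhdsWithin] with y hy hyS
  have h2 : exp (g y - g x) = 1 := by rw [exp_sub, h y hyS, h x hx, div_one]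
  obtain ⟨n, hn⟩ := exp_eq_one_iff.1 h2
  rw [dist_eq_norm, hn] at hy
  have h3 : ‖(n : ℂ) * (2 * Real.pi * I)‖ = |(n : ℝ)| * (2 * Real.pi) := by
    simp [abs_of_pos Real.pi_pos]
  rw [h3] at hy
  have h4 : n = 0 := by
    by_contra hne
    have : (1 : ℝ) ≤ |(n : ℝ)| := by exact_mod_cast Int.one_le_abs hne
    nlinarith [Real.pi_gt_three]
  rw [h4] at hn
  simp at hn
  exact (sub_eq_zero.1 hn).symm

theorem const_of_exp_eq {α : Type*} [TopologicalSpace α] {S : Set α} (hS : IsPreconnected S)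
    {f g : α → ℂ} (hf : ContinuousOn f S) (hg : ContinuousOn g S)
    (h : ∀ z ∈ S, exp (f z) = exp (g z)) {x y : α}
    (hx : x ∈ S) (hy : y ∈ S) : f x - g x = f y - g y :=
  const_of_exp hS (hf.sub hg) (fun z hz => by
    simp [exp_sub, h z hz, exp_ne_zero]) hx hy

theorem HasLog.neg {X : Set ℂ} {p q : ℂ} (h : HasLog (mob p q) X) : HasLog (mob q p) X := by
  obtain ⟨L, h1, h2⟩ := h
  exact ⟨fun z => - L z, h1.neg, fun z hz => by rw [exp_neg, h2 z hz, mob, mob, inv_div]⟩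

theorem hasLog_of_Lk {X : Set ℂ} (hX : IsClosed X) {p q : ℂ} (h : Lk X p q) :
    HasLog (mob p q) X := by
  obtain ⟨C, hC, hCX, hp, hq⟩ := h
  refine hC.induction₂ (fun p q => HasLog (mob p q) X) (fun p hp => ?_)
    ?_ (fun _ _ _ _ h => h.neg) hp hq
  · obtain ⟨ε, hε, hb⟩ := Metric.isOpen_iff.1 hX.isOpen_compl p (hCX hp)
    filter_upwards [mem_nhdsWithin_of_mem_nhds (Metric.ball_mem_nhds p hε)] with q hq
    refine HasLog.neg ?_
    have key : ∀ z ∈ X, z - p ≠ 0 ∧ mob q p z ∈ slitPlane := by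
      intro z hz
      have h1 : ε ≤ dist z p := by
        by_contra hlt
        exact hb (Metric.mem_ball.2 (not_le.1 hlt)) hz
      have h0 : z - p ≠ 0 := by
        intro h0
        rw [dist_eq_norm, h0, norm_zero] at h1; linarith
      refine ⟨h0, ?_⟩
      have h2 : mob q p z = 1 + (p - q) / (z - p) := by
        rw [mob]; field_simp; ring
      rw [h2]
      apply mem_slitPlane_of_norm_lt_one
      rw [norm_div, div_lt_one (norm_pos_iff.2 h0)]
      rw [Metric.mem_ball, dist_comm, dist_eq_norm] at hq
      rw [dist_eq_norm] at h1
      linarith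
    refine ⟨fun z => log (mob q p z), ?_, fun z hz => exp_log (slitPlane_ne_zero (key z hz).2)⟩
    refine ContinuousOn.clog ?_ (fun z hz => (key z hz).2)
    unfold mob
    exact ContinuousOn.div (by fun_prop) (by fun_prop) (fun z hz => (key z hz).1)
  · rintro x y z hx hy hz ⟨L, h1, h2⟩ ⟨M, h3, h4⟩
    refine ⟨fun w => L w + M w, h1.add h3, fun w hw => ?_⟩
    have : w - y ≠ 0 := fun h0 => hCX hy (by rw [← sub_eq_zero.1 h0]; exact hw)
    rw [exp_add, h2 w hw, h4 w hw]
    unfold mob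
    rw [div_mul_div_cancel₀ this]

theorem exists_log {A : Type*} [TopologicalSpace A] [SimplyConnectedSpace A]
    [LocallyPathConnectedSpace A] [Inhabited A] (f : A → ℂ) (hf : Continuous f)
    (h0 : ∀ a, f a ≠ 0) : ∃ L : A → ℂ, Continuous L ∧ ∀ a, exp (L a) = f a := by
  obtain ⟨F, ⟨_, hF⟩, _⟩ := Complex.isCoveringMapOn_exp.existsUnique_continuousMap_lifts
    (⟨f, hf⟩ : C(A, ℂ)) (a₀ := default) (e₀ := log (f default)) (exp_log (h0 _))
    (fun a => by simpa using h0 a)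
  exact ⟨F, F.continuous, fun a => congrFun hF a⟩

theorem frontier_comp {X : Set ℂ} (hX : IsClosed X) (p : ℂ) :
    frontier (connectedComponentIn Xᶜ p) ⊆ X := by
  intro z hz
  by_contra hzX
  have ho : IsOpen (connectedComponentIn Xᶜ p) := hX.isOpen_compl.connectedComponentIn
  rw [ho.frontier_eq] at hz
  have hzo : connectedComponentIn Xᶜ z ∈ 𝓝 z :=
    (hX.isOpen_compl.connectedComponentIn).mem_nhds (mem_connectedComponentIn hzX)
  obtain ⟨w, hw1, hw2⟩ := mem_closure_iff_nhds.1 hz.1 _ hzo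
  apply hz.2
  rw [connectedComponentIn_eq hw2, ← connectedComponentIn_eq hw1]
  exact mem_connectedComponentIn hzX

theorem Lk_of_mem_comp {X : Set ℂ} {p q : ℂ} (hp : p ∉ X) (hq : q ∈ connectedComponentIn Xᶜ p) :
    Lk X p q :=
  ⟨_, isPreconnected_connectedComponentIn, connectedComponentIn_subset _ _,
    mem_connectedComponentIn hp, hq⟩

theorem Lk.mem_comp {X : Set ℂ} {p q : ℂ} (h : Lk X p q) : q ∈ connectedComponentIn Xᶜ p := by
  obtain ⟨C, h1, h2, h3, h4⟩ := h
  exact h1.subset_connectedComponentIn h3 h2 h4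

theorem Lk.symm {X : Set ℂ} {p q : ℂ} (h : Lk X p q) : Lk X q p := by
  obtain ⟨C, h1, h2, h3, h4⟩ := h
  exact ⟨C, h1, h2, h4, h3⟩

theorem Lk.trans {X : Set ℂ} {p q s : ℂ} (h : Lk X p q) (h' : Lk X q s) : Lk X p s := by
  obtain ⟨C, h1, h2, h3, h4⟩ := h
  obtain ⟨D, g1, g2, g3, g4⟩ := h'
  exact ⟨C ∪ D, h1.union q h4 g3 g1, union_subset h2 g2, Or.inl h3, Or.inr g4⟩

theorem Lk.mono {X Y : Set ℂ} {p q : ℂ} (h : Lk X p q) (hY : Y ⊆ X) : Lk Y p q := by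
  obtain ⟨C, h1, h2, h3, h4⟩ := h
  exact ⟨C, h1, h2.trans (compl_subset_compl.2 hY), h3, h4⟩

theorem no_log_bdd {X : Set ℂ} (hX : IsCompact X) {p q : ℂ} (hp : p ∉ X) (hq : q ∉ X)
    (hb : Bornology.IsBounded (connectedComponentIn Xᶜ p))
    (hqD : q ∉ connectedComponentIn Xᶜ p) : ¬ HasLog (mob p q) X := by
  classical
  rintro ⟨L, hL, hexp⟩
  obtain ⟨g, hg⟩ := ContinuousMap.exists_restrict_eq hX.isClosed
    (⟨X.domRestrict L, hL.domRestrict⟩ : C(X, ℂ))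
  have hgL : ∀ z ∈ X, g z = L z := fun z hz => by
    have := congrArg (fun k : C(X, ℂ) => k ⟨z, hz⟩) hg
    exact this
  set D := connectedComponentIn Xᶜ p with hD
  have hpD : p ∈ D := mem_connectedComponentIn hp
  let h : ℂ → ℂ := fun z => if z ∈ D then (z - q) * exp (g z) else z - p
  have hc : Continuous h := by
    refine Continuous.if (fun z hz => ?_) (by fun_prop) (by fun_prop)
    have hzX : z ∈ X := frontier_comp hX.isClosed p hz
    have hzq : z - q ≠ 0 := fun h0 => hq (by rw [← sub_eq_zero.1 h0]; exact hzX)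
    rw [hgL z hzX, hexp z hzX, mob, mul_div_cancel₀ _ hzq]
  have h0 : ∀ z, h z ≠ 0 := by
    intro z
    by_cases hz : z ∈ D
    · have hzq : z - q ≠ 0 := fun h0 => hqD (by rw [← sub_eq_zero.1 h0]; exact hz)
      simp [h, hz, exp_ne_zero, hzq]
    · have hzq : z - p ≠ 0 := fun h0 => hz (by rw [sub_eq_zero.1 h0]; exact hpD)
      simp [h, hz, hzq]
  obtain ⟨Λ, hΛ, hΛe⟩ := exists_log h hc h0
  obtain ⟨R, hR⟩ := hb.subset_ball p
  have hRpos : 0 < R := by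
    have := hR hpD
    simpa using this
  have hk : ∀ θ : ℝ, h (p + R * exp (θ * I)) = R * exp (θ * I) := by
    intro θ
    have : p + R * exp (θ * I) ∉ D := fun hm => by
      have := hR hm
      rw [Metric.mem_ball, dist_eq_norm] at this
      simp [norm_exp_ofReal_mul_I, abs_of_pos hRpos] at this
    simp [h, this]
  have := const_of_exp (S := (univ : Set ℝ)) isPreconnected_univ
    (g := fun θ : ℝ => Λ (p + R * exp (θ * I)) - θ * I - log R)
    (by fun_prop) (fun θ _ => by
      have hR0 : (R : ℂ) ≠ 0 := by exact_mod_cast hRpos.ne'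
      rw [exp_sub, exp_sub, hΛe, hk, exp_log hR0]
      field_simp [exp_ne_zero]) (mem_univ 0) (mem_univ (2 * Real.pi))
  have e1 : exp (((2 * Real.pi : ℝ) : ℂ) * I) = 1 := by
    push_cast; exact exp_two_pi_mul_I
  simp only [e1] at this
  simp at this
  have h3 : (2 : ℂ) * Real.pi * I = 0 := by linear_combination this
  simp at h3

theorem preconn_far (R : ℝ) (hR : 0 < R) : IsPreconnected {z : ℂ | R < ‖z‖} := by
  have : {z : ℂ | R < ‖z‖} =
      (fun x : ℝ × ℝ => (x.1 : ℂ) * exp (x.2 * I)) '' (Ioi R ×ˢ univ) := by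
    ext z
    constructor
    · intro hz
      exact ⟨(‖z‖, arg z), ⟨hz, mem_univ _⟩, norm_mul_exp_arg_mul_I z⟩
    · rintro ⟨⟨r, t⟩, ⟨hr, _⟩, rfl⟩
      have : R < r := hr
      simp [norm_exp_ofReal_mul_I, abs_of_pos (hR.trans this), this]
  rw [this]
  exact (isPreconnected_Ioi.prod isPreconnected_univ).image _ (by fun_prop)

theorem unbdd_Lk {X : Set ℂ} (hX : IsCompact X) {p q : ℂ} (hp : p ∉ X) (hq : q ∉ X)
    (h1 : ¬ Bornology.IsBounded (connectedComponentIn Xᶜ p))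
    (h2 : ¬ Bornology.IsBounded (connectedComponentIn Xᶜ q)) : Lk X p q := by
  obtain ⟨R, hR0, hR⟩ := hX.isBounded.subset_ball_lt 0 0
  have hfar : {z : ℂ | R < ‖z‖} ⊆ Xᶜ := fun z hz hzX => by
    have := hR hzX
    simp at this
    exact absurd hz (not_lt.2 this.le)
  have aux : ∀ p, ¬ Bornology.IsBounded (connectedComponentIn Xᶜ p) →
      ∃ z ∈ connectedComponentIn Xᶜ p, R < ‖z‖ := by
    intro p hp
    by_contra hcon
    push Not at hcon
    exact hp ((Metric.isBounded_closedBall (x := (0 : ℂ)) (r := R)).subset fun z hz => by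
      simpa using hcon z hz)
  obtain ⟨z, hz, hz'⟩ := aux p h1
  obtain ⟨w, hw, hw'⟩ := aux q h2
  have l2 : Lk X z w := ⟨_, preconn_far R hR0, hfar, hz', hw'⟩
  exact (Lk_of_mem_comp hp hz).trans (l2.trans (Lk_of_mem_comp hq hw).symm)

theorem Lk_of_hasLog {X : Set ℂ} (hX : IsCompact X) {p q : ℂ} (hp : p ∉ X) (hq : q ∉ X)
    (h : HasLog (mob p q) X) : Lk X p q := by
  by_contra hn
  have n1 : q ∉ connectedComponentIn Xᶜ p := fun hm => hn (Lk_of_mem_comp hp hm)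
  have n2 : p ∉ connectedComponentIn Xᶜ q := fun hm => hn (Lk_of_mem_comp hq hm).symm
  by_cases b1 : Bornology.IsBounded (connectedComponentIn Xᶜ p)
  · exact no_log_bdd hX hp hq b1 n1 h
  by_cases b2 : Bornology.IsBounded (connectedComponentIn Xᶜ q)
  · exact no_log_bdd hX hq hp b2 n2 h.neg
  exact hn (unbdd_Lk hX hp hq b1 b2)

/-- gluing two logs -/
theorem HasLog.glue {f : ℂ → ℂ} {A B : Set ℂ} (hA : IsClosed A) (hB : IsClosed B)
    {L M : ℂ → ℂ} (hL : ContinuousOn L A) (hLe : ∀ z ∈ A, exp (L z) = f z)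
    (hM : ContinuousOn M B) (hMe : ∀ z ∈ B, exp (M z) = f z)
    (h : ∀ x ∈ A ∩ B, ∀ y ∈ A ∩ B, L x - M x = L y - M y) : HasLog f (A ∪ B) := by
  classical
  obtain ⟨k, hk, hk1⟩ : ∃ k : ℂ, (∀ x ∈ A ∩ B, L x = M x + k) ∧ exp k = 1 := by
    by_cases hne : (A ∩ B).Nonempty
    · obtain ⟨y, hy⟩ := hne
      refine ⟨L y - M y, fun x hx => by rw [← h x hx y hy]; ring, ?_⟩
      rw [exp_sub, hLe y hy.1, hMe y hy.2, div_self]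
      rw [← hLe y hy.1]; exact exp_ne_zero _
    · exact ⟨0, fun x hx => (hne ⟨x, hx⟩).elim, exp_zero⟩
  let N : ℂ → ℂ := fun z => if z ∈ A then L z else M z + k
  have hNA : EqOn N L A := fun z hz => by simp [N, hz]
  have hNB : EqOn N (fun z => M z + k) B := fun z hz => by
    by_cases hzA : z ∈ A
    · simp [N, hzA, hk z ⟨hzA, hz⟩]
    · simp [N, hzA]
  refine ⟨N, ContinuousOn.union_of_isClosed (hL.congr hNA)
    ((hM.add continuousOn_const).congr hNB) hA hB, ?_⟩
  rintro z (hz | hz)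
  · rw [hNA hz, hLe z hz]
  · rw [hNB hz]
    simp only [exp_add, hk1, mul_one, hMe z hz]

theorem janiszewski {A B : Set ℂ} (hA : IsCompact A) (hB : IsCompact B)
    (hAB : IsPreconnected (A ∩ B)) {p q : ℂ} (h1 : Lk A p q) (h2 : Lk B p q) :
    Lk (A ∪ B) p q := by
  have e1 : p ∉ A ∪ B := by
    obtain ⟨C, _, c2, c3, _⟩ := h1
    obtain ⟨D, _, d2, d3, _⟩ := h2
    rintro (h | h)
    exacts [c2 c3 h, d2 d3 h]
  have e2 : q ∉ A ∪ B := by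
    obtain ⟨C, _, c2, _, c3⟩ := h1
    obtain ⟨D, _, d2, _, d3⟩ := h2
    rintro (h | h)
    exacts [c2 c3 h, d2 d3 h]
  obtain ⟨L, hL, hLe⟩ := hasLog_of_Lk hA.isClosed h1
  obtain ⟨M, hM, hMe⟩ := hasLog_of_Lk hB.isClosed h2
  refine Lk_of_hasLog (hA.union hB) e1 e2 (HasLog.glue hA.isClosed hB.isClosed hL hLe hM hMe ?_)
  intro x hx y hy
  exact const_of_exp_eq hAB (hL.mono inter_subset_left) (hM.mono inter_subset_right)
    (fun z hz => by rw [hLe z hz.1, hMe z hz.2]) hx hy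

end TG

namespace TG
open Set Complex Filter Topology

def IsArc (S : Set ℂ) (x y : ℂ) : Prop :=
  ∃ f : ℝ → ℂ, ContinuousOn f (Icc 0 1) ∧ InjOn f (Icc 0 1) ∧ f 0 = x ∧ f 1 = y ∧
    f '' Icc 0 1 = S

theorem isArc_image {f : ℝ → ℂ} {s t : ℝ} (hst : s < t) (hf : ContinuousOn f (Icc s t))
    (hi : InjOn f (Icc s t)) : IsArc (f '' Icc s t) (f s) (f t) := by
  have hd : 0 < t - s := sub_pos.2 hst
  have him : (fun u : ℝ => s + u * (t - s)) '' Icc 0 1 = Icc s t := by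
    ext w
    constructor
    · rintro ⟨u, ⟨h0, h1⟩, rfl⟩
      constructor <;> simp only <;> nlinarith
    · rintro ⟨h0, h1⟩
      refine ⟨(w - s) / (t - s), ⟨div_nonneg (by linarith) hd.le, ?_⟩, ?_⟩
      · rw [div_le_one hd]; linarith
      · simp only; field_simp; ring
  have hm : MapsTo (fun u : ℝ => s + u * (t - s)) (Icc 0 1) (Icc s t) := by
    rw [← him]; exact mapsTo_image _ _
  refine ⟨fun u => f (s + u * (t - s)), hf.comp (by fun_prop) hm, ?_, by simp, by simp, ?_⟩
  · intro u hu w hw h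
    have := hi (hm hu) (hm hw) h
    simp only [add_right_inj] at this
    exact mul_right_cancel₀ hd.ne' this
  · rw [← him, image_image]

theorem IsArc.symm {S : Set ℂ} {x y : ℂ} (h : IsArc S x y) : IsArc S y x := by
  obtain ⟨f, hf, hi, h0, h1, hS⟩ := h
  have hm : MapsTo (fun u : ℝ => 1 - u) (Icc 0 1) (Icc 0 1) := fun u hu =>
    ⟨by linarith [hu.2], by linarith [hu.1]⟩
  refine ⟨fun u => f (1 - u), hf.comp (by fun_prop) hm, ?_, by simpa, by simpa, ?_⟩
  · intro u hu w hw h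
    have := hi (hm hu) (hm hw) h
    simpa using this
  · rw [← hS]
    apply Subset.antisymm
    · rintro _ ⟨u, hu, rfl⟩; exact ⟨1 - u, hm hu, rfl⟩
    · rintro _ ⟨u, hu, rfl⟩; exact ⟨1 - u, hm hu, by simp⟩

theorem IsArc.left_mem {S : Set ℂ} {x y : ℂ} (h : IsArc S x y) : x ∈ S := by
  obtain ⟨f, hf, hi, h0, h1, hS⟩ := h
  rw [← hS, ← h0]; exact ⟨0, by simp, rfl⟩

theorem IsArc.right_mem {S : Set ℂ} {x y : ℂ} (h : IsArc S x y) : y ∈ S := h.symm.left_mem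

theorem IsArc.ne {S : Set ℂ} {x y : ℂ} (h : IsArc S x y) : x ≠ y := by
  obtain ⟨f, hf, hi, h0, h1, hS⟩ := h
  intro hxy
  have : (0:ℝ) = 1 := @hi 0 (by simp) 1 (by simp) (by rw [h0, h1, hxy])
  norm_num at this

theorem IsArc.isCompact {S : Set ℂ} {x y : ℂ} (h : IsArc S x y) : IsCompact S := by
  obtain ⟨f, hf, hi, h0, h1, hS⟩ := h
  rw [← hS]; exact isCompact_Icc.image_of_continuousOn hf

theorem IsArc.isPreconnected {S : Set ℂ} {x y : ℂ} (h : IsArc S x y) : IsPreconnected S := by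
  obtain ⟨f, hf, hi, h0, h1, hS⟩ := h
  rw [← hS]; exact isPreconnected_Icc.image _ hf

/-- removing endpoints keeps the arc connected -/
theorem IsArc.diff_left {S : Set ℂ} {x y : ℂ} (h : IsArc S x y) :
    IsPreconnected (S \ {x}) := by
  obtain ⟨f, hf, hi, h0, h1, hS⟩ := h
  have : S \ {x} = f '' Ioc 0 1 := by
    rw [← hS, ← h0, ← image_singleton, ← hi.image_sdiff_subset (by simp)]
    congr 1
    ext t; simp
  rw [this]
  exact isPreconnected_Ioc.image _ (hf.mono Ioc_subset_Icc_self)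

theorem IsArc.diff_both {S : Set ℂ} {x y : ℂ} (h : IsArc S x y) :
    IsPreconnected (S \ {x, y}) := by
  obtain ⟨f, hf, hi, h0, h1, hS⟩ := h
  have : S \ {x, y} = f '' Ioo 0 1 := by
    rw [← hS, ← h0, ← h1, ← image_pair, ← hi.image_sdiff_subset (by intro t; simp; rintro (rfl|rfl) <;> simp)]
    rw [Icc_sdiff_both]
  rw [this]
  exact isPreconnected_Ioo.image _ (hf.mono Ioo_subset_Icc_self)

theorem isArc_segment {x y : ℂ} (h : x ≠ y) : IsArc (segment ℝ x y) x y := by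
  refine ⟨fun t => x + t • (y - x), by fun_prop, ?_, by simp, by simp, ?_⟩
  · intro s _ t _ hst
    have h1 : ((s - t : ℝ)) • (y - x) = 0 := by
      rw [sub_smul, sub_eq_zero]; simpa using hst
    rcases smul_eq_zero.1 h1 with h2 | h2
    · linarith
    · exact (h (sub_eq_zero.1 h2).symm).elim
  · rw [segment_eq_image']

theorem IsArc.concat {S T : Set ℂ} {x y z : ℂ} (h : IsArc S x y) (h' : IsArc T y z)
    (hST : S ∩ T ⊆ {y}) : IsArc (S ∪ T) x z := by
  classical
  obtain ⟨f, hf, hi, h0, h1, hS⟩ := h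
  obtain ⟨g, hg, hj, g0, g1, hT⟩ := h'
  let k : ℝ → ℂ := fun t => if t ≤ 1 then f t else g (t - 1)
  have kf : EqOn k f (Icc 0 1) := fun t ht => by simp [k, ht.2]
  have kg : EqOn k (fun t => g (t - 1)) (Icc 1 2) := fun t ht => by
    rcases eq_or_lt_of_le ht.1 with h | h
    · simp [k, ← h, h1, g0]
    · simp [k, not_le.2 h]
  have hm : MapsTo (fun t : ℝ => t - 1) (Icc 1 2) (Icc 0 1) := fun t ht =>
    ⟨by linarith [ht.1], by linarith [ht.2]⟩
  have hU : Icc (0:ℝ) 1 ∪ Icc 1 2 = Icc 0 2 := Icc_union_Icc_eq_Icc (by norm_num) (by norm_num)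
  have c1 : ContinuousOn k (Icc 0 2) := by
    rw [← hU]
    exact ContinuousOn.union_of_isClosed (hf.congr kf)
      ((hg.comp (by fun_prop) hm).congr kg) isClosed_Icc isClosed_Icc
  have aux : ∀ s t : ℝ, s ∈ Icc (0:ℝ) 1 → t ∈ Icc (1:ℝ) 2 → f s = g (t - 1) → s = t := by
    intro s t hs ht hst
    have hy : f s = y := hST ⟨by rw [← hS]; exact ⟨s, hs, rfl⟩,
      by rw [hst, ← hT]; exact ⟨t - 1, hm ht, rfl⟩⟩
    have e1 : s = 1 := hi hs (by simp) (by rw [hy, h1])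
    have e2 : t - 1 = 0 := hj (hm ht) (by simp) (by rw [← hst, hy, g0])
    linarith
  have c2 : InjOn k (Icc 0 2) := by
    rw [← hU]
    rintro s (hs | hs) t (ht | ht) hst
    · rw [kf hs, kf ht] at hst; exact hi hs ht hst
    · rw [kf hs, kg ht] at hst; exact aux s t hs ht hst
    · rw [kg hs, kf ht] at hst; exact (aux t s ht hs hst.symm).symm
    · rw [kg hs, kg ht] at hst
      have := hj (hm hs) (hm ht) hst
      linarith
  have := isArc_image (by norm_num : (0:ℝ) < 2) c1 c2
  have e0 : k 0 = x := by rw [kf (by simp), h0]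
  have e2 : k 2 = z := by rw [kg (by simp)]; norm_num; exact g1
  rw [e0, e2, ← hU, image_union, kf.image_eq, kg.image_eq, hS] at this
  have e3 : (fun t => g (t - 1)) '' Icc 1 2 = T := by
    rw [← hT]
    apply Subset.antisymm
    · rintro _ ⟨t, ht, rfl⟩; exact ⟨_, hm ht, rfl⟩
    · rintro _ ⟨t, ht, rfl⟩
      exact ⟨t + 1, ⟨by linarith [ht.1], by linarith [ht.2]⟩, by simp⟩
  rwa [e3] at this

/-- cut an arc at the first hit with a closed set -/
theorem IsArc.first_hit {S Z : Set ℂ} {x y : ℂ} (h : IsArc S x y) (hZ : IsClosed Z)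
    (hy : y ∈ Z) (hx : x ∉ Z) : ∃ q T, IsArc T x q ∧ T ⊆ S ∧ T ∩ Z = {q} := by
  obtain ⟨f, hf, hi, h0, h1, hS⟩ := h
  have hK : IsCompact (Icc (0:ℝ) 1 ∩ f ⁻¹' Z) :=
    isCompact_Icc.of_isClosed_subset (hf.preimage_isClosed_of_isClosed isClosed_Icc hZ)
      inter_subset_left
  obtain ⟨t, ⟨ht, htZ⟩, hmin⟩ := hK.exists_isLeast ⟨1, by simp, by simpa [h1] using hy⟩
  have ht0 : 0 < t := lt_of_le_of_ne ht.1 (fun h => hx (by rw [← h0, h]; exact htZ))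
  have hsub : Icc 0 t ⊆ Icc (0:ℝ) 1 := Icc_subset_Icc le_rfl ht.2
  refine ⟨f t, f '' Icc 0 t, ?_, ?_, ?_⟩
  · have := isArc_image ht0 (hf.mono hsub) (hi.mono hsub)
    rwa [h0] at this
  · rw [← hS]; exact image_mono hsub
  · apply Subset.antisymm
    · rintro _ ⟨⟨s, hs, rfl⟩, hsZ⟩
      have : t ≤ s := hmin ⟨hsub hs, hsZ⟩
      rw [le_antisymm hs.2 this]; rfl
    · rintro _ rfl
      exact ⟨⟨t, ⟨ht0.le, le_rfl⟩, rfl⟩, htZ⟩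

theorem IsArc.split {S : Set ℂ} {x y q : ℂ} (h : IsArc S x y) (hq : q ∈ S) (hx : q ≠ x)
    (hy : q ≠ y) : ∃ T U, IsArc T x q ∧ IsArc U q y ∧ T ∪ U = S ∧ T ∩ U = {q} := by
  obtain ⟨f, hf, hi, h0, h1, hS⟩ := h
  rw [← hS] at hq
  obtain ⟨t, ht, rfl⟩ := hq
  have ht0 : 0 < t := lt_of_le_of_ne ht.1 (fun h => hx (by rw [← h0, h]))
  have ht1 : t < 1 := lt_of_le_of_ne ht.2 (fun h => hy (by rw [← h1, h]))
  have hsub : Icc 0 t ⊆ Icc (0:ℝ) 1 := Icc_subset_Icc le_rfl ht.2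
  have hsub' : Icc t 1 ⊆ Icc (0:ℝ) 1 := Icc_subset_Icc ht.1 le_rfl
  refine ⟨f '' Icc 0 t, f '' Icc t 1, ?_, ?_, ?_, ?_⟩
  · have := isArc_image ht0 (hf.mono hsub) (hi.mono hsub)
    rwa [h0] at this
  · have := isArc_image ht1 (hf.mono hsub') (hi.mono hsub')
    rwa [h1] at this
  · rw [← image_union, Icc_union_Icc_eq_Icc ht.1 ht.2, hS]
  · rw [← hi.image_inter hsub hsub', Icc_inter_Icc_eq_singleton ht.1 ht.2, image_singleton]

/-- near the end `y`, an arc can be cut such that the tail stays in a given neighbourhood -/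
theorem IsArc.tail {S : Set ℂ} {x y : ℂ} (h : IsArc S x y) {R : ℝ} (hR : 0 < R)
    (hxR : R < dist x y) : ∃ q T U, IsArc T x q ∧ IsArc U q y ∧ T ∪ U = S ∧ T ∩ U = {q} ∧
      U ⊆ Metric.ball y R := by
  obtain ⟨f, hf, hi, h0, h1, hS⟩ := h
  have := (hf 1 (by simp)).tendsto.eventually (Metric.ball_mem_nhds _ hR)
  rw [h1, eventually_iff, Metric.mem_nhdsWithin_iff] at this
  obtain ⟨δ, hδ, hb⟩ := this
  set t := max (1 - δ / 2) 0 with ht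
  have e1 : t < 1 := max_lt (by linarith) (by norm_num)
  have htI : t ∈ Icc (0:ℝ) 1 := ⟨le_max_right _ _, e1.le⟩
  have hin : ∀ s ∈ Icc t 1, f s ∈ Metric.ball y R := by
    intro s hs
    have hs0 : 0 ≤ s := (le_max_right _ _).trans hs.1
    refine hb ⟨?_, hs0, hs.2⟩
    rw [Metric.mem_ball, Real.dist_eq, abs_lt]
    have := (le_max_left (1 - δ / 2) 0).trans hs.1
    constructor <;> linarith [hs.2]
  have ht0 : 0 < t := by
    rcases eq_or_lt_of_le htI.1 with h | h
    · have := hin t ⟨le_rfl, e1.le⟩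
      rw [← h, h0, Metric.mem_ball] at this; linarith
    · exact h
  have hsub : Icc 0 t ⊆ Icc (0:ℝ) 1 := Icc_subset_Icc le_rfl htI.2
  have hsub' : Icc t 1 ⊆ Icc (0:ℝ) 1 := Icc_subset_Icc htI.1 le_rfl
  refine ⟨f t, f '' Icc 0 t, f '' Icc t 1, ?_, ?_, ?_, ?_, ?_⟩
  · have := isArc_image ht0 (hf.mono hsub) (hi.mono hsub)
    rwa [h0] at this
  · have := isArc_image e1 (hf.mono hsub') (hi.mono hsub')
    rwa [h1] at this
  · rw [← image_union, Icc_union_Icc_eq_Icc htI.1 htI.2, hS]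
  · rw [← hi.image_inter hsub hsub', Icc_inter_Icc_eq_singleton htI.1 htI.2, image_singleton]
  · rintro _ ⟨s, hs, rfl⟩; exact hin s hs

theorem IsArc.hasLog {S : Set ℂ} {x y : ℂ} (h : IsArc S x y) {φ : ℂ → ℂ}
    (hφ : ContinuousOn φ S) (h0 : ∀ z ∈ S, φ z ≠ 0) : HasLog φ S := by
  obtain ⟨f, hf, hi, -, -, hS⟩ := h
  have hmem : ∀ t : ℝ, f (projIcc 0 1 zero_le_one t) ∈ S := fun t => by
    rw [← hS]; exact ⟨_, (projIcc 0 1 zero_le_one t).2, rfl⟩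
  have hc : Continuous fun t : ℝ => φ (f (projIcc 0 1 zero_le_one t)) := by
    refine hφ.comp_continuous ?_ hmem
    exact hf.comp_continuous (by fun_prop) (fun t => (projIcc 0 1 zero_le_one t).2)
  obtain ⟨L, hL, hLe⟩ := exists_log _ hc (fun t => h0 _ (hmem t))
  let e : Icc (0:ℝ) 1 → ℂ := fun t => f t
  have he : Topology.IsClosedEmbedding e := by
    refine Continuous.isClosedEmbedding ?_ ?_
    · exact hf.comp_continuous (by fun_prop) (fun t => t.2)
    · intro s t hst; exact Subtype.ext (hi s.2 t.2 hst)
  obtain ⟨M, hM⟩ := ContinuousMap.exists_extension he (⟨fun t => L t, by fun_prop⟩ : C(Icc (0:ℝ) 1, ℂ))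
  refine ⟨M, M.continuous.continuousOn, ?_⟩
  intro z hz
  rw [← hS] at hz
  obtain ⟨t, ht, rfl⟩ := hz
  have h1 := congrArg (fun k : C(Icc (0:ℝ) 1, ℂ) => k ⟨t, ht⟩) hM
  have h2 : M (f t) = L t := h1
  rw [h2, hLe]
  simp [projIcc_of_mem zero_le_one ht]

theorem IsArc.Lk {S : Set ℂ} {x y p q : ℂ} (h : IsArc S x y) (hp : p ∉ S) (hq : q ∉ S) :
    Lk S p q := by
  have hne : ∀ {p : ℂ}, p ∉ S → ∀ z ∈ S, z - p ≠ 0 := fun hp z hz h0 =>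
    hp (by rw [← sub_eq_zero.1 h0]; exact hz)
  refine Lk_of_hasLog h.isCompact hp hq (h.hasLog ?_ ?_)
  · unfold mob
    exact ContinuousOn.div (by fun_prop) (by fun_prop) (hne hq)
  · intro z hz; exact div_ne_zero (hne hp z hz) (hne hq z hz)

/-- extend an arc along a segment -/
theorem IsArc.extend_seg {S : Set ℂ} {x p v : ℂ} (h : IsArc S x p) (hv : v ∉ S)
    (hx : x ∉ segment ℝ p v) : ∃ q T, IsArc T x q ∧ T ⊆ S ∧ q ∈ segment ℝ p v ∧ q ≠ v ∧
      T ∩ segment ℝ q v ⊆ {q} ∧ segment ℝ q v ⊆ segment ℝ p v := by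
  obtain ⟨q, T, h1, h2, h3⟩ := h.first_hit (Z := segment ℝ p v)
    (by rw [segment_eq_image']; exact (isCompact_Icc.image (by fun_prop)).isClosed)
    (left_mem_segment ℝ p v) hx
  have hq : q ∈ T ∩ segment ℝ p v := by rw [h3]; rfl
  have hs : segment ℝ q v ⊆ segment ℝ p v :=
    (convex_segment p v).segment_subset hq.2 (right_mem_segment ℝ p v)
  refine ⟨q, T, h1, h2, hq.2, ?_, ?_, hs⟩
  · rintro rfl; exact hv (h2 hq.1)
  · rw [← h3]; exact inter_subset_inter_right _ hs

/-- arcs in an open connected set together with an accessible boundary point -/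
theorem exists_arc {F : Set ℂ} (hF : IsOpen F) (hFc : IsPreconnected F) {x z p : ℂ}
    (hx : x ∉ F) (hz : z ∈ F) (hp : p ∈ F) (hzx : segment ℝ z x \ {x} ⊆ F) :
    ∃ S, IsArc S x p ∧ S ⊆ F ∪ {x} := by
  have step : ∀ {p p'}, (∃ S, IsArc S x p ∧ S ⊆ F ∪ {x}) → segment ℝ p p' ⊆ F →
      ∃ S, IsArc S x p' ∧ S ⊆ F ∪ {x} := by
    rintro p p' ⟨S, hS, hSF⟩ hseg
    by_cases hv : p' ∈ S
    · by_cases hpp : p' = p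
      · subst hpp; exact ⟨S, hS, hSF⟩
      · obtain ⟨T, U, h1, h2, h3, h4⟩ := hS.split hv
          (fun h => hx (by rw [← h]; exact hseg (right_mem_segment ℝ p p'))) hpp
        exact ⟨T, h1, fun w hw => hSF (by rw [← h3]; exact Or.inl hw)⟩
    · obtain ⟨q, T, h1, h2, h3, h4, h5, h6⟩ := hS.extend_seg hv (fun h => hx (hseg h))
      exact ⟨_, h1.concat (isArc_segment h4) h5,
        union_subset (h2.trans hSF) ((h6.trans hseg).trans subset_union_left)⟩
  refine hFc.induction₂ (fun p q => (∃ S, IsArc S x p ∧ S ⊆ F ∪ {x}) ↔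
    (∃ S, IsArc S x q ∧ S ⊆ F ∪ {x})) (fun p hp => ?_) (fun _ _ _ _ _ _ h1 h2 => h1.trans h2)
    (fun _ _ _ _ h => h.symm) hz hp |>.1 ?_
  · obtain ⟨ε, hε, hb⟩ := Metric.isOpen_iff.1 hF p hp
    filter_upwards [mem_nhdsWithin_of_mem_nhds (Metric.ball_mem_nhds p hε)] with q hq
    have h1 : segment ℝ p q ⊆ F :=
      ((convex_ball p ε).segment_subset (Metric.mem_ball_self hε) hq).trans hb
    exact ⟨fun h => step h h1, fun h => step h (by rwa [segment_symm])⟩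
  · have hxz : x ≠ z := fun h => hx (by rw [h]; exact hz)
    refine ⟨segment ℝ x z, isArc_segment hxz, fun w hw => ?_⟩
    by_cases hwx : w = x
    · exact Or.inr hwx
    · exact Or.inl (hzx ⟨by rwa [segment_symm], hwx⟩)

end TG

namespace TG
open Set Complex Filter Topology Metric
open scoped ComplexConjugate

/-- orientation determinant -/
noncomputable def dt (A B z : ℂ) : ℝ := ((z - A) * conj (B - A)).im

theorem seg_ball {v x y z : ℂ} {r : ℝ} (hr : 0 < r) (hx : x ∈ closedBall v r)
    (hy : y ∈ closedBall v r) (hz : z ∈ segment ℝ x y) (h1 : z ≠ x) (h2 : z ≠ y) :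
    z ∈ ball v r := by
  have hxy : x ≠ y := by
    rintro rfl; rw [segment_same] at hz; exact h1 hz
  have := (strictConvex_closedBall ℝ v r).openSegment_subset hx hy hxy
    (mem_openSegment_of_ne_left_right (Ne.symm h1) (Ne.symm h2) hz)
  rwa [interior_closedBall v hr.ne'] at this

theorem arg_gt {ε : ℝ} (h0 : 0 < ε) (h1 : ε < 1 / 2) : Real.pi / 4 < arg (ε + I * (1 / 2 : ℝ)) := by
  have hre : (ε + I * (1 / 2 : ℝ) : ℂ).re = ε := by simp
  have him : (ε + I * (1 / 2 : ℝ) : ℂ).im = 1 / 2 := by simp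
  have habs : |arg (ε + I * (1 / 2 : ℝ) : ℂ)| < Real.pi / 2 :=
    abs_arg_lt_pi_div_two_iff.2 (Or.inl (by rw [hre]; exact h0))
  have ht := tan_arg (ε + I * (1 / 2 : ℝ) : ℂ)
  rw [hre, him] at ht
  by_contra hle
  rw [not_lt] at hle
  have h3 := Real.strictMonoOn_tan.monotoneOn ⟨(abs_lt.1 habs).1, (abs_lt.1 habs).2⟩
    ⟨by linarith [Real.pi_pos], by linarith [Real.pi_pos]⟩ hle
  rw [ht, Real.tan_pi_div_four, div_le_one h0] at h3
  linarith

theorem not_Lk_chord {v p1 p3 : ℂ} {r : ℝ} (h1 : dist p1 v = r) (h3 : dist p3 v = r)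
    (hne : p1 ≠ p3) {Y : Set ℂ} (hYc : IsCompact Y) (hY : IsPreconnected Y)
    (hp1 : p1 ∈ Y) (hp3 : p3 ∈ Y) (hout : ∀ z ∈ Y, r ≤ dist z v) :
    ∃ p ∈ ball v r, ∃ q ∈ ball v r, 0 < dt p1 p3 p ∧ dt p1 p3 q < 0 ∧
      ¬ Lk (Y ∪ segment ℝ p1 p3) p q := by
  have hr : 0 < r := by
    rcases (dist_nonneg (x := p1) (y := v)).eq_or_lt with h | h
    · exfalso; apply hne
      rw [← h1, ← h] at h3
      rw [dist_eq_zero.1 h.symm, dist_eq_zero.1 h3]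
    · linarith
  set e := p3 - p1 with he
  have he0 : e ≠ 0 := sub_ne_zero.2 (Ne.symm hne)
  have hen : 0 < ‖e‖ := norm_pos_iff.2 he0
  set m := (p1 + p3) / 2 with hm
  have hmseg : m ∈ segment ℝ p1 p3 := by
    refine ⟨1/2, 1/2, by norm_num, by norm_num, by norm_num, ?_⟩
    rw [hm]; simp only [real_smul]; push_cast; ring
  have hmb : m ∈ ball v r := by
    refine seg_ball hr h1.le h3.le hmseg (fun h => hne ?_) (fun h => hne ?_)
    · rw [hm] at h; linear_combination (-2) * h
    · rw [hm] at h; linear_combination 2 * h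
  set d := r - dist m v with hd
  have hd0 : 0 < d := sub_pos.2 hmb
  obtain ⟨ε, hε0, hε1, hε2⟩ : ∃ ε : ℝ, 0 < ε ∧ ε < 1/2 ∧ ε * ‖e‖ < d := by
    refine ⟨min (1/4) (d / (2 * ‖e‖)), by positivity, ?_, ?_⟩
    · exact (min_le_left _ _).trans_lt (by norm_num)
    · calc _ ≤ d / (2 * ‖e‖) * ‖e‖ := by gcongr; exact min_le_right _ _
        _ = d / 2 := by field_simp
        _ < d := by linarith
  set η := I * ε * e with hη
  have hηn : ‖η‖ = ε * ‖e‖ := by simp [hη, abs_of_pos hε0]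
  have hb : ∀ x, ‖x - m‖ < d → x ∈ ball v r := by
    intro x hx
    rw [mem_ball]
    have := dist_triangle x m v
    rw [dist_eq_norm x m] at this
    linarith
  have hside : ∀ s : ℝ, dt p1 p3 (m + I * s * e) = s * normSq e := by
    intro s
    have e1 : (m + I * s * e - p1) = (1 / 2 + I * s) * e := by rw [hm, he]; ring
    rw [dt, ← he, e1, mul_assoc, mul_conj]
    simp
  refine ⟨m + η, hb _ (by simpa [hηn] using hε2), m - η, hb _ (by simpa [hηn] using hε2), ?_, ?_, ?_⟩
  · rw [hη, hside]; exact mul_pos hε0 (normSq_pos.2 he0)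
  · have : m - η = m + I * ((-ε : ℝ) : ℂ) * e := by rw [hη]; push_cast; ring
    rw [this, hside]
    have := mul_pos hε0 (normSq_pos.2 he0)
    linarith
  intro hLk
  have hsc : IsArc (segment ℝ p1 p3) p1 p3 := isArc_segment hne
  obtain ⟨L, hL, hLe⟩ := hasLog_of_Lk (hYc.union hsc.isCompact).isClosed hLk
  -- the log on Y
  have hY1 : ∀ z ∈ Y, z - (m - η) ≠ 0 ∧ 0 < (mob (m + η) (m - η) z).re := by
    intro z hz
    have hzm : ‖η‖ < ‖z - m‖ := by
      rw [hηn]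
      have := hout z hz
      have h2 := dist_triangle z m v
      rw [dist_eq_norm z m] at h2
      linarith
    have hz0 : z - (m - η) ≠ 0 := by
      intro h0
      have : z - m = - η := by linear_combination h0
      rw [this, norm_neg] at hzm; exact lt_irrefl _ hzm
    refine ⟨hz0, ?_⟩
    have hsq : normSq η < normSq (z - m) := by
      rw [normSq_eq_norm_sq, normSq_eq_norm_sq]
      exact pow_lt_pow_left₀ hzm (norm_nonneg _) (by norm_num)
    rw [mob, div_eq_mul_inv, inv_def, ← mul_assoc, re_mul_ofReal]
    refine mul_pos ?_ (inv_pos.2 (normSq_pos.2 hz0))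
    have : z - (m + η) = (z - m) - η := by ring
    rw [this]
    have : z - (m - η) = (z - m) + η := by ring
    rw [this]
    simp only [normSq_apply] at hsq
    simp only [mul_re, sub_re, sub_im, add_re, add_im, conj_re, conj_im, map_add]
    simp only [sub_re, sub_im] at hsq
    nlinarith
  have k1 := const_of_exp_eq hY (f := L) (g := fun z => log (mob (m + η) (m - η) z))
    (hL.mono subset_union_left) (by
      refine ContinuousOn.clog ?_ (fun z hz => Or.inl (hY1 z hz).2)
      unfold mob
      exact ContinuousOn.div (by fun_prop) (by fun_prop) (fun z hz => (hY1 z hz).1))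
    (fun z hz => by
      rw [hLe z (Or.inl hz), exp_log]
      intro h0
      have := (hY1 z hz).2
      rw [h0] at this; simp at this) hp1 hp3
  -- the log on the chord
  have hw : ∀ z ∈ segment ℝ p1 p3, ∃ s : ℝ, z = m + s * e := by
    rintro z ⟨a, b, ha, hb, hab, rfl⟩
    refine ⟨b - 1/2, ?_⟩
    have : (a : ℂ) = 1 - b := by rw [← ofReal_one, ← ofReal_sub, ← hab]; simp
    rw [hm, he]; simp only [real_smul]; push_cast; rw [this]; ring
  have hpos : ∀ s : ℝ, 0 < ((ε : ℂ) + I * s).re ∧ 0 < ((ε : ℂ) - I * s).re := by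
    intro s; simp [hε0]
  have k2 := const_of_exp_eq hsc.isPreconnected (f := L)
    (g := fun z => log (ε + I * ((z - m) / e)) - log (ε - I * ((z - m) / e)) + Real.pi * I)
    (hL.mono subset_union_right) (by
      refine ContinuousOn.add (ContinuousOn.sub (ContinuousOn.clog (by fun_prop) ?_)
        (ContinuousOn.clog (by fun_prop) ?_)) continuousOn_const
      · intro z hz
        obtain ⟨s, rfl⟩ := hw z hz
        rw [add_sub_cancel_left, mul_div_cancel_right₀ _ he0]
        exact Or.inl (hpos s).1
      · intro z hz
        obtain ⟨s, rfl⟩ := hw z hz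
        rw [add_sub_cancel_left, mul_div_cancel_right₀ _ he0]
        exact Or.inl (hpos s).2)
    (fun z hz => by
      obtain ⟨s, rfl⟩ := hw z hz
      rw [hLe _ (Or.inr hz)]
      simp only [add_sub_cancel_left, mul_div_cancel_right₀ _ he0]
      have n1 : (ε : ℂ) + I * s ≠ 0 := fun h => by have := (hpos s).1; rw [h] at this; simp at this
      have n2 : (ε : ℂ) - I * s ≠ 0 := fun h => by have := (hpos s).2; rw [h] at this; simp at this
      rw [exp_add, exp_sub, exp_log n1, exp_log n2, exp_pi_mul_I, mob]
      have n3 : m + s * e - (m - η) = I * e * (ε - I * s) := by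
        rw [hη]; linear_combination ((s : ℂ) * e) * I_sq
      have n4 : m + s * e - (m + η) = - (I * e * (ε + I * s)) := by
        rw [hη]; linear_combination ((s : ℂ) * e) * I_sq
      rw [n3, n4]
      field_simp) hsc.left_mem hsc.right_mem
  have w1 : (p1 - m) / e = -((1 / 2 : ℝ) : ℂ) := by
    rw [div_eq_iff he0, hm, he]; push_cast; ring
  have w3 : (p3 - m) / e = ((1 / 2 : ℝ) : ℂ) := by
    rw [div_eq_iff he0, hm, he]; push_cast; ring
  simp only [w1, w3] at k2
  have a1 := abs_lt.1 (abs_arg_lt_pi_div_two_iff.2 (Or.inl (hY1 p1 hp1).2))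
  have a3 := abs_lt.1 (abs_arg_lt_pi_div_two_iff.2 (Or.inl (hY1 p3 hp3).2))
  have b1 := arg_gt hε0 hε1
  have b2 : arg ((ε : ℂ) - I * (1 / 2 : ℝ)) = - arg (ε + I * (1 / 2 : ℝ)) := by
    have : (ε : ℂ) - I * (1 / 2 : ℝ) = conj ((ε : ℂ) + I * (1 / 2 : ℝ)) := by
      apply Complex.ext <;> simp
    rw [this, arg_conj, if_neg]
    intro h
    have := abs_arg_lt_pi_div_two_iff.2 (Or.inl (hpos (1/2)).1)
    rw [h, abs_of_pos Real.pi_pos] at this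
    linarith [Real.pi_pos]
  have i1 := congrArg im k1
  have i2 := congrArg im k2
  rw [mul_neg, sub_neg_eq_add, ← sub_eq_add_neg] at i2
  simp only [sub_im, add_im, log_im] at i1 i2
  rw [b2] at i2
  linarith

/-- crossing lemma -/
theorem crossing {v p1 p2 p3 p4 : ℂ} {r : ℝ} (h1 : dist p1 v = r) (h2 : dist p2 v = r)
    (h3 : dist p3 v = r) (h4 : dist p4 v = r) {Y Z : Set ℂ} (hYc : IsCompact Y)
    (hY : IsPreconnected Y) (hZ : IsPreconnected Z) (m1 : p1 ∈ Y) (m3 : p3 ∈ Y) (m2 : p2 ∈ Z)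
    (m4 : p4 ∈ Z) (hYo : ∀ z ∈ Y, r ≤ dist z v) (hZo : ∀ z ∈ Z, r ≤ dist z v)
    (hs : dt p1 p3 p2 * dt p1 p3 p4 < 0) : (Y ∩ Z).Nonempty := by
  by_contra hemp
  rw [not_nonempty_iff_eq_empty] at hemp
  have hdis : ∀ z ∈ Z, z ∉ Y := fun z hz hy => by
    have : z ∈ Y ∩ Z := ⟨hy, hz⟩
    rw [hemp] at this; exact this
  wlog hpos : 0 < dt p1 p3 p2 generalizing p2 p4
  · refine this h4 h2 m4 m2 (by linarith [mul_comm (dt p1 p3 p2) (dt p1 p3 p4)]) ?_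
    rcases mul_neg_iff.1 hs with h | h
    · exact absurd h.1 hpos
    · exact h.2
  have hneg : dt p1 p3 p4 < 0 := by
    rcases mul_neg_iff.1 hs with h | h
    · exact h.2
    · linarith [h.1]
  have hne : p1 ≠ p3 := by
    rintro rfl
    simp [dt] at hpos
  obtain ⟨p, hp, q, hq, dp, dq, hn⟩ := not_Lk_chord h1 h3 hne hYc hY m1 m3 hYo
  have hr : 0 < r := pos_of_mem_ball hp
  have lin : ∀ a b : ℝ, ∀ x y : ℂ, a + b = 1 →
      dt p1 p3 (a • x + b • y) = a * dt p1 p3 x + b * dt p1 p3 y := by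
    intro a b x y hab
    obtain rfl : a = 1 - b := by linarith
    simp [dt]; ring
  have hch : ∀ z ∈ segment ℝ p1 p3, dt p1 p3 z = 0 := by
    rintro z ⟨a, b, _, _, hab, rfl⟩
    rw [lin a b _ _ hab]
    simp [dt]; right; ring
  have hZch : ∀ z ∈ Z, z ∉ segment ℝ p1 p3 := by
    intro z hz hzs
    by_cases e1 : z = p1
    · exact hdis z hz (by rw [e1]; exact m1)
    by_cases e3 : z = p3
    · exact hdis z hz (by rw [e3]; exact m3)
    have := seg_ball hr h1.le h3.le hzs e1 e3
    rw [mem_ball] at this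
    linarith [hZo z hz]
  have seg : ∀ {x y : ℂ}, x ∈ ball v r → dist y v = r → y ∈ Z → 0 < dt p1 p3 x * dt p1 p3 y →
      Lk (Y ∪ segment ℝ p1 p3) x y := by
    intro x y hx hy hyZ hxy
    refine ⟨segment ℝ x y, (convex_segment x y).isPreconnected, ?_, left_mem_segment ℝ x y,
      right_mem_segment ℝ x y⟩
    intro z hz hzX
    by_cases ey : z = y
    · rw [ey] at hzX
      exact hzX.elim (hdis y hyZ) (hZch y hyZ)
    have hzb : z ∈ ball v r := by
      by_cases ex : z = x
      · rw [ex]; exact hx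
      · exact seg_ball hr (ball_subset_closedBall hx) hy.le hz ex ey
    rcases hzX with h | h
    · rw [mem_ball] at hzb; linarith [hYo z h]
    · have e0 := hch z h
      obtain ⟨a, b, ha, hb, hab, rfl⟩ := hz
      rw [lin a b _ _ hab] at e0
      rcases mul_pos_iff.1 hxy with ⟨u, w⟩ | ⟨u, w⟩
      · rcases eq_or_lt_of_le ha with h | h
        · nlinarith
        · nlinarith [mul_pos h u, mul_nonneg hb w.le]
      · rcases eq_or_lt_of_le ha with h | h
        · nlinarith
        · nlinarith [mul_pos h (neg_pos.2 u), mul_nonneg hb (neg_pos.2 w).le]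
  have l1 := seg hp h2 m2 (mul_pos dp hpos)
  have l2 := seg hq h4 m4 (mul_pos_of_neg_of_neg dq hneg)
  have l3 : Lk (Y ∪ segment ℝ p1 p3) p2 p4 :=
    ⟨Z, hZ, fun z hz h => h.elim (hdis z hz) (hZch z hz), m2, m4⟩
  exact hn (l1.trans (l3.trans l2.symm))

end TG

namespace TG
open Set Complex Filter Topology Metric
open scoped ComplexConjugate

theorem dt_lin (A B : ℂ) {a b : ℝ} (x y : ℂ) (hab : a + b = 1) :
    dt A B (a • x + b • y) = a * dt A B x + b * dt A B y := by
  obtain rfl : a = 1 - b := by linarith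
  simp [dt]; ring

theorem dt_left (A B : ℂ) : dt A B A = 0 := by simp [dt]

theorem dt_right (A B : ℂ) : dt A B B = 0 := by simp [dt]; ring

theorem dt_seg {A B z : ℂ} (hz : z ∈ segment ℝ A B) : dt A B z = 0 := by
  obtain ⟨a, b, _, _, hab, rfl⟩ := hz
  rw [dt_lin A B _ _ hab, dt_left, dt_right]; simp

theorem Lk.notMem {X : Set ℂ} {p q : ℂ} (h : Lk X p q) : p ∉ X := by
  obtain ⟨C, _, c2, c3, _⟩ := h; exact c2 c3

theorem comp_closure {α β : Set ℂ} {x y : ℂ} (hα : IsArc α x y) (hβ : IsArc β x y)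
    (hαβ : α ∩ β ⊆ {x, y}) {p q : ℂ} (hp : p ∉ α ∪ β) (hn : ¬ Lk (α ∪ β) p q)
    (hq : q ∉ α ∪ β) : α ∪ β ⊆ closure (connectedComponentIn (α ∪ β)ᶜ p) := by
  intro j hj
  by_contra hcl
  wlog hjα : j ∈ α generalizing α β
  · exact this hβ hα (by rwa [inter_comm]) (by rwa [union_comm]) (by rwa [union_comm])
      (by rwa [union_comm]) (by rwa [union_comm]) (by rwa [union_comm]) (hj.resolve_left hjα)
  set D := connectedComponentIn (α ∪ β)ᶜ p with hD
  obtain ⟨ε, hε, hb⟩ := Metric.isOpen_iff.1 isClosed_closure.isOpen_compl j hcl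
  -- an interior point
  obtain ⟨j', hj', hjx, hjy, ε', hε', hb'⟩ : ∃ j' ∈ α, j' ≠ x ∧ j' ≠ y ∧ ∃ ε' > 0,
      ball j' ε' ⊆ ball j ε := by
    have aux : ∀ {x y : ℂ}, IsArc α x y → j = y → ∃ j' ∈ α, j' ≠ x ∧ j' ≠ y ∧ ∃ ε' > 0,
      ball j' ε' ⊆ ball j ε := by
      rintro x y hα rfl
      have hxy := dist_pos.2 hα.ne
      obtain ⟨q, T, U, h1, h2, h3, h4, h5⟩ := hα.tail (R := min ε (dist x j / 2))
        (by positivity) ((min_le_right _ _).trans_lt (by linarith))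
      have hq := h5 h2.left_mem
      obtain ⟨ε', h6, h7⟩ := Metric.isOpen_iff.1 isOpen_ball q
        (ball_subset_ball (min_le_left _ _) hq)
      exact ⟨q, by rw [← h3]; exact Or.inl h1.right_mem, h1.ne.symm, h2.ne, ε', h6, h7⟩
    by_cases h1 : j = y
    · exact aux hα h1
    by_cases h2 : j = x
    · obtain ⟨j', a1, a2, a3, a4⟩ := aux hα.symm h2
      exact ⟨j', a1, a3, a2, a4⟩
    exact ⟨j, hjα, h2, h1, ε, hε, Subset.rfl⟩
  obtain ⟨T, U, hT, hU, hTU, hTUi⟩ := hα.split hj' hjx hjy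
  have dx := dist_pos.2 hT.ne
  have dy := dist_pos.2 hU.ne.symm
  obtain ⟨q1, T1, T2, a1, a2, a3, a4, a5⟩ := hT.tail (R := min ε' (dist x j' / 2))
    (by positivity) ((min_le_right _ _).trans_lt (by linarith))
  obtain ⟨q2, U1, U2, b1, b2, b3, b4, b5⟩ := hU.symm.tail (R := min ε' (dist y j' / 2))
    (by positivity) ((min_le_right _ _).trans_lt (by linarith))
  have hT1α : T1 ⊆ T := by rw [← a3]; exact subset_union_left
  have hU1α : U1 ⊆ U := by rw [← b3]; exact subset_union_left
  have hTα : T ⊆ α := by rw [← hTU]; exact subset_union_left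
  have hUα : U ⊆ α := by rw [← hTU]; exact subset_union_right
  have jT1 : j' ∉ T1 := fun h => a2.ne (by
    have : j' ∈ T1 ∩ T2 := ⟨h, a2.right_mem⟩
    rw [a4] at this; exact this.symm)
  have yT : y ∉ T := fun h => hU.ne (by
    have : y ∈ T ∩ U := ⟨h, hU.right_mem⟩
    rw [hTUi] at this; exact this.symm)
  have xU : x ∉ U := fun h => hT.ne (by
    have : x ∈ T ∩ U := ⟨hT.left_mem, h⟩
    rw [hTUi] at this; exact this)
  have c1 : IsArc (T1 ∪ β) q1 y := a1.symm.concat hβ (by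
    rintro z ⟨hz1, hz2⟩
    rcases hαβ ⟨hTα (hT1α hz1), hz2⟩ with h | h
    · exact h
    · exact absurd (hT1α hz1) (by rw [h]; exact yT))
  have c2 : IsArc (T1 ∪ β ∪ U1) q1 q2 := c1.concat b1 (by
    rintro z ⟨hz1 | hz1, hz2⟩
    · have : z ∈ T ∩ U := ⟨hT1α hz1, hU1α hz2⟩
      rw [hTUi] at this
      exact absurd hz1 (by rw [show z = j' from this]; exact jT1)
    · rcases hαβ ⟨hUα (hU1α hz2), hz1⟩ with h | h
      · exact absurd (hU1α hz2) (by rw [h]; exact xU)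
      · exact h)
  have hsub : T1 ∪ β ∪ U1 ⊆ α ∪ β := by
    rintro z ((h | h) | h)
    exacts [Or.inl (hTα (hT1α h)), Or.inr h, Or.inl (hUα (hU1α h))]
  have hcov : ∀ z ∈ α ∪ β, z ∉ ball j ε → z ∈ T1 ∪ β ∪ U1 := by
    rintro z (h | h) hz
    · rw [← hTU, ← a3, ← b3] at h
      rcases h with (h | h) | (h | h)
      · exact Or.inl (Or.inl h)
      · exact absurd (hb' (ball_subset_ball (min_le_left _ _) (a5 h))) hz
      · exact Or.inr h
      · exact absurd (hb' (ball_subset_ball (min_le_left _ _) (b5 h))) hz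
    · exact Or.inl (Or.inr h)
  obtain ⟨C, e1, e2, e3, e4⟩ := c2.Lk (fun h => hp (hsub h)) (fun h => hq (hsub h))
  have hcl' : IsClosed (α ∪ β) := (hα.isCompact.union hβ.isCompact).isClosed
  have hDo : IsOpen D := hcl'.isOpen_compl.connectedComponentIn
  have hpD : p ∈ D := mem_connectedComponentIn hp
  have := e1.subset_of_closure_inter_subset hDo ⟨p, e3, hpD⟩ (by
    rintro z ⟨hz1, hz2⟩
    by_contra hzD
    have hzf : z ∈ α ∪ β := frontier_comp hcl' p (by rw [hDo.frontier_eq]; exact ⟨hz1, hzD⟩)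
    exact e2 hz2 (hcov z hzf (fun h => hb h hz1)))
  exact hn (Lk_of_mem_comp hp (this e4))

/-- truncating an arc near its end point -/
theorem IsArc.trunc {S : Set ℂ} {y x : ℂ} (h : IsArc S y x) {R : ℝ} (hR : 0 < R)
    (hxR : R < dist y x) : ∃ r0 > 0, r0 ≤ R ∧ ∀ r, 0 < r → r < r0 → ∃ p T U, IsArc T y p ∧ T ⊆ S ∧
      dist p x = r ∧ T ∩ closedBall x r = {p} ∧ IsPreconnected U ∧ U ⊆ S ∧ U ⊆ ball x R ∧
      p ∈ U ∧ x ∈ U ∧ S ⊆ T ∪ U := by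
  obtain ⟨q, T, U, h1, h2, h3, h4, h5⟩ := h.tail hR hxR
  have hxT : x ∉ T := fun h => h2.ne (by
    have : x ∈ T ∩ U := ⟨h, h2.right_mem⟩
    rw [h4] at this; exact this.symm)
  obtain ⟨ε, hε, hb⟩ := Metric.isOpen_iff.1 h1.isCompact.isClosed.isOpen_compl x hxT
  refine ⟨min ε R, by positivity, min_le_right _ _, fun r hr hr0 => ?_⟩
  have hTr : ∀ z ∈ T, r < dist z x := by
    intro z hz
    by_contra hlt
    exact hb (mem_ball.2 ((not_lt.1 hlt).trans_lt (hr0.trans_le (min_le_left _ _)))) hz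
  obtain ⟨p, T', g1, g2, g3⟩ := h2.first_hit (Z := closedBall x r) isClosed_closedBall
    (mem_closedBall_self hr.le) (fun hm => by
      have := hTr q h1.right_mem
      rw [mem_closedBall] at hm; linarith)
  have hA : IsArc (T ∪ T') y p := h1.concat g1 (by
    rw [← h4]; exact inter_subset_inter_right _ g2)
  have hint : (T ∪ T') ∩ closedBall x r = {p} := by
    rw [union_inter_distrib_right, g3, union_eq_right]
    rintro z ⟨hz, hz'⟩
    rw [mem_closedBall] at hz'
    linarith [hTr z hz]
  have hp : p ∈ T' ∩ closedBall x r := by rw [g3]; rfl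
  have hdist : dist p x = r := by
    obtain ⟨z, hz, hzr⟩ := hA.isPreconnected.intermediate_value hA.right_mem hA.left_mem
      (f := fun z => dist z x) (by fun_prop) ⟨hp.2, (hTr y h1.left_mem).le⟩
    have : z ∈ (T ∪ T') ∩ closedBall x r := ⟨hz, hzr.le⟩
    rw [hint] at this
    rw [← show z = p from this]; exact hzr
  refine ⟨p, T ∪ T', U, hA, union_subset ?_ (g2.trans ?_), hdist, hint, h2.isPreconnected,
    ?_, h5, g2 hp.1, h2.right_mem, ?_⟩
  · rw [← h3]; exact subset_union_left
  · rw [← h3]; exact subset_union_right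
  · rw [← h3]; exact subset_union_right
  · rw [← h3]; exact union_subset_union_left _ subset_union_left

theorem jordan_sep {α β : Set ℂ} {x y : ℂ} (hα : IsArc α y x) (hβ : IsArc β y x)
    (hαβ : α ∩ β ⊆ {x, y}) : ∃ p q, p ∉ α ∪ β ∧ q ∉ α ∪ β ∧ ¬ Lk (α ∪ β) p q := by
  have hd := dist_pos.2 hα.ne
  set R := dist y x / 2 with hR
  obtain ⟨r1, hr1, hr1R, H1⟩ := hα.trunc (R := R) (by positivity) (by linarith)
  obtain ⟨r2, hr2, hr2R, H2⟩ := hβ.trunc (R := R) (by positivity) (by linarith)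
  set r := min r1 r2 / 2 with hr
  have hr0 : 0 < r := by positivity
  have hlt1 : r < r1 := by have := min_le_left r1 r2; linarith
  have hlt2 : r < r2 := by have := min_le_right r1 r2; linarith
  obtain ⟨p1, T1, U1, a1, a2, a3, a4, a5, a6, a7, a8, a9, a10⟩ := H1 r hr0 hlt1
  obtain ⟨p3, T3, U3, b1, b2, b3, b4, b5, b6, b7, b8, b9, b10⟩ := H2 r hr0 hlt2
  have hout : ∀ z ∈ T1 ∪ T3, r ≤ dist z x := by
    rintro z (hz | hz) <;> by_contra hlt
    · have : z ∈ T1 ∩ closedBall x r := ⟨hz, (not_le.1 hlt).le⟩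
      rw [a4] at this; rw [show z = p1 from this] at hlt; exact hlt a3.ge
    · have : z ∈ T3 ∩ closedBall x r := ⟨hz, (not_le.1 hlt).le⟩
      rw [b4] at this; rw [show z = p3 from this] at hlt; exact hlt b3.ge
  have hxT : x ∉ T1 ∪ T3 := fun h => by have := hout x h; rw [dist_self] at this; linarith
  have hYi : T1 ∩ T3 ⊆ {y} := by
    rintro z ⟨h1, h2⟩
    rcases hαβ ⟨a2 h1, b2 h2⟩ with h | h
    · exact absurd (Or.inl h1) (by rw [h]; exact hxT)
    · exact h
  have hY : IsArc (T1 ∪ T3) p1 p3 := a1.symm.concat b1 hYi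
  have hne := hY.ne
  obtain ⟨p, hp, q, hq, dp, dq, hn⟩ := not_Lk_chord a3 b3 hne hY.isCompact hY.isPreconnected
    hY.left_mem hY.right_mem hout
  have hch := isArc_segment hne
  have hchb : segment ℝ p1 p3 ⊆ closedBall x r :=
    (convex_closedBall x r).segment_subset a3.le b3.le
  have hYch : (T1 ∪ T3) ∩ segment ℝ p1 p3 ⊆ {p1, p3} := by
    rintro z ⟨h1 | h1, h2⟩
    · left
      have : z ∈ T1 ∩ closedBall x r := ⟨h1, hchb h2⟩
      rw [a4] at this; exact this
    · right
      have : z ∈ T3 ∩ closedBall x r := ⟨h1, hchb h2⟩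
      rw [b4] at this; exact this
  have notin : ∀ z ∈ ball x r, dt p1 p3 z ≠ 0 → z ∉ (T1 ∪ T3) ∪ segment ℝ p1 p3 := by
    rintro z hz hdz (h | h)
    · have := hout z h; rw [mem_ball] at hz; linarith
    · exact hdz (dt_seg h)
  have hpn := notin p hp dp.ne'
  have hqn := notin q hq dq.ne
  have cp := comp_closure hY hch hYch hpn hn hqn (Or.inl (Or.inl a1.left_mem))
  have cq := comp_closure hY hch hYch hqn (fun h => hn h.symm) hpn (Or.inl (Or.inl a1.left_mem))
  obtain ⟨p', hp'b, hp'⟩ := mem_closure_iff_nhds.1 cp _ (ball_mem_nhds y (by positivity : 0 < R))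
  obtain ⟨q', hq'b, hq'⟩ := mem_closure_iff_nhds.1 cq _ (ball_mem_nhds y (by positivity : 0 < R))
  have lp := Lk_of_mem_comp hpn hp'
  have lq := Lk_of_mem_comp hqn hq'
  have hdisj : ∀ z ∈ ball y R, z ∉ closedBall x R := by
    intro z hz hz'
    rw [mem_ball] at hz; rw [mem_closedBall] at hz'
    have := dist_triangle y z x
    rw [dist_comm y z] at this
    linarith
  have hJ : α ∪ β ⊆ (T1 ∪ T3) ∪ ball x R := by
    rintro z (h | h)
    · rcases a10 h with h | h
      exacts [Or.inl (Or.inl h), Or.inr (a7 h)]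
    · rcases b10 h with h | h
      exacts [Or.inl (Or.inr h), Or.inr (b7 h)]
  have hnJ : ∀ z ∈ ball y R, z ∉ (T1 ∪ T3) ∪ segment ℝ p1 p3 → z ∉ α ∪ β := by
    intro z hz hz2 hz3
    rcases hJ hz3 with h | h
    · exact hz2 (Or.inl h)
    · exact hdisj z hz (ball_subset_closedBall h)
  refine ⟨p', q', hnJ p' hp'b lp.symm.notMem, hnJ q' hq'b lq.symm.notMem, fun hL => hn ?_⟩
  refine lp.trans (Lk.trans ?_ lq.symm)
  obtain ⟨L, hLc, hLe⟩ := hasLog_of_Lk (hα.isCompact.union hβ.isCompact).isClosed hL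
  have hball : Lk (closedBall x R) p' q' :=
    ⟨ball y R, (convex_ball y R).isPreconnected, hdisj, hp'b, hq'b⟩
  obtain ⟨M, hMc, hMe⟩ := hasLog_of_Lk isClosed_closedBall hball
  have hU : U1 ∪ U3 ⊆ α ∪ β := union_subset_union a6 b6
  have hUb : U1 ∪ U3 ⊆ closedBall x R :=
    (union_subset a7 b7).trans ball_subset_closedBall
  have key := const_of_exp_eq (a5.union x a9 b9 b5) (hLc.mono hU) (hMc.mono hUb)
    (fun z hz => by rw [hLe z (hU hz), hMe z (hUb hz)]) (Or.inl a8) (Or.inr b8)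
  have hrR : closedBall x r ⊆ closedBall x R := closedBall_subset_closedBall (by linarith)
  have hYJ : T1 ∪ T3 ⊆ α ∪ β := union_subset_union a2 b2
  refine Lk_of_hasLog (hY.isCompact.union hch.isCompact) lp.symm.notMem lq.symm.notMem
    (HasLog.glue hY.isCompact.isClosed hch.isCompact.isClosed (hLc.mono hYJ)
    (fun z hz => hLe z (hYJ hz)) (hMc.mono (hchb.trans hrR)) (fun z hz => hMe z (hrR (hchb hz))) ?_)
  intro z hz w hw
  rcases hYch hz with h | h <;> rcases hYch hw with h' | h' <;> rw [h, h']
  · exact key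
  · exact key.symm

end TG

namespace TG
open Set Complex Filter Topology Metric
open scoped ComplexConjugate

lemma f31 : ∀ i : Fin 3, i + 1 ≠ i := by decide
lemma f32 : ∀ i : Fin 3, i + 2 ≠ i := by decide
lemma f33 : ∀ i : Fin 3, i + 1 ≠ i + 2 := by decide
lemma f34 : ∀ i : Fin 3, i + 2 + 1 = i := by decide
lemma f35 : ∀ i : Fin 3, i + 2 + 2 = i + 1 := by decide
lemma f36 : ∀ i : Fin 3, i + 1 + 1 = i + 2 := by decide
lemma f37 : ∀ i : Fin 3, i + 1 + 2 = i := by decide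
lemma f38 : ∀ s s' : Fin 3, s ≠ s' → ∃ t : Fin 3, ∀ q, q ≠ t → q = s ∨ q = s' := by decide

lemma unit_sq {a : ℂ} (h : ‖a‖ = 1) : a.re ^ 2 + a.im ^ 2 = 1 := by
  have := Complex.normSq_eq_norm_sq a
  rw [h, Complex.normSq_apply] at this; nlinarith

lemma unit_sq_le {a : ℂ} (h : ‖a‖ ≤ 1) : a.re ^ 2 + a.im ^ 2 ≤ 1 := by
  have := Complex.normSq_eq_norm_sq a
  rw [Complex.normSq_apply] at this; nlinarith [norm_nonneg a]

lemma inner_lt {a z : ℂ} (ha : ‖a‖ = 1) (hz : ‖z‖ ≤ 1) (hne : z ≠ a) :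
    a.re * z.re + a.im * z.im < 1 := by
  have h1 := unit_sq ha
  have h2 := unit_sq_le hz
  by_contra hc
  push Not at hc
  have h3 : (a.re - z.re) ^ 2 + (a.im - z.im) ^ 2 ≤ 0 := by nlinarith
  apply hne
  apply Complex.ext
  · nlinarith [sq_nonneg (a.re - z.re), sq_nonneg (a.im - z.im)]
  · nlinarith [sq_nonneg (a.re - z.re), sq_nonneg (a.im - z.im)]

lemma dt_formula (A B z : ℂ) : dt A B z =
    (z.im - A.im) * (B.re - A.re) - (z.re - A.re) * (B.im - A.im) := by
  simp [dt, Complex.mul_im]; ring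

noncomputable def bt (T : Fin 3 → ℂ) (s : Fin 3) (z : ℂ) : ℝ :=
  dt (T (s + 1)) (T (s + 2)) z * dt (T 0) (T 1) (T 2)

lemma dt_ne {a b c : ℂ} (ha : ‖a‖ = 1) (hb : ‖b‖ = 1) (hc : ‖c‖ = 1) (h1 : a ≠ b) (h2 : a ≠ c)
    (h3 : b ≠ c) : dt a b c ≠ 0 := by
  have e1 := inner_lt ha hb.le h1.symm
  have e2 := inner_lt ha hc.le h2.symm
  have e3 := inner_lt hb hc.le h3.symm
  have sa := unit_sq ha
  have sb := unit_sq hb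
  have sc := unit_sq hc
  rw [dt_formula]
  intro h
  -- D² = 2(1-ab)(1-ac)(1-bc)
  have : ((c.im - a.im) * (b.re - a.re) - (c.re - a.re) * (b.im - a.im)) ^ 2 =
     2 * (1 - (a.re * b.re + a.im * b.im)) * (1 - (a.re * c.re + a.im * c.im)) *
       (1 - (b.re * c.re + b.im * c.im)) := by
    grind
  rw [h] at this
  have h5 := mul_pos (mul_pos (sub_pos.2 e1) (sub_pos.2 e2)) (sub_pos.2 e3)
  nlinarith

structure Tri (T : Fin 3 → ℂ) : Prop where
  inj : Function.Injective T
  unit : ∀ i, ‖T i‖ = 1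

lemma Tri.D_ne {T} (h : Tri T) : dt (T 0) (T 1) (T 2) ≠ 0 :=
  dt_ne (h.unit _) (h.unit _) (h.unit _) (h.inj.ne (by decide)) (h.inj.ne (by decide))
    (h.inj.ne (by decide))

lemma bt_sum (T : Fin 3 → ℂ) (z : ℂ) : bt T 0 z + bt T 1 z + bt T 2 z = dt (T 0) (T 1) (T 2) ^ 2 := by
  simp only [bt, show (0 : Fin 3) + 1 = 1 from rfl, show (0 : Fin 3) + 2 = 2 from rfl,
    show (1 : Fin 3) + 1 = 2 from rfl, show (1 : Fin 3) + 2 = 0 from rfl,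
    show (2 : Fin 3) + 1 = 0 from rfl, show (2 : Fin 3) + 2 = 1 from rfl, dt_formula]
  ring

lemma bt_re (T : Fin 3 → ℂ) (z : ℂ) : bt T 0 z * (T 0).re + bt T 1 z * (T 1).re + bt T 2 z * (T 2).re
    = dt (T 0) (T 1) (T 2) ^ 2 * z.re := by
  simp only [bt, show (0 : Fin 3) + 1 = 1 from rfl, show (0 : Fin 3) + 2 = 2 from rfl,
    show (1 : Fin 3) + 1 = 2 from rfl, show (1 : Fin 3) + 2 = 0 from rfl,
    show (2 : Fin 3) + 1 = 0 from rfl, show (2 : Fin 3) + 2 = 1 from rfl, dt_formula]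
  ring

lemma bt_im (T : Fin 3 → ℂ) (z : ℂ) : bt T 0 z * (T 0).im + bt T 1 z * (T 1).im + bt T 2 z * (T 2).im
    = dt (T 0) (T 1) (T 2) ^ 2 * z.im := by
  simp only [bt, show (0 : Fin 3) + 1 = 1 from rfl, show (0 : Fin 3) + 2 = 2 from rfl,
    show (1 : Fin 3) + 1 = 2 from rfl, show (1 : Fin 3) + 2 = 0 from rfl,
    show (2 : Fin 3) + 1 = 0 from rfl, show (2 : Fin 3) + 2 = 1 from rfl, dt_formula]
  ring

lemma bt_ip (T : Fin 3 → ℂ) (z q : ℂ) :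
    ∑ i, bt T i z * (1 - (q.re * (T i).re + q.im * (T i).im)) =
      dt (T 0) (T 1) (T 2) ^ 2 * (1 - (q.re * z.re + q.im * z.im)) := by
  rw [Fin.sum_univ_three]
  linear_combination bt_sum T z - q.re * bt_re T z - q.im * bt_im T z

lemma Tri.sector {T} (h : Tri T) {p : ℂ} (hp : ‖p‖ = 1) (hn : ∀ i, p ≠ T i) :
    ∃ s, bt T s p < 0 := by
  by_contra hc
  push Not at hc
  have e := bt_ip T p p
  have hpp : p.re * p.re + p.im * p.im = 1 := by have := unit_sq hp; nlinarith
  rw [hpp, sub_self, mul_zero] at e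
  have pos : ∀ i, 0 < 1 - (p.re * (T i).re + p.im * (T i).im) := fun i =>
    sub_pos.2 (inner_lt hp (h.unit i).le (hn i).symm)
  have hz : ∀ i, bt T i p = 0 := by
    intro i
    have := (Finset.sum_eq_zero_iff_of_nonneg
      (fun i _ => mul_nonneg (hc i) (pos i).le)).1 e i (Finset.mem_univ i)
    exact (mul_eq_zero.1 this).resolve_right (pos i).ne'
  have := bt_sum T p
  rw [hz, hz, hz] at this
  exact h.D_ne (by nlinarith)

lemma Tri.third {T} (h : Tri T) {z : ℂ} (hz : ‖z‖ ≤ 1) (t : Fin 3)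
    (hb : ∀ s, s ≠ t → bt T s z ≤ 0) : z = T t := by
  by_contra hne
  have e := bt_ip T z (T t)
  have h1 := inner_lt (h.unit t) hz hne
  have hD : 0 < dt (T 0) (T 1) (T 2) ^ 2 := by have := h.D_ne; positivity
  have hpos := mul_pos hD (sub_pos.2 h1)
  rw [← e] at hpos
  apply absurd hpos
  push Not
  apply Finset.sum_nonpos
  intro i _
  by_cases hi : i = t
  · subst hi
    have := unit_sq (h.unit i)
    rw [show (T i).re * (T i).re + (T i).im * (T i).im = 1 by nlinarith]; simp
  · exact mul_nonpos_of_nonpos_of_nonneg (hb i hi)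
      (sub_pos.2 (inner_lt (h.unit t) (h.unit i).le (h.inj.ne hi))).le

lemma bt_seg (T : Fin 3 → ℂ) (s : Fin 3) {x y z : ℂ} (hz : z ∈ segment ℝ x y) :
    ∃ a b : ℝ, 0 ≤ a ∧ 0 ≤ b ∧ a + b = 1 ∧ z = a • x + b • y ∧ bt T s z = a * bt T s x + b * bt T s y := by
  obtain ⟨a, b, ha, hb, hab, rfl⟩ := hz
  refine ⟨a, b, ha, hb, hab, rfl, ?_⟩
  simp only [bt]
  have hb' : b = 1 - a := by linarith
  subst hb'
  simp [dt_formula]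
  ring

lemma bt_T_ne (T : Fin 3 → ℂ) {s p : Fin 3} (h : p ≠ s) : bt T s (T p) = 0 := by
  revert s p
  intro s p h
  fin_cases s <;> fin_cases p <;> first | exact absurd rfl h | (simp [bt, dt_formula]; try ring_nf; try tauto)

lemma bt_T_eq (T : Fin 3 → ℂ) (s : Fin 3) : 0 ≤ bt T s (T s) := by
  have : bt T s (T s) = dt (T 0) (T 1) (T 2) ^ 2 := by
    fin_cases s <;> (simp [bt, dt_formula,  show (1 : Fin 3) + 1 = 2 from rfl, show (1 : Fin 3) + 2 = 0 from rfl,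
    show (2 : Fin 3) + 1 = 0 from rfl, show (2 : Fin 3) + 2 = 1 from rfl]; ring)
  rw [this]; positivity

lemma bt_T_nonneg (T : Fin 3 → ℂ) (s p : Fin 3) : 0 ≤ bt T s (T p) := by
  by_cases h : p = s
  · subst h; exact bt_T_eq T p
  · exact (bt_T_ne T h).ge

/-- chord from sector s -/
lemma bt_chord {T : Fin 3 → ℂ} {s p : Fin 3} {P z : ℂ} (hP : bt T s P < 0) (hps : p ≠ s)
    (hz : z ∈ segment ℝ P (T p)) : bt T s z ≤ 0 ∧ (0 ≤ bt T s z → z = T p) := by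
  obtain ⟨a, b, ha, hb, hab, rfl, e⟩ := bt_seg T s hz
  rw [bt_T_ne T hps, mul_zero, add_zero] at e
  rw [e]
  refine ⟨mul_nonpos_of_nonneg_of_nonpos ha hP.le, fun h => ?_⟩
  have : a = 0 := by nlinarith
  subst this
  have : b = 1 := by linarith
  subst this; simp

lemma bt_side (T : Fin 3 → ℂ) {s i j : Fin 3} {z : ℂ} (hz : z ∈ segment ℝ (T i) (T j)) :
    0 ≤ bt T s z := by
  obtain ⟨a, b, ha, hb, hab, rfl, e⟩ := bt_seg T s hz
  rw [e]
  have := bt_T_nonneg T s i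
  have := bt_T_nonneg T s j
  positivity

lemma bt_side_zero (T : Fin 3 → ℂ) {s i j : Fin 3} {z : ℂ} (hi : i ≠ s) (hj : j ≠ s)
   (hz : z ∈ segment ℝ (T i) (T j)) : bt T s z = 0 := by
  obtain ⟨a, b, ha, hb, hab, rfl, e⟩ := bt_seg T s hz
  rw [e, bt_T_ne T hi, bt_T_ne T hj]; simp

lemma norm_seg {x y z : ℂ} (hx : ‖x‖ ≤ 1) (hy : ‖y‖ ≤ 1) (hz : z ∈ segment ℝ x y) : ‖z‖ ≤ 1 := by
  have := (convex_closedBall (0:ℂ) 1).segment_subset (by simpa using hx) (by simpa using hy) hz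
  simpa using this

/-- side of triangle opposite to `s` -/
lemma Tri.side_side {T} (h : Tri T) {s s' : Fin 3} (hs : s ≠ s') {z : ℂ}
    (h1 : z ∈ segment ℝ (T (s + 1)) (T (s + 2))) (h2 : z ∈ segment ℝ (T (s' + 1)) (T (s' + 2))) :
    z ∈ range T := by
  have a1 : bt T s z ≤ 0 := (bt_side_zero T (f31 s) (f32 s) h1).le
  have a2 : bt T s' z ≤ 0 := (bt_side_zero T (f31 s') (f32 s') h2).le
  have hn := norm_seg (h.unit _).le (h.unit _).le h1
  obtain ⟨t, ht⟩ : ∃ t : Fin 3, ∀ q, q ≠ t → q = s ∨ q = s' := f38 _ _ (by assumption)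
  refine ⟨t, (h.third hn t fun q hq => ?_).symm⟩
  rcases ht q hq with rfl | rfl <;> assumption

lemma Tri.chord_side {T} {s p i j : Fin 3} {P z : ℂ} (hP : bt T s P < 0) (hps : p ≠ s)
    (hz : z ∈ segment ℝ P (T p)) (h1 : z ∈ segment ℝ (T i) (T j)) : z ∈ range T :=
  ⟨p, ((bt_chord hP hps hz).2 (bt_side T h1)).symm⟩

lemma Tri.chord_chord {T} (h : Tri T) {s s' p q : Fin 3} {P Q z : ℂ} (hP : bt T s P < 0) (hps : p ≠ s)
    (hQ : bt T s' Q < 0) (hqs : q ≠ s') (hss : s ≠ s') (hPn : ‖P‖ ≤ 1)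
    (hz : z ∈ segment ℝ P (T p)) (h1 : z ∈ segment ℝ Q (T q)) : z ∈ range T := by
  have a1 := (bt_chord hP hps hz).1
  have a2 := (bt_chord hQ hqs h1).1
  have hn := norm_seg hPn (h.unit _).le hz
  obtain ⟨t, ht⟩ : ∃ t : Fin 3, ∀ q, q ≠ t → q = s ∨ q = s' := f38 _ _ (by assumption)
  refine ⟨t, (h.third hn t fun q hq => ?_).symm⟩
  rcases ht q hq with rfl | rfl <;> assumption

lemma dt_opp {u i w j z : ℂ} (hu : ‖u‖ = 1) (hi : ‖i‖ = 1) (hw : ‖w‖ = 1) (hj : ‖j‖ = 1)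
    (d1 : u ≠ i) (d2 : u ≠ w) (d3 : u ≠ j) (d4 : i ≠ w) (d5 : i ≠ j) (d6 : w ≠ j)
    (h1 : z ∈ segment ℝ u i) (h2 : z ∈ segment ℝ w j) : dt w j u * dt w j i < 0 := by
  have n1 := dt_ne hw hj hu d6 d2.symm d3.symm
  have n2 := dt_ne hw hj hi d6 d4.symm d5.symm
  obtain ⟨a, b, ha, hb, hab, rfl⟩ := h1
  obtain ⟨a', b', ha', hb', hab', e⟩ := h2
  have e0 : dt w j (a • u + b • i) = 0 := by
    rw [← e]
    have hb' : b' = 1 - a' := by linarith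
    subst hb'
    simp [dt_formula]; ring
  have e1 : dt w j (a • u + b • i) = a * dt w j u + b * dt w j i := by
    have hb' : b = 1 - a := by linarith
    subst hb'
    simp [dt_formula]; ring
  rw [e1] at e0
  by_contra hc
  push Not at hc
  have hc' : 0 < dt w j u * dt w j i := lt_of_le_of_ne hc (mul_ne_zero n1 n2).symm
  rcases mul_pos_iff.1 hc' with ⟨q1, q2⟩ | ⟨q1, q2⟩
  · rcases ha.eq_or_lt with h | h
    · have : b = 1 := by linarith
      subst this; nlinarith
    · nlinarith [mul_pos h q1, mul_nonneg hb q2.le]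
  · rcases ha.eq_or_lt with h | h
    · have : b = 1 := by linarith
      subst this; nlinarith
    · nlinarith [mul_pos h (neg_pos.2 q1), mul_nonneg hb (neg_pos.2 q2).le]

lemma chords_alt {u i w j : ℂ} (hu : ‖u‖ = 1) (hi : ‖i‖ = 1) (hw : ‖w‖ = 1) (hj : ‖j‖ = 1)
    (d1 : u ≠ i) (d2 : u ≠ w) (d3 : u ≠ j) (d4 : i ≠ w) (d5 : i ≠ j) (d6 : w ≠ j) :
    (∀ z, z ∈ segment ℝ u i → z ∈ segment ℝ w j → False) ∨
    (∀ z, z ∈ segment ℝ u j → z ∈ segment ℝ w i → False) := by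
  by_contra hc
  push Not at hc
  obtain ⟨⟨z, h1, h2, -⟩, z', h3, h4, -⟩ := hc
  have q1 := dt_opp hu hi hw hj d1 d2 d3 d4 d5 d6 h1 h2
  have q2 := dt_opp hu hj hw hi d3 d2 d1 d6.symm d5.symm d4.symm h3 h4
  have q3 := dt_opp hw hj hu hi d6 d2.symm d4.symm d3.symm d5.symm d1 h2 h1
  have q4 := dt_opp hw hi hu hj d4.symm d2.symm d6 d1.symm d5 d3 h4 h3
  have f1 : dt w j u = - dt u j w := by simp only [dt_formula]; ring
  have f2 : dt w j i = - dt i j w := by simp only [dt_formula]; ring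
  have f3 : dt w i u = - dt u i w := by simp only [dt_formula]; ring
  have f4 : dt w i j = dt i j w := by simp only [dt_formula]; ring
  have f5 : dt u j i = - dt u i j := by simp only [dt_formula]; ring
  have f6 : dt i j w - dt u j w + dt u i w - dt u i j = 0 := by simp only [dt_formula]; ring
  rw [f1, f2] at q1
  rw [f3, f4] at q2
  rw [f5] at q4
  generalize dt u j w = A at *
  generalize dt i j w = B at *
  generalize dt u i w = C at *
  generalize dt u i j = D at *
  rcases lt_trichotomy B 0 with h | h | h
  · have : 0 < A := by nlinarith
    have : C < 0 := by nlinarith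
    have : 0 < D := by nlinarith
    linarith
  · subst h; simp at q1
  · have : A < 0 := by nlinarith
    have : 0 < C := by nlinarith
    have : D < 0 := by nlinarith
    linarith

lemma dt_rot {d B : ℂ} (hd : ‖d‖ = 1) (hB : ‖B‖ = 1) (hne : B ≠ d) {η : ℝ} (h0 : η ≠ 0)
    (hη : |η| < 1 - (d.re * B.re + d.im * B.im)) (hη1 : |η| < 1) :
    dt d B (d * exp (η * I)) * η < 0 := by
  have sd := unit_sq hd
  have sB := unit_sq hB
  have e : dt d B (d * exp (η * I)) = Real.sin η * ((d.re * B.re + d.im * B.im) - 1)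
      - (Real.cos η - 1) * (d.re * B.im - d.im * B.re) := by
    rw [dt_formula, Complex.exp_mul_I, ← Complex.ofReal_cos, ← Complex.ofReal_sin]
    simp only [Complex.mul_re, Complex.mul_im, Complex.add_re, Complex.add_im, Complex.ofReal_re, Complex.ofReal_im, Complex.I_re, Complex.I_im]
    linear_combination (-Real.sin η) * sd
  rw [e]
  set t := d.re * B.re + d.im * B.im with ht
  set q := d.re * B.im - d.im * B.re with hq
  have hq1 : t ^ 2 + q ^ 2 = 1 := by rw [ht, hq]; linear_combination sd * (B.re ^ 2 + B.im ^ 2) + sB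
  have hqa : |q| ≤ 1 := abs_le_one_iff_mul_self_le_one.2 (by nlinarith)
  have hc : 0 ≤ Real.cos η := Real.cos_nonneg_of_mem_Icc
    ⟨by linarith [neg_abs_le η, Real.pi_gt_three], by linarith [le_abs_self η, Real.pi_gt_three]⟩
  have hc1 := Real.cos_le_one η
  have hss := Real.sin_sq_add_cos_sq η
  have h1c : 1 - Real.cos η ≤ Real.sin η ^ 2 := by nlinarith
  have hq2 := abs_le.1 hqa
  rcases lt_or_gt_of_ne h0 with h | h
  · rw [abs_of_neg h] at hη hη1
    have s1 : Real.sin η < 0 := Real.sin_neg_of_neg_of_neg_pi_lt h (by linarith [Real.pi_gt_three])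
    have s2 : η < Real.sin η := by
      have := Real.sin_lt (x := -η) (by linarith)
      rw [Real.sin_neg] at this; linarith
    apply mul_neg_of_pos_of_neg _ h
    have : (1 - Real.cos η) * q ≥ -(1 - Real.cos η) := by nlinarith
    have : (-Real.sin η) * (1 - t) > (-Real.sin η) * (-Real.sin η) := by
      apply mul_lt_mul_of_pos_left _ (by linarith); linarith
    nlinarith
  · rw [abs_of_pos h] at hη hη1
    have s1 : 0 < Real.sin η := Real.sin_pos_of_pos_of_lt_pi h (by linarith [Real.pi_gt_three])
    have s2 : Real.sin η < η := Real.sin_lt h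
    apply mul_neg_of_neg_of_pos _ h
    have : (1 - Real.cos η) * q ≤ (1 - Real.cos η) := by nlinarith
    have : (Real.sin η) * (1 - t) > (Real.sin η) * (Real.sin η) := by
      apply mul_lt_mul_of_pos_left _ (by linarith); linarith
    nlinarith

/-- rotating a spoke slightly -/
lemma Tri.rot {T} (h : Tri T) (i : Fin 3) : ∃ η0 : ℝ, 0 < η0 ∧ ∃ s s' : Fin 3, s ≠ s' ∧
    ∀ η : ℝ, 0 < η → η < η0 → bt T s (T i * exp (η * I)) < 0 ∧
      bt T s' (T i * exp (((-η : ℝ) : ℂ) * I)) < 0 := by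
  have k1 := inner_lt (h.unit i) (h.unit (i + 1)).le (h.inj.ne (f31 i))
  have k2 := inner_lt (h.unit i) (h.unit (i + 2)).le (h.inj.ne (f32 i))
  obtain ⟨η0, hp, hη0⟩ : ∃ η0 : ℝ, 0 < η0 ∧ ∀ η : ℝ, |η| < η0 → η ≠ 0 →
     dt (T i) (T (i + 1)) (T i * exp (η * I)) * η < 0 ∧
     dt (T i) (T (i + 2)) (T i * exp (η * I)) * η < 0 := by
    refine ⟨min 1 (min _ _), lt_min one_pos (lt_min (sub_pos.2 k1) (sub_pos.2 k2)), ?_⟩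
    intro η hη hn
    have q1 := lt_of_lt_of_le hη (min_le_left _ _)
    have q := lt_of_lt_of_le hη (min_le_right _ _)
    exact ⟨dt_rot (h.unit _) (h.unit _) (h.inj.ne (f31 i)) hn (lt_of_lt_of_le q (min_le_left _ _)) q1,
      dt_rot (h.unit _) (h.unit _) (h.inj.ne (f32 i)) hn (lt_of_lt_of_le q (min_le_right _ _)) q1⟩
  have e1 : ∀ z, bt T (i + 2) z = dt (T i) (T (i + 1)) z * dt (T 0) (T 1) (T 2) := by
    intro z; unfold bt
    have : i + 2 + 1 = i := f34 i
    rw [this]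
    have : i + 2 + 2 = i + 1 := f35 i
    rw [this]
  have e2 : ∀ z, bt T (i + 1) z = - dt (T i) (T (i + 2)) z * dt (T 0) (T 1) (T 2) := by
    intro z; unfold bt
    have : i + 1 + 1 = i + 2 := f36 i
    rw [this]
    have : i + 1 + 2 = i := f37 i
    rw [this]
    congr 1
    simp only [dt_formula]; ring
  have hns : i + 1 ≠ i + 2 := f33 i
  refine ⟨η0, hp, ?_⟩
  rcases lt_or_gt_of_ne h.D_ne with hD | hD
  · refine ⟨i + 1, i + 2, hns, fun η h0 h1 => ?_⟩
    have a1 := hη0 η (by rwa [abs_of_pos h0]) h0.ne'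
    have a2 := hη0 (-η) (by rwa [abs_neg, abs_of_pos h0]) (by linarith)
    rw [e1, e2]
    constructor
    · have := a1.2
      have : dt (T i) (T (i + 2)) (T i * exp (η * I)) < 0 := by nlinarith
      exact mul_neg_of_pos_of_neg (by linarith) hD
    · have := a2.1
      have : 0 < dt (T i) (T (i + 1)) (T i * exp (((-η : ℝ) : ℂ) * I)) := by nlinarith
      exact mul_neg_of_pos_of_neg (by linarith) hD
  · refine ⟨i + 2, i + 1, hns.symm, fun η h0 h1 => ?_⟩
    have a1 := hη0 η (by rwa [abs_of_pos h0]) h0.ne'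
    have a2 := hη0 (-η) (by rwa [abs_neg, abs_of_pos h0]) (by linarith)
    rw [e1, e2]
    constructor
    · have := a1.1
      have : dt (T i) (T (i + 1)) (T i * exp (η * I)) < 0 := by nlinarith
      exact mul_neg_of_neg_of_pos (by linarith) hD
    · have := a2.2
      have : 0 < dt (T i) (T (i + 2)) (T i * exp (((-η : ℝ) : ℂ) * I)) := by nlinarith
      exact mul_neg_of_neg_of_pos (by linarith) hD
end TG

namespace TG
open Set Complex Filter Topology Metric
open scoped ComplexConjugate

structure Sys {X ι : Type*} (pos : X → ℂ) (e : ι → Sym2 X) (A : ι → Set ℂ) : Prop where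
  inj : Function.Injective pos
  arc : ∀ i x y, e i = s(x, y) → IsArc (A i) (pos x) (pos y)
  on : ∀ i x, pos x ∈ A i → x ∈ e i
  inter : ∀ i j, i ≠ j → A i ∩ A j ⊆ range pos

structure Rad {X ι : Type*} (pos : X → ℂ) (e : ι → Sym2 X) (A : ι → Set ℂ) (v : X) (r : ℝ)
    (dir : ι → ℂ) : Prop where
  rpos : 0 < r
  unit : ∀ i, v ∈ e i → ‖dir i‖ = 1
  spoke : ∀ i y, e i = s(v, y) → ∃ τ, IsArc τ (pos y) (pos v + r * dir i) ∧
    τ ∩ closedBall (pos v) r = {pos v + r * dir i} ∧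
    A i = τ ∪ segment ℝ (pos v + r * dir i) (pos v)
  far : ∀ i, v ∉ e i → Disjoint (A i) (closedBall (pos v) r)
  vert : ∀ y, y ≠ v → pos y ∉ closedBall (pos v) r

section
variable {X ι : Type*} {pos : X → ℂ} {e : ι → Sym2 X} {A : ι → Set ℂ}

lemma Sys.reindex (h : Sys pos e A) {κ : Type*} (f : κ → ι) (hf : Function.Injective f) :
    Sys pos (e ∘ f) (A ∘ f) :=
  ⟨h.inj, fun i => h.arc (f i), fun i => h.on (f i), fun i j hij => h.inter _ _ (hf.ne hij)⟩

lemma Rad.reindex {v r dir} (h : Rad pos e A v r dir) {κ : Type*} (f : κ → ι) :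
    Rad pos (e ∘ f) (A ∘ f) v r (dir ∘ f) :=
  ⟨h.rpos, fun i => h.unit (f i), fun i => h.spoke (f i), fun i => h.far (f i), h.vert⟩

lemma Sys.mem (h : Sys pos e A) {i x} (hx : x ∈ e i) : pos x ∈ A i := by
  obtain ⟨y, hy⟩ := Sym2.mem_iff_exists.1 hx
  exact (h.arc i x y hy).left_mem

lemma s2_ex {X : Type*} (s : Sym2 X) : ∃ x y, s = s(x, y) := by
  induction s with | _ x y
  exact ⟨x, y, rfl⟩

lemma Sys.compact (h : Sys pos e A) (i) : IsCompact (A i) := by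
  obtain ⟨x, y, hxy⟩ : ∃ x y, e i = s(x, y) := s2_ex _
  exact (h.arc i x y hxy).isCompact

lemma Sys.preconn (h : Sys pos e A) (i) : IsPreconnected (A i) := by
  obtain ⟨x, y, hxy⟩ : ∃ x y, e i = s(x, y) := s2_ex _
  exact (h.arc i x y hxy).isPreconnected

noncomputable def cE : (ℝ × ℝ) ≃L[ℝ] ℂ := Complex.equivRealProdCLM.symm

lemma Sys.planar {W : Type*} (h : Sys pos e A) (H : SimpleGraph W) (φ : W → X)
    (hφ : Function.Injective φ) (hH : ∀ u v, H.Adj u v → ∃ i, e i = s(φ u, φ v)) : H.IsPlanar := by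
  classical
  have hc : ∀ s : Sym2 W, s ∈ H.edgeSet → ∃ i, e i = s.map φ := by
    intro s hs
    induction s with | _ u v
    exact hH u v hs
  choose idx hidx using hc
  have hcg : ∀ s s' hs hs', s = s' → idx s hs = idx s' hs' := by rintro _ _ _ _ rfl; rfl
  have key : ∀ {u v w z} (h1 : H.Adj u v) (h2 : H.Adj w z), s(u, v) ≠ s(w, z) →
      idx s(u, v) h1 ≠ idx s(w, z) h2 := by
    intro u v w z h1 h2 hne heq
    have a1 := hidx s(u, v) h1
    have a2 := hidx s(w, z) h2
    rw [heq, a2] at a1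
    exact hne (Sym2.map.injective hφ a1.symm)
  refine ⟨{ pos := fun w => cE.symm (pos (φ w))
            pos_inj := fun a b hab => hφ (h.inj (cE.symm.injective hab))
            arc := fun u v hh => cE.symm '' A (idx s(u, v) hh)
            arc_symm := fun u v hh => congrArg (fun i => cE.symm '' A i) (hcg _ _ _ hh Sym2.eq_swap)
            arc_curve := ?_
            arc_inter := ?_
            pos_arc := ?_ }⟩
  · intro u v hh
    have a1 := hidx s(u, v) hh
    obtain ⟨f, hf, hfi, h0, h1, him⟩ := h.arc _ _ _ (a1.trans (Sym2.map_mk ..))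
    refine ⟨fun t => cE.symm (f t), cE.symm.continuous.comp_continuousOn hf,
      fun x hx y hy hxy => hfi hx hy (cE.symm.injective hxy), by simp [h0], by simp [h1], ?_⟩
    rw [← him, image_image]
  · rintro u v w z h1 h2 hne _ ⟨⟨p, hp, rfl⟩, q, hq, hqp⟩
    have := cE.symm.injective hqp
    subst this
    obtain ⟨x, rfl⟩ := h.inter _ _ (key h1 h2 hne) ⟨hp, hq⟩
    have m1 := h.on _ _ hp
    have m2 := h.on _ _ hq
    rw [hidx _ h1] at m1
    rw [hidx _ h2] at m2
    simp only [Sym2.map_mk, Sym2.mem_iff] at m1 m2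
    constructor
    · rcases m1 with rfl | rfl <;> simp
    · rcases m2 with rfl | rfl <;> simp
  · rintro u v h1 w ⟨p, hp, hpw⟩
    have := cE.symm.injective hpw
    subst this
    have m1 := h.on _ _ hp
    rw [hidx _ h1] at m1
    simp only [Sym2.map_mk, Sym2.mem_iff] at m1
    rcases m1 with m | m
    · exact Or.inl (hφ m)
    · exact Or.inr (hφ m)

lemma Sys.of_embedding {V : Type*} {G : SimpleGraph V} (E : PlaneEmbedding G) :
    ∃ A : G.edgeSet → Set ℂ, Sys (fun v => cE (E.pos v)) (fun i : G.edgeSet => (i : Sym2 V)) A ∧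
      ∀ u v (h : G.Adj u v), A ⟨s(u, v), h⟩ = cE '' E.arc h := by
  let A : G.edgeSet → Set ℂ := fun i => ⋃ (u : V) (v : V) (h : G.Adj u v) (_ : s(u, v) = i), cE '' E.arc h
  have hA : ∀ u v (h : G.Adj u v) (i : G.edgeSet), (i : Sym2 V) = s(u, v) → A i = cE '' E.arc h := by
    intro u v h i hi
    apply subset_antisymm
    · simp only [A, iUnion_subset_iff]
      intro w z h2 h3
      rw [hi, Sym2.eq_iff] at h3
      rcases h3 with ⟨rfl, rfl⟩ | ⟨rfl, rfl⟩
      · rfl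
      · rw [E.arc_symm h]
    · intro x hx
      simp only [A, mem_iUnion]
      exact ⟨u, v, h, hi.symm, hx⟩
  refine ⟨A, ⟨fun a b hab => E.pos_inj (cE.injective hab), ?_, ?_, ?_⟩, fun u v h => hA u v h _ rfl⟩
  · intro i x y hxy
    have hadj : G.Adj x y := by have := i.2; rw [hxy] at this; exact this
    rw [hA x y hadj i hxy]
    obtain ⟨f, hf, hfi, h0, h1, him⟩ := E.arc_curve hadj
    refine ⟨fun t => cE (f t), cE.continuous.comp_continuousOn hf,
      fun x hx y hy hxy => hfi hx hy (cE.injective hxy), by simp [h0], by simp [h1], ?_⟩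
    rw [← him, image_image]
  · rintro ⟨i, hi⟩ x hx
    induction i with | _ u v
    rw [hA u v hi _ rfl] at hx
    obtain ⟨p, hp, hpx⟩ := hx
    have := cE.injective hpx
    subst this
    simpa using E.pos_arc hi x hp
  · rintro ⟨i, hi⟩ ⟨j, hj⟩ hij z ⟨h1, h2⟩
    induction i with | _ u v
    induction j with | _ u' v'
    rw [hA u v hi _ rfl] at h1
    rw [hA u' v' hj _ rfl] at h2
    obtain ⟨p, hp, rfl⟩ := h1
    obtain ⟨q, hq, hqp⟩ := h2
    have := cE.injective hqp
    subst this
    have := (E.arc_inter hi hj (fun hh => hij (Subtype.ext hh)) ⟨hp, hq⟩).1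
    rcases this with h | h
    · exact ⟨u, by rw [h]⟩
    · exact ⟨v, by rw [h]⟩

lemma hit_dist {M : Set ℂ} {a p q : ℂ} {r : ℝ} (hM : IsPreconnected M) (hq : q ∈ M) (hqp : q ≠ p)
    (h : M ∩ closedBall a r = {p}) : dist p a = r := by
  have hp : p ∈ M ∩ closedBall a r := by rw [h]; rfl
  by_contra hc
  have hlt : p ∈ ball a r := lt_of_le_of_ne hp.2 hc
  have hqn : q ∉ closedBall a r := fun hh => hqp (by have : q ∈ M ∩ closedBall a r := ⟨hq, hh⟩; rw [h] at this; exact this)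
  obtain ⟨z, hz, hz1, hz2⟩ := hM (ball a r) (closedBall a r)ᶜ isOpen_ball isClosed_closedBall.isOpen_compl
    (by
      intro z hz
      by_cases hzc : z ∈ closedBall a r
      · left
        have : z ∈ M ∩ closedBall a r := ⟨hz, hzc⟩
        rw [h] at this
        rw [mem_singleton_iff.1 this]; exact hlt
      · exact Or.inr hzc) ⟨p, hp.1, hlt⟩ ⟨q, hq, hqn⟩
  exact hz2 (ball_subset_closedBall hz1)

lemma IsArc.two_end {S : Set ℂ} {a b : ℂ} (hS : IsArc S a b) {r : ℝ} (hr : 0 < r) (h2 : 2 * r < dist a b) :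
    ∃ M p q, M ⊆ S ∧ IsArc M p q ∧ M ∩ closedBall a r = {p} ∧ M ∩ closedBall b r = {q} ∧
      dist p a = r ∧ dist q b = r := by
  have hb : b ∉ closedBall a r := by rw [mem_closedBall, dist_comm]; linarith
  obtain ⟨p, T, hT, hTS, hTp⟩ := hS.symm.first_hit (Z := closedBall a r) isClosed_closedBall
    (by simp [hr.le]) hb
  have hpa : p ∈ T ∩ closedBall a r := by rw [hTp]; rfl
  have hp : p ∉ closedBall b r := by
    intro hh
    have h1 := hpa.2
    rw [mem_closedBall] at h1 hh
    have := dist_triangle a p b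
    rw [dist_comm a p] at this
    linarith
  obtain ⟨q, M, hM, hMT, hMq⟩ := hT.symm.first_hit (Z := closedBall b r) isClosed_closedBall
    (by simp [hr.le]) hp
  have hMp : M ∩ closedBall a r = {p} := by
    apply subset_antisymm
    · rw [← hTp]; exact inter_subset_inter_left _ hMT
    · rintro _ rfl; exact ⟨hM.left_mem, hpa.2⟩
  exact ⟨M, p, q, hMT.trans hTS, hM, hMp, hMq, hit_dist hM.isPreconnected hM.right_mem hM.ne.symm hMp,
    hit_dist hM.isPreconnected hM.left_mem hM.ne hMq⟩

lemma rad_seg {c p q z : ℂ} {r : ℝ} (hr : 0 < r) (hp : dist p c = r) (hq : dist q c = r) (hpq : p ≠ q)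
    (h1 : z ∈ segment ℝ p c) (h2 : z ∈ segment ℝ q c) : z = c := by
  obtain ⟨a, b, ha, hb, hab, rfl⟩ := h1
  obtain ⟨a', b', ha', hb', hab', h⟩ := h2
  have e1 : a' • q + b' • c - c = a' • (q - c) := by
    rw [show b' = 1 - a' by linarith]; module
  have e2 : a • p + b • c - c = a • (p - c) := by
    rw [show b = 1 - a by linarith]; module
  rw [h, e2] at e1
  have n := congrArg norm e1
  rw [norm_smul, norm_smul, ← dist_eq_norm, ← dist_eq_norm, hp, hq, Real.norm_of_nonneg ha,
    Real.norm_of_nonneg ha'] at n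
  have haa : a = a' := mul_right_cancel₀ hr.ne' n
  subst haa
  by_cases h0 : a = 0
  · subst h0
    rw [show b = 1 by linarith]; simp
  · have := smul_right_injective ℂ h0 e1
    exact absurd (sub_left_injective this) hpq

lemma seg_sphere {c p z : ℂ} {r : ℝ} (hp : dist p c = r) (hr : 0 < r) (h1 : z ∈ segment ℝ p c)
    (hz : r ≤ dist z c) : z = p := by
  by_contra hne
  by_cases hzc : z = c
  · subst hzc; simp at hz; linarith
  have := seg_ball (v := c) hr (by rw [mem_closedBall, hp]) (by simp [hr.le]) h1 hne hzc
  rw [mem_ball] at this; linarith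

lemma seg_in_ball {c p z : ℂ} {r : ℝ} (hp : dist p c = r) (hr : 0 < r) (h1 : z ∈ segment ℝ p c) :
    z ∈ closedBall c r :=
  (convex_closedBall c r).segment_subset (by rw [mem_closedBall, hp]) (by simp [hr.le]) h1

/-- small radius -/
lemma Sys.small [Finite X] [Finite ι] (h : Sys pos e A) : ∃ r0 > 0, ∀ r, 0 < r → r < r0 →
    (∀ x y, x ≠ y → Disjoint (closedBall (pos x) r) (closedBall (pos y) r)) ∧
    (∀ x y, x ≠ y → 2 * r < dist (pos x) (pos y)) ∧
    (∀ i x, x ∉ e i → Disjoint (A i) (closedBall (pos x) r)) := by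
  have h1 : ∀ x y : X, x ≠ y → ∀ᶠ r in 𝓝[>] (0:ℝ), 2 * r < dist (pos x) (pos y) := by
    intro x y hxy
    have : 0 < dist (pos x) (pos y) / 2 := by have := dist_pos.2 (h.inj.ne hxy); positivity
    filter_upwards [Ioo_mem_nhdsGT this] with r hr
    linarith [hr.2]
  have h2 : ∀ i x, x ∉ e i → ∀ᶠ r in 𝓝[>] (0:ℝ), Disjoint (A i) (closedBall (pos x) r) := by
    intro i x hx
    have ho : IsOpen (A i)ᶜ := (h.compact i).isClosed.isOpen_compl
    obtain ⟨ε, hε, hb⟩ := Metric.isOpen_iff.1 ho (pos x) (fun hh => hx (h.on _ _ hh))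
    filter_upwards [Ioo_mem_nhdsGT hε] with r hr
    rw [Set.disjoint_right]
    intro z hz
    exact hb (lt_of_le_of_lt hz hr.2)
  have h1' : ∀ᶠ r in 𝓝[>] (0:ℝ), ∀ x y : X, x ≠ y → 2 * r < dist (pos x) (pos y) := by
    rw [eventually_all]; intro x; rw [eventually_all]; intro y
    by_cases hxy : x = y
    · simp [hxy]
    · filter_upwards [h1 x y hxy] with r hr _ using hr
  have h2' : ∀ᶠ r in 𝓝[>] (0:ℝ), ∀ i x, x ∉ e i → Disjoint (A i) (closedBall (pos x) r) := by
    rw [eventually_all]; intro i; rw [eventually_all]; intro x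
    by_cases hxy : x ∈ e i
    · simp [hxy]
    · filter_upwards [h2 i x hxy] with r hr _ using hr
  obtain ⟨r0, hr0, hr⟩ := mem_nhdsGT_iff_exists_Ioo_subset.1 (h1'.and h2')
  refine ⟨r0, hr0, fun r h0 h3 => ?_⟩
  have := hr ⟨h0, h3⟩
  exact ⟨fun x y hxy => closedBall_disjoint_closedBall (by have := this.1 x y hxy; linarith), this.1, this.2⟩

lemma Sys.straighten [Finite X] [Finite ι] (h : Sys pos e A) : ∃ r0 > 0, ∀ r, 0 < r → r < r0 →
    ∃ (A' : ι → Set ℂ) (dir : X → ι → ℂ), Sys pos e A' ∧ (∀ x, Rad pos e A' x r (dir x)) ∧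
      ∀ i, A' i ⊆ A i ∪ ⋃ x ∈ e i, closedBall (pos x) r := by
  classical
  obtain ⟨r0, hr0, hsm⟩ := h.small
  refine ⟨r0, hr0, fun r hr hrr => ?_⟩
  obtain ⟨hdis, hdist, hfar⟩ := hsm r hr hrr
  have ex : ∀ i, ∃ (M : Set ℂ) (pt : X → ℂ), M ⊆ A i ∧ (∀ x y, e i = s(x, y) → IsArc M (pt x) (pt y)) ∧
      ∀ x ∈ e i, M ∩ closedBall (pos x) r = {pt x} ∧ dist (pt x) (pos x) = r := by
    intro i
    obtain ⟨x, y, hxy⟩ : ∃ x y, e i = s(x, y) := s2_ex _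
    have ha := h.arc i x y hxy
    have hne : x ≠ y := fun hh => ha.ne (by rw [hh])
    obtain ⟨M, p, q, hMS, hM, h1, h2, h3, h4⟩ := ha.two_end hr (hdist x y hne)
    refine ⟨M, fun z => if z = x then p else q, hMS, ?_, ?_⟩
    · intro x' y' hh
      rw [hxy, Sym2.eq_iff] at hh
      rcases hh with ⟨rfl, rfl⟩ | ⟨rfl, rfl⟩
      · simpa [hne.symm] using hM
      · simpa [hne.symm] using hM.symm
    · intro z hz
      rw [hxy, Sym2.mem_iff] at hz
      rcases hz with rfl | rfl
      · simp [h1, h3]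
      · simp [h2, h4, hne.symm]
  choose M pt hMA hM hpt using ex
  have hrc : (r : ℂ) ≠ 0 := by exact_mod_cast hr.ne'
  have hdirpt : ∀ x i, pos x + r * ((pt i x - pos x) / r) = pt i x := by
    intro x i; field_simp; ring
  set A' : ι → Set ℂ := fun i => M i ∪ ⋃ x ∈ e i, segment ℝ (pt i x) (pos x) with hA'
  have hptM : ∀ i x, x ∈ e i → pt i x ∈ M i := by
    intro i x hx
    have : pt i x ∈ M i ∩ closedBall (pos x) r := by rw [(hpt i x hx).1]; rfl
    exact this.1
  have hMball : ∀ i x z, x ∈ e i → z ∈ M i → z ∈ closedBall (pos x) r → z = pt i x := by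
    intro i x z hx hz hb
    have : z ∈ M i ∩ closedBall (pos x) r := ⟨hz, hb⟩
    rw [(hpt i x hx).1] at this; exact this
  have hptne : ∀ i j x, i ≠ j → x ∈ e i → x ∈ e j → pt i x ≠ pt j x := by
    intro i j x hij hi hj hh
    obtain ⟨y, hy⟩ := h.inter i j hij ⟨hMA _ (hptM i x hi), hh ▸ hMA _ (hptM j x hj)⟩
    have h3 := (hpt i x hi).2
    by_cases hxy : y = x
    · subst hxy; rw [← hy] at h3; simp at h3; linarith
    · have := hdist y x hxy
      rw [hy] at this; linarith
  have hposM : ∀ i x, pos x ∉ M i := by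
    intro i x hx
    have hxe := h.on _ _ (hMA _ hx)
    have := hMball i x _ hxe hx (by simp [hr.le])
    have h3 := (hpt i x hxe).2
    rw [← this] at h3; simp at h3; linarith
  have hunion : ∀ i x y, e i = s(x, y) → A' i = (M i ∪ segment ℝ (pt i y) (pos y)) ∪ segment ℝ (pt i x) (pos x) := by
    intro i x y hxy
    simp only [hA', hxy]
    ext z
    simp only [mem_union, mem_iUnion, Sym2.mem_iff, exists_prop]
    constructor
    · rintro (h | ⟨w, rfl | rfl, h⟩) <;> tauto
    · rintro ((h | h) | h)
      · exact Or.inl h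
      · exact Or.inr ⟨y, Or.inr rfl, h⟩
      · exact Or.inr ⟨x, Or.inl rfl, h⟩
  have hxyne : ∀ i x y, e i = s(x, y) → x ≠ y := fun i x y hxy hh => (h.arc i x y hxy).ne (by rw [hh])
  have hseg : ∀ i x, x ∈ e i → segment ℝ (pt i x) (pos x) ⊆ closedBall (pos x) r := fun i x hx z hz =>
    seg_in_ball (hpt i x hx).2 hr hz
  have hτ : ∀ i x y, e i = s(x, y) → IsArc (M i ∪ segment ℝ (pt i y) (pos y)) (pt i x) (pos y) := by
    intro i x y hxy
    have hy : y ∈ e i := by rw [hxy]; simp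
    refine (hM i x y hxy).concat (isArc_segment ?_) ?_
    · intro hh
      have := (hpt i y hy).2
      rw [hh] at this; simp at this; linarith
    · rintro z ⟨hz1, hz2⟩
      exact hMball i y z hy hz1 (hseg i y hy hz2)
  have hsub : ∀ i, A' i ⊆ A i ∪ ⋃ x ∈ e i, closedBall (pos x) r := by
    intro i
    apply union_subset_union (hMA i)
    apply iUnion₂_mono
    exact fun x hx => hseg i x hx
  have hτb : ∀ i x y, e i = s(x, y) →
      (M i ∪ segment ℝ (pt i y) (pos y)) ∩ closedBall (pos x) r = {pt i x} := by
    intro i x y hxy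
    have hy : y ∈ e i := by rw [hxy]; simp
    have hx : x ∈ e i := by rw [hxy]; simp
    apply subset_antisymm
    · rintro z ⟨hz1 | hz1, hz2⟩
      · exact hMball i x z hx hz1 hz2
      · exact absurd hz2 (Set.disjoint_left.1 (hdis y x (hxyne i x y hxy).symm) (hseg i y hy hz1))
    · rintro _ rfl
      exact ⟨Or.inl (hptM i x hx), by rw [mem_closedBall, (hpt i x hx).2]⟩
  refine ⟨A', fun x i => (pt i x - pos x) / r, ⟨h.inj, ?_, ?_, ?_⟩, ?_, hsub⟩
  · intro i x y hxy
    have hx : x ∈ e i := by rw [hxy]; simp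
    rw [hunion i x y hxy, union_comm]
    refine IsArc.concat (isArc_segment ?_).symm (hτ i x y hxy) ?_
    · intro hh
      have := (hpt i x hx).2
      rw [hh] at this; simp at this; linarith
    · rintro z ⟨hz1, hz2⟩
      have : z ∈ (M i ∪ segment ℝ (pt i y) (pos y)) ∩ closedBall (pos x) r := ⟨hz2, hseg i x hx hz1⟩
      rwa [hτb i x y hxy] at this
  · intro i x hx
    rcases hsub i hx with hx | hx
    · exact h.on _ _ hx
    · simp only [mem_iUnion] at hx
      obtain ⟨y, hy, hz⟩ := hx
      by_cases hxy : x = y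
      · rwa [hxy]
      · exact absurd hz (Set.disjoint_left.1 (hdis x y hxy) (by simp [hr.le]))
  · intro i j hij z ⟨hi, hj⟩
    have aux : ∀ i j, i ≠ j → ∀ x ∈ e j, z ∈ segment ℝ (pt j x) (pos x) → z ∈ M i → z ∈ range pos := by
      intro i j hij x hxj hz hzM
      have hzb := hseg j x hxj hz
      by_cases hxi : x ∈ e i
      · have e1 := hMball i x z hxi hzM hzb
        have := seg_sphere (hpt j x hxj).2 hr hz (by rw [e1, (hpt i x hxi).2])
        exact absurd (e1.symm.trans this) (hptne i j x hij hxi hxj)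
      · exact absurd hzb (Set.disjoint_left.1 (hfar i x hxi) (hMA i hzM))
    rcases hi with hi | hi
    · rcases hj with hj | hj
      · exact h.inter i j hij ⟨hMA _ hi, hMA _ hj⟩
      · simp only [mem_iUnion] at hj
        obtain ⟨x, hxj, hz⟩ := hj
        exact aux i j hij x hxj hz hi
    · simp only [mem_iUnion] at hi
      obtain ⟨x, hxi, hz⟩ := hi
      rcases hj with hj | hj
      · exact aux j i hij.symm x hxi hz hj
      · simp only [mem_iUnion] at hj
        obtain ⟨x', hxj, hz'⟩ := hj
        by_cases hxx : x = x'
        · subst hxx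
          exact ⟨x, (rad_seg hr (hpt i x hxi).2 (hpt j x hxj).2 (hptne i j x hij hxi hxj) hz hz').symm⟩
        · exact absurd (hseg j x' hxj hz') (Set.disjoint_left.1 (hdis x x' hxx) (hseg i x hxi hz))
  · intro v
    refine ⟨hr, ?_, ?_, ?_, ?_⟩
    · intro i hi
      rw [norm_div, ← dist_eq_norm, (hpt i v hi).2]
      simp [abs_of_pos hr, hr.ne']
    · intro i y hy
      rw [hdirpt]
      exact ⟨_, (hτ i v y hy).symm, hτb i v y hy, hunion i v y hy⟩
    · intro i hi
      rw [Set.disjoint_left]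
      intro z hz hzb
      rcases hsub i hz with hx | hx
      · exact Set.disjoint_left.1 (hfar i v hi) hx hzb
      · simp only [mem_iUnion] at hx
        obtain ⟨y, hy, hz⟩ := hx
        exact Set.disjoint_left.1 (hdis v y (fun hh => hi (hh ▸ hy))) hzb hz
    · intro y hy hh
      exact Set.disjoint_left.1 (hdis v y hy.symm) hh (by simp [hr.le])
end
end TG

namespace TG
open Set Complex Filter Topology Metric
open scoped ComplexConjugate

section
variable {X ι : Type*} {pos : X → ℂ} {e : ι → Sym2 X} {A : ι → Set ℂ} {v : X} {r : ℝ} {dir : ι → ℂ}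

lemma Rad.dist_pt (h : Rad pos e A v r dir) {i} (hi : v ∈ e i) : dist (pos v + r * dir i) (pos v) = r := by
  rw [dist_eq_norm, add_sub_cancel_left, norm_mul, h.unit i hi]; simp [abs_of_pos h.rpos]

lemma Rad.tau (h : Rad pos e A v r dir) {i y} (hi : e i = s(v, y)) :
    IsArc (A i \ ball (pos v) r) (pos y) (pos v + r * dir i) ∧
    (A i \ ball (pos v) r) ∩ closedBall (pos v) r = {pos v + r * dir i} ∧
    A i = (A i \ ball (pos v) r) ∪ segment ℝ (pos v + r * dir i) (pos v) := by
  obtain ⟨τ, h1, h2, h3⟩ := h.spoke i y hi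
  have hv : v ∈ e i := by rw [hi]; simp
  have hd := h.dist_pt hv
  have : A i \ ball (pos v) r = τ := by
    rw [h3]
    ext z
    constructor
    · rintro ⟨hz | hz, hb⟩
      · exact hz
      · have := seg_sphere hd h.rpos hz (by simpa using hb)
        rw [this]; exact h1.right_mem
    · intro hz
      refine ⟨Or.inl hz, fun hb => ?_⟩
      have : z ∈ τ ∩ closedBall (pos v) r := ⟨hz, ball_subset_closedBall hb⟩
      rw [h2] at this
      rw [mem_singleton_iff.1 this, mem_ball, hd] at hb
      exact lt_irrefl _ hb
  rw [this]; exact ⟨h1, h2, h3⟩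

lemma Rad.pt_mem (h : Rad pos e A v r dir) {i} (hi : v ∈ e i) : pos v + r * dir i ∈ A i := by
  obtain ⟨y, hy⟩ := Sym2.mem_iff_exists.1 hi
  exact (h.tau hy).1.right_mem.1

lemma Rad.dir_ne (h : Rad pos e A v r dir) (hs : Sys pos e A) {i j} (hij : i ≠ j) (hi : v ∈ e i) (hj : v ∈ e j) :
    dir i ≠ dir j := by
  intro hh
  obtain ⟨y, hy⟩ := hs.inter i j hij ⟨h.pt_mem hi, hh ▸ h.pt_mem hj⟩
  have hd := h.dist_pt hi
  by_cases hyv : y = v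
  · subst hyv; rw [← hy] at hd; simp at hd; linarith [h.rpos]
  · exact h.vert y hyv (by rw [hy, mem_closedBall, hd])

lemma sub_seg {c d : ℂ} {r r' : ℝ} (h0 : 0 ≤ r') (hr : 0 < r) (h1 : r' ≤ r) :
    segment ℝ (c + r * d) c = segment ℝ (c + r * d) (c + r' * d) ∪ segment ℝ (c + r' * d) c := by
  have hm : c + r' * d ∈ segment ℝ (c + r * d) c := by
    refine ⟨r' / r, 1 - r' / r, by positivity, by rw [sub_nonneg]; exact (div_le_one hr).2 h1, by ring, ?_⟩
    have : (r : ℂ) ≠ 0 := by exact_mod_cast hr.ne'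
    simp only [real_smul]; push_cast; field_simp; ring
  apply subset_antisymm
  · intro z hz
    rw [segment_eq_image'] at hz
    obtain ⟨t, ht, rfl⟩ := hz
    have e1 : c + ↑r * d + t • (c - (c + ↑r * d)) = c + ((1 - t) * r : ℝ) * d := by
      simp only [real_smul]; push_cast; ring
    simp only [e1]
    have key : ∀ x y z : ℝ, x ≤ y → y ≤ z → c + (y:ℂ) * d ∈ segment ℝ (c + (z:ℂ) * d) (c + (x:ℂ) * d) := by
      intro x y z hxy hyz
      rcases (hxy.trans hyz).eq_or_lt with h | h
      · subst h
        have : y = x := le_antisymm hyz hxy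
        subst this; exact left_mem_segment _ _ _
      · refine ⟨(y - x) / (z - x), (z - y) / (z - x), div_nonneg (by linarith) (by linarith),
          div_nonneg (by linarith) (by linarith), by rw [← add_div]; rw [div_eq_one_iff_eq] <;> linarith, ?_⟩
        have : (z : ℂ) - x ≠ 0 := by rw [← ofReal_sub]; exact_mod_cast (sub_pos.2 h).ne'
        simp only [real_smul]; push_cast; field_simp; ring
    rcases le_total r' ((1 - t) * r) with h | h
    · left; exact key _ _ _ h (by nlinarith [ht.1])
    · right; have := key 0 _ _ (by have := ht.2; apply mul_nonneg <;> linarith) h; simpa using this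
  · exact union_subset ((convex_segment _ _).segment_subset (left_mem_segment _ _ _) hm)
      ((convex_segment _ _).segment_subset hm (right_mem_segment _ _ _))

lemma Rad.mono (h : Rad pos e A v r dir) {r' : ℝ} (h0 : 0 < r') (h1 : r' ≤ r) : Rad pos e A v r' dir := by
  rcases h1.eq_or_lt with rfl | h1'
  · exact h
  have hcb : closedBall (pos v) r' ⊆ closedBall (pos v) r := closedBall_subset_closedBall h1
  refine ⟨h0, h.unit, ?_, fun i hi => (h.far i hi).mono_right hcb, fun y hy hh => h.vert y hy (hcb hh)⟩
  intro i y hi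
  obtain ⟨τ, a1, a2, a3⟩ := h.spoke i y hi
  have hv : v ∈ e i := by rw [hi]; simp
  have hu := h.unit i hv
  have hd0 : dir i ≠ 0 := by intro hh; rw [hh] at hu; simp at hu
  have hd := h.dist_pt hv
  have hd' : Dist.dist (pos v + r' * dir i) (pos v) = r' := by
    rw [dist_eq_norm, add_sub_cancel_left, norm_mul, hu]; simp [abs_of_pos h0]
  have hss := sub_seg (c := pos v) (d := dir i) h0.le h.rpos h1
  have hsub : segment ℝ (pos v + r * dir i) (pos v + r' * dir i) ⊆ segment ℝ (pos v + r * dir i) (pos v) := by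
    rw [hss]; exact subset_union_left
  refine ⟨τ ∪ segment ℝ (pos v + r * dir i) (pos v + r' * dir i), ?_, ?_, ?_⟩
  · refine a1.concat (isArc_segment ?_) ?_
    · intro hh
      rw [add_right_inj] at hh
      have := mul_right_cancel₀ hd0 hh
      exact h1'.ne (by exact_mod_cast this.symm)
    · rintro z ⟨hz1, hz2⟩
      rw [← a2]
      exact ⟨hz1, seg_in_ball hd h.rpos (hsub hz2)⟩
  · apply subset_antisymm
    · rintro z ⟨hz | hz, hzb⟩
      · have : z ∈ τ ∩ closedBall (pos v) r := ⟨hz, hcb hzb⟩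
        rw [a2] at this
        rw [mem_singleton_iff.1 this, mem_closedBall, hd] at hzb
        linarith
      · rw [segment_symm, segment_eq_image'] at hz
        obtain ⟨t, ht, rfl⟩ := hz
        rw [mem_closedBall, dist_eq_norm] at hzb
        have e1 : pos v + ↑r' * dir i + t • (pos v + ↑r * dir i - (pos v + ↑r' * dir i)) - pos v =
          ((r' + t * (r - r') : ℝ) : ℂ) * dir i := by
            simp only [real_smul]; push_cast; ring
        simp only [e1, norm_mul, hu, mul_one, norm_real, Real.norm_eq_abs] at hzb
        have := (abs_le.1 hzb).2
        have : t = 0 := by nlinarith [ht.1]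
        subst this; simp
    · rintro _ rfl
      exact ⟨Or.inr (right_mem_segment _ _ _), by rw [mem_closedBall, hd']⟩
  · rw [a3, hss, union_assoc]

/-- connected vertex set, with respect to the edges of the system -/
def Cn (R : X → X → Prop) (Q : Set X) : Prop :=
  ∀ x ∈ Q, ∀ y ∈ Q, Relation.ReflTransGen (fun a b => R a b ∧ b ∈ Q) x y

def Dr (pos : X → ℂ) (e : ι → Sym2 X) (A : ι → Set ℂ) (Q : Set X) : Set ℂ :=
  pos '' Q ∪ ⋃ (i : ι) (_ : ∀ x ∈ e i, x ∈ Q), A i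

lemma Sys.Dr_compact [Finite X] [Finite ι] (h : Sys pos e A) (Q : Set X) : IsCompact (Dr pos e A Q) := by
  refine ((Set.toFinite _).isCompact).union ?_
  exact isCompact_iUnion fun i => isCompact_iUnion fun _ => h.compact i

lemma Sys.Dr_preconn (h : Sys pos e A) {R : X → X → Prop} (hR : ∀ a b, R a b → ∃ i, e i = s(a, b)) {Q : Set X}
    (hQ : Cn R Q) : IsPreconnected (Dr pos e A Q) := by
  rcases Q.eq_empty_or_nonempty with hE | ⟨x0, hx0⟩
  · subst hE
    have : Dr pos e A ∅ = ∅ := by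
      simp only [Dr, image_empty, empty_union, iUnion_eq_empty]
      intro i hi
      obtain ⟨x, y, hxy⟩ := s2_ex (e i)
      exact absurd (hi x (by rw [hxy]; simp)) (by simp)
    rw [this]; exact isPreconnected_empty
  have step : ∀ y ∈ Q, ∃ t ⊆ Dr pos e A Q, pos x0 ∈ t ∧ pos y ∈ t ∧ IsPreconnected t := by
    intro y hy
    have hr := hQ x0 hx0 y hy
    clear hy
    induction hr with
    | refl => exact ⟨{pos x0}, by rintro _ rfl; exact Or.inl ⟨x0, hx0, rfl⟩, rfl, rfl, isPreconnected_singleton⟩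
    | @tail b c hab hbc ih =>
      obtain ⟨t, ht, h1, h2, h3⟩ := ih
      obtain ⟨i, hi⟩ := hR _ _ hbc.1
      have hbQ : b ∈ Q := by
        cases hab with
        | refl => exact hx0
        | tail _ hh => exact hh.2
      have ha := h.arc i b c hi
      refine ⟨t ∪ A i, union_subset ht ?_, Or.inl h1, Or.inr ha.right_mem,
        h3.union (pos b) h2 ha.left_mem ha.isPreconnected⟩
      intro z hz
      right
      simp only [mem_iUnion]
      refine ⟨i, ?_, hz⟩
      intro x hx
      rw [hi, Sym2.mem_iff] at hx
      rcases hx with rfl | rfl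
      · exact hbQ
      · exact hbc.2
  refine isPreconnected_of_forall (pos x0) ?_
  rintro z (⟨y, hy, rfl⟩ | hz)
  · obtain ⟨t, h1, h2, h3, h4⟩ := step y hy
    exact ⟨t, h1, h2, h3, h4⟩
  · simp only [mem_iUnion] at hz
    obtain ⟨i, hi, hz⟩ := hz
    obtain ⟨x, y, hxy⟩ := s2_ex (e i)
    have hx : x ∈ e i := by rw [hxy]; simp
    obtain ⟨t, h1, h2, h3, h4⟩ := step x (hi x hx)
    refine ⟨t ∪ A i, union_subset h1 ?_, Or.inl h2, Or.inr hz, h4.union (pos x) h3 (h.mem hx) (h.preconn i)⟩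
    intro z hz
    right
    simp only [mem_iUnion]
    exact ⟨i, hi, hz⟩

lemma Sys.Dr_disj (h : Sys pos e A) {Q Q' : Set X} (hQ : Disjoint Q Q') :
    Disjoint (Dr pos e A Q) (Dr pos e A Q') := by
  have aux : ∀ i x, pos x ∈ A i → ∀ Q : Set X, (∀ y ∈ e i, y ∈ Q) → x ∈ Q := fun i x hx Q hi => hi x (h.on _ _ hx)
  rw [Set.disjoint_left] at hQ ⊢
  rintro z (⟨x, hx, rfl⟩ | hz) (⟨y, hy, hz'⟩ | hz')
  · exact hQ hx (h.inj hz' ▸ hy)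
  · simp only [mem_iUnion] at hz'
    obtain ⟨i, hi, hz'⟩ := hz'
    exact hQ hx (aux i x hz' _ hi)
  · simp only [mem_iUnion] at hz
    obtain ⟨i, hi, hz⟩ := hz
    rw [← hz'] at hz
    exact hQ (aux i y hz _ hi) hy
  · simp only [mem_iUnion] at hz hz'
    obtain ⟨i, hi, hz⟩ := hz
    obtain ⟨j, hj, hz'⟩ := hz'
    by_cases hij : i = j
    · subst hij
      obtain ⟨x, y, hxy⟩ := s2_ex (e i)
      have hx : x ∈ e i := by rw [hxy]; simp
      exact hQ (hi x hx) (hj x hx)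
    · obtain ⟨x, rfl⟩ := h.inter i j hij ⟨hz, hz'⟩
      exact hQ (aux i x hz _ hi) (aux j x hz' _ hj)

lemma Sys.Dr_arc (h : Sys pos e A) {Q : Set X} {i x y} (hi : e i = s(x, y)) (hx : x ∉ Q) (hy : y ∉ Q) :
    Disjoint (Dr pos e A Q) (A i) := by
  have hQ : Disjoint Q {x, y} := by
    rw [Set.disjoint_right]; rintro _ (rfl | rfl) <;> assumption
  refine (h.Dr_disj hQ).mono_right ?_
  intro z hz
  right
  simp only [mem_iUnion]
  exact ⟨i, fun w hw => by rw [hi] at hw; simpa using hw, hz⟩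

lemma Rad.Dr_ball (h : Rad pos e A v r dir) {Q : Set X} (hv : v ∉ Q) :
    Disjoint (Dr pos e A Q) (closedBall (pos v) r) := by
  rw [Set.disjoint_left]
  rintro z (⟨x, hx, rfl⟩ | hz) hb
  · exact h.vert x (fun hh => hv (hh ▸ hx)) hb
  · simp only [mem_iUnion] at hz
    obtain ⟨i, hi, hz⟩ := hz
    exact Set.disjoint_left.1 (h.far i (fun hh => hv (hi v hh))) hz hb

lemma dt_scale (c a b z : ℂ) (r : ℝ) : dt (c + r * a) (c + r * b) (c + r * z) = r ^ 2 * dt a b z := by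
  simp [dt_formula]; ring

lemma Rad.alt [Finite X] [Finite ι] (h : Rad pos e A v r dir) (hs : Sys pos e A)
    {R : X → X → Prop} (hR : ∀ a b, R a b → ∃ i, e i = s(a, b)) {Q : Set X} (hQ : Cn R Q)
    {i1 i2 i3 i4 : ι} {y1 y2 y3 y4 : X} (h1 : e i1 = s(v, y1)) (h2 : e i2 = s(v, y2))
    (h3 : e i3 = s(v, y3)) (h4 : e i4 = s(v, y4)) (hvQ : v ∉ Q) (m1 : y1 ∈ Q) (m3 : y3 ∈ Q)
    (m2 : y2 ∉ Q) (m4 : y4 ∉ Q) {Z : Set ℂ} (hZ : IsPreconnected Z) (z2 : pos y2 ∈ Z) (z4 : pos y4 ∈ Z)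
    (hZb : Disjoint Z (closedBall (pos v) r)) (hZQ : Disjoint Z (Dr pos e A Q)) (hZ1 : Disjoint Z (A i1))
    (hZ3 : Disjoint Z (A i3)) :
    0 ≤ dt (dir i1) (dir i3) (dir i2) * dt (dir i1) (dir i3) (dir i4) := by
  by_contra hneg
  push Not at hneg
  have o : ∀ {i y}, e i = s(v, y) → v ∈ e i := by intro i y hh; rw [hh]; simp
  have mQ : ∀ {y}, y ∈ Q → pos y ∈ Dr pos e A Q := fun hy => Or.inl ⟨_, hy, rfl⟩
  have t1 := h.tau h1
  have t2 := h.tau h2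
  have t3 := h.tau h3
  have t4 := h.tau h4
  have bo : ∀ {S : Set ℂ}, Disjoint S (closedBall (pos v) r) → ∀ z ∈ S, r ≤ Dist.dist z (pos v) := by
    intro S hS z hz
    by_contra hc
    exact Set.disjoint_left.1 hS hz (by rw [mem_closedBall]; linarith)
  have bt : ∀ i, ∀ z ∈ A i \ ball (pos v) r, r ≤ Dist.dist z (pos v) := by
    intro i z hz; simpa using hz.2
  have := crossing (v := pos v) (r := r) (h.dist_pt (o h1)) (h.dist_pt (o h2)) (h.dist_pt (o h3)) (h.dist_pt (o h4))
    (Y := Dr pos e A Q ∪ (A i1 \ ball (pos v) r) ∪ (A i3 \ ball (pos v) r))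
    (Z := Z ∪ (A i2 \ ball (pos v) r) ∪ (A i4 \ ball (pos v) r))
    (((hs.Dr_compact Q).union t1.1.isCompact).union t3.1.isCompact)
    (((hs.Dr_preconn hR hQ).union (pos y1) (mQ m1) t1.1.left_mem t1.1.isPreconnected).union (pos y3)
      (Or.inl (mQ m3)) t3.1.left_mem t3.1.isPreconnected)
    ((hZ.union (pos y2) z2 t2.1.left_mem t2.1.isPreconnected).union (pos y4)
      (Or.inl z4) t4.1.left_mem t4.1.isPreconnected)
    (Or.inl (Or.inr t1.1.right_mem)) (Or.inr t3.1.right_mem) (Or.inl (Or.inr t2.1.right_mem))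
    (Or.inr t4.1.right_mem)
    (by rintro z ((hz | hz) | hz); exacts [bo (h.Dr_ball hvQ) z hz, bt _ z hz, bt _ z hz])
    (by rintro z ((hz | hz) | hz); exacts [bo hZb z hz, bt _ z hz, bt _ z hz])
    (by
      rw [dt_scale, dt_scale]
      have : 0 < r ^ 2 := by have := h.rpos; positivity
      have := mul_pos this this
      nlinarith)
  obtain ⟨z, hzY, hzZ⟩ := this
  have arcs : ∀ {i j y y'}, e i = s(v, y) → e j = s(v, y') → y ∈ Q → y' ∉ Q →
      z ∈ A i \ ball (pos v) r → z ∈ A j \ ball (pos v) r → False := by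
    intro i j y y' hi hj hy hy' hz hz'
    have hij : i ≠ j := by
      rintro rfl
      rw [hi] at hj
      have := Sym2.congr_right.1 hj
      exact hy' (this ▸ hy)
    obtain ⟨x, rfl⟩ := hs.inter i j hij ⟨hz.1, hz'.1⟩
    have a1 := hs.on _ _ hz.1
    have a2 := hs.on _ _ hz'.1
    rw [hi, Sym2.mem_iff] at a1
    rw [hj, Sym2.mem_iff] at a2
    rcases a1 with rfl | rfl
    · exact hz.2 (by simp [h.rpos])
    · rcases a2 with rfl | rfl
      · exact hvQ hy
      · exact hy' hy
  rcases hzY with (hzY | hzY) | hzY <;> rcases hzZ with (hzZ | hzZ) | hzZ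
  · exact Set.disjoint_left.1 hZQ hzZ hzY
  · exact Set.disjoint_left.1 (hs.Dr_arc h2 hvQ m2) hzY hzZ.1
  · exact Set.disjoint_left.1 (hs.Dr_arc h4 hvQ m4) hzY hzZ.1
  · exact Set.disjoint_left.1 hZ1 hzZ hzY.1
  · exact arcs h1 h2 m1 m2 hzY hzZ
  · exact arcs h1 h4 m1 m4 hzY hzZ
  · exact Set.disjoint_left.1 hZ3 hzZ hzY.1
  · exact arcs h3 h2 m3 m2 hzY hzZ
  · exact arcs h3 h4 m3 m4 hzY hzZ

lemma Rad.alt2 [Finite X] [Finite ι] (h : Rad pos e A v r dir) (hs : Sys pos e A)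
    {R : X → X → Prop} (hR : ∀ a b, R a b → ∃ i, e i = s(a, b)) {Q Q' : Set X} (hQ : Cn R Q)
    (hQ' : Cn R Q') (hd : Disjoint Q Q')
    {i1 i2 i3 i4 : ι} {y1 y2 y3 y4 : X} (h1 : e i1 = s(v, y1)) (h2 : e i2 = s(v, y2))
    (h3 : e i3 = s(v, y3)) (h4 : e i4 = s(v, y4)) (hvQ : v ∉ Q) (hvQ' : v ∉ Q') (m1 : y1 ∈ Q) (m3 : y3 ∈ Q)
    (m2 : y2 ∈ Q') (m4 : y4 ∈ Q') :
    0 ≤ dt (dir i1) (dir i3) (dir i2) * dt (dir i1) (dir i3) (dir i4) := by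
  have hd' := Set.disjoint_left.1 hd
  exact h.alt hs hR hQ h1 h2 h3 h4 hvQ m1 m3 (fun hh => hd' hh m2) (fun hh => hd' hh m4) (hs.Dr_preconn hR hQ')
    (Or.inl ⟨_, m2, rfl⟩) (Or.inl ⟨_, m4, rfl⟩) (h.Dr_ball hvQ') (hs.Dr_disj hd.symm)
    (hs.Dr_arc h1 hvQ' (hd' m1)) (hs.Dr_arc h3 hvQ' (hd' m3))
end
end TG

namespace TG
open Set Complex Filter Topology Metric
open scoped ComplexConjugate

section
variable {O ι : Type*} {pos : Option O → ℂ} {e : ι → Sym2 (Option O)} {A : ι → Set ℂ} {r : ℝ} {dir : ι → ℂ}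

lemma seg_aff (c a b : ℂ) (r : ℝ) : segment ℝ (c + r * a) (c + r * b) = (fun z => c + r * z) '' segment ℝ a b := by
  rw [segment_eq_image, segment_eq_image, image_image]
  apply image_congr
  intro t _
  simp only [real_smul]; push_cast; ring

def exMap (t : Fin 3) : Option O → O ⊕ Fin 3
  | some o => Sum.inl o
  | none => Sum.inr t

lemma Rad.explode (h : Rad pos e A none r dir) (hs : Sys pos e A) (g : ι → Fin 3) (k : Fin 3 → ι)
    (hk : ∀ j, none ∈ e (k j)) (hkg : ∀ j, g (k j) = j)
    (hcc : ∀ i j, i ≠ j → none ∈ e i → none ∈ e j → ∀ z, z ∈ segment ℝ (dir i) (dir (k (g i))) →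
      z ∈ segment ℝ (dir j) (dir (k (g j))) → z ∈ range (dir ∘ k))
    (hcs : ∀ i, none ∈ e i → ∀ s z, z ∈ segment ℝ (dir i) (dir (k (g i))) →
      z ∈ segment ℝ (dir (k (s + 1))) (dir (k (s + 2))) → z ∈ range (dir ∘ k)) :
    ∃ pos' A', Sys (X := O ⊕ Fin 3) (ι := ι ⊕ Fin 3) pos'
      (Sum.elim (fun i => (e i).map (exMap (g i))) (fun s => s(Sum.inr (s + 1), Sum.inr (s + 2)))) A' := by
  classical
  set c := pos none with hc
  set pt : ℂ → ℂ := fun z => c + r * z with hpt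
  have hrc : (r : ℂ) ≠ 0 := by exact_mod_cast h.rpos.ne'
  have ptinj : Function.Injective pt := by
    intro a b hab
    simp only [hpt, add_right_inj] at hab
    exact mul_left_cancel₀ hrc hab
  have kinj : Function.Injective k := fun a b hab => by rw [← hkg a, ← hkg b, hab]
  have hT : Tri (dir ∘ k) := ⟨fun a b hab => by
      by_contra hne
      exact h.dir_ne hs (kinj.ne hne) (hk a) (hk b) hab, fun i => h.unit _ (hk i)⟩
  have distpt : ∀ i, none ∈ e i → dist (pt (dir i)) c = r := fun i hi => h.dist_pt hi
  have ptball : ∀ {a b z : ℂ}, ‖a‖ = 1 → ‖b‖ = 1 → z ∈ pt '' segment ℝ a b → z ∈ closedBall c r := by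
    rintro a b z ha hb ⟨w, hw, rfl⟩
    have := norm_seg ha.le hb.le hw
    rw [mem_closedBall, dist_eq_norm]
    simp only [hpt, add_sub_cancel_left, norm_mul, norm_real, Real.norm_eq_abs, abs_of_pos h.rpos]
    nlinarith [h.rpos]
  have ptsph : ∀ {a b z : ℂ}, ‖a‖ = 1 → ‖b‖ = 1 → z ∈ pt '' segment ℝ a b → dist z c = r → z = pt a ∨ z = pt b := by
    rintro a b z ha hb hz hzc
    have : z ∈ segment ℝ (pt a) (pt b) := by simp only [hpt]; rw [seg_aff]; exact hz
    by_contra hcon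
    push Not at hcon
    have hb' := seg_ball (v := c) h.rpos (ptball ha hb ⟨a, left_mem_segment _ _ _, rfl⟩)
      (ptball ha hb ⟨b, right_mem_segment _ _ _, rfl⟩) this hcon.1 hcon.2
    rw [mem_ball, hzc] at hb'
    exact lt_irrefl _ hb'
  have tau := fun i y (hi : e i = s(none, y)) => h.tau hi
  set τ : ι → Set ℂ := fun i => A i \ ball c r with hτ
  have hun := h.unit
  have hkun := fun j => h.unit _ (hk j)
  have τsph : ∀ i z, none ∈ e i → z ∈ τ i → z ∈ closedBall c r → z = pt (dir i) := by
    intro i z hi hz hzb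
    obtain ⟨y, hy⟩ := Sym2.mem_iff_exists.1 hi
    have : z ∈ (A i \ ball c r) ∩ closedBall c r := ⟨hz, hzb⟩
    rw [(tau i y hy).2.1] at this
    exact this
  set ch : ι → Set ℂ := fun i => pt '' segment ℝ (dir i) (dir (k (g i))) with hch
  set pos' : O ⊕ Fin 3 → ℂ := Sum.elim (fun o => pos (some o)) (fun j => pt (dir (k j))) with hpos'
  have posout : ∀ o : O, pos (some o) ∉ closedBall c r := fun o => h.vert _ (by simp)
  have chb : ∀ i, none ∈ e i → ch i ⊆ closedBall c r := fun i hi z hz => ptball (hun i hi) (hkun _) hz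
  set B : ι ⊕ Fin 3 → Set ℂ := Sum.elim (fun i => if none ∈ e i then τ i ∪ ch i else A i)
    (fun s => pt '' segment ℝ (dir (k (s + 1))) (dir (k (s + 2)))) with hB
  have sideb : ∀ s : Fin 3, B (Sum.inr s) ⊆ closedBall c r := fun s z hz => ptball (hkun _) (hkun _) hz
  have Bi : ∀ i, none ∈ e i → B (Sum.inl i) = τ i ∪ ch i := fun i hi => by simp [hB, hi]
  have Bn : ∀ i, none ∉ e i → B (Sum.inl i) = A i := fun i hi => by simp [hB, hi]
  have rng : ∀ w, w ∈ range (dir ∘ k) → pt w ∈ range pos' := by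
    rintro _ ⟨j, rfl⟩; exact ⟨Sum.inr j, rfl⟩
  have rngA : ∀ i j z, i ≠ j → z ∈ A i → z ∈ A j → z ∉ ball c r → z ∈ range pos' := by
    intro i j z hij hi hj hz
    obtain ⟨x, rfl⟩ := hs.inter i j hij ⟨hi, hj⟩
    cases x with
    | none => exact absurd (by simp [hc, h.rpos]) hz
    | some o => exact ⟨Sum.inl o, rfl⟩
  refine ⟨pos', B, ⟨?_, ?_, ?_, ?_⟩⟩
  · rintro (o | j) (o' | j') hh
    · simp only [hpos', Sum.elim_inl] at hh
      rw [Option.some_injective _ (hs.inj hh)]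
    · simp only [hpos', Sum.elim_inl, Sum.elim_inr] at hh
      exact absurd (by rw [hh, mem_closedBall, distpt _ (hk j')]) (posout o)
    · simp only [hpos', Sum.elim_inl, Sum.elim_inr] at hh
      exact absurd (by rw [← hh, mem_closedBall, distpt _ (hk j)]) (posout o')
    · simp only [hpos', Sum.elim_inr] at hh
      rw [hT.inj (ptinj hh)]
  · have key : ∀ i o, e i = s(none, some o) → IsArc (B (Sum.inl i)) (pos' (Sum.inl o)) (pos' (Sum.inr (g i))) := by
      intro i o hi
      have hni : none ∈ e i := by rw [hi]; simp
      rw [Bi i hni]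
      have t := tau i _ hi
      by_cases heq : dir i = dir (k (g i))
      · have : ch i = {pt (dir i)} := by simp only [hch]; rw [← heq, segment_same, image_singleton]
        rw [this, union_singleton, insert_eq_of_mem t.1.right_mem]
        have := t.1
        rw [heq] at this
        exact this
      · refine t.1.concat (T := ch i) ?_ ?_
        · simp only [hch, hpt]
          rw [← seg_aff]
          exact isArc_segment fun hh => heq (ptinj hh)
        · rintro z ⟨hz1, hz2⟩
          exact τsph i z hni hz1 (chb i hni hz2)
    rintro (i | s) x y hxy
    · simp only [Sum.elim_inl] at hxy
      obtain ⟨a, b, hab⟩ := s2_ex (e i)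
      have hane : a ≠ b := fun hh => (hs.arc i a b hab).ne (by rw [hh])
      rw [hab, Sym2.map_mk] at hxy
      have : IsArc (B (Sum.inl i)) (pos' (exMap (g i) a)) (pos' (exMap (g i) b)) := by
        cases a with
        | none =>
          cases b with
          | none => exact absurd rfl hane
          | some o => exact (key i o hab).symm
        | some o =>
          cases b with
          | none => exact key i o (by rw [hab, Sym2.eq_swap])
          | some o' =>
            rw [Bn i (by rw [hab]; simp)]
            exact hs.arc i _ _ hab
      rw [Sym2.eq_iff] at hxy
      rcases hxy with ⟨rfl, rfl⟩ | ⟨rfl, rfl⟩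
      · exact this
      · exact this.symm
    · simp only [Sum.elim_inr] at hxy
      have : IsArc (B (Sum.inr s)) (pos' (Sum.inr (s + 1))) (pos' (Sum.inr (s + 2))) := by
        simp only [hB, Sum.elim_inr, hpos', hpt]
        rw [← seg_aff]
        exact isArc_segment fun hh => f33 s (hT.inj (ptinj hh))
      rw [Sym2.eq_iff] at hxy
      rcases hxy with ⟨rfl, rfl⟩ | ⟨rfl, rfl⟩
      · exact this
      · exact this.symm
  · rintro (i | s) x hx
    · simp only [Sum.elim_inl]
      by_cases hi : none ∈ e i
      · rw [Bi i hi] at hx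
        rcases x with o | j
        · rcases hx with hx | hx
          · have := hs.on i _ hx.1
            exact Sym2.mem_map.2 ⟨_, this, rfl⟩
          · exact absurd (chb i hi hx) (posout o)
        · refine Sym2.mem_map.2 ⟨none, hi, ?_⟩
          simp only [exMap, Sum.inr.injEq]
          have hsph : dist (pos' (Sum.inr j)) c = r := distpt _ (hk j)
          have hcases : pt (dir (k j)) = pt (dir i) ∨ pt (dir (k j)) = pt (dir (k (g i))) := by
            rcases hx with hx | hx
            · left; exact τsph i _ hi hx (mem_closedBall.2 hsph.le)
            · exact ptsph (hun i hi) (hkun _) hx hsph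
          rcases hcases with hh | hh
          · by_contra hne
            exact h.dir_ne hs (fun hh' => hne (by rw [← hh', hkg])) (hk j) hi (ptinj hh)
          · exact (hT.inj (ptinj hh)).symm
      · rw [Bn i hi] at hx
        rcases x with o | j
        · exact Sym2.mem_map.2 ⟨_, hs.on i _ hx, rfl⟩
        · exact absurd (by rw [mem_closedBall]; exact (distpt _ (hk j)).le) (Set.disjoint_left.1 (h.far i hi) hx)
    · rcases x with o | j
      · exact absurd (sideb s hx) (posout o)
      · simp only [Sum.elim_inr, Sym2.mem_iff, Sum.inr.injEq]
        rcases ptsph (hkun _) (hkun _) hx (distpt _ (hk j)) with hh | hh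
        · exact Or.inl (hT.inj (ptinj hh))
        · exact Or.inr (hT.inj (ptinj hh))
  · have c1 : ∀ i j, i ≠ j → none ∈ e i → none ∈ e j → ∀ z, z ∈ τ i → z ∈ ch j → z ∈ range pos' := by
      intro i j hij hi hj z hz hz'
      have e1 := τsph i z hi hz (chb j hj hz')
      subst e1
      rcases ptsph (hun j hj) (hkun _) hz' (distpt i hi) with hh | hh
      · exact absurd (ptinj hh) (h.dir_ne hs hij hi hj)
      · rw [hh]; exact rng _ ⟨_, rfl⟩
    have c2 : ∀ i s, ∀ z, z ∈ B (Sum.inl i) → z ∈ B (Sum.inr s) → z ∈ range pos' := by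
      intro i s z hz hz'
      by_cases hi : none ∈ e i
      · rw [Bi i hi] at hz
        rcases hz with hz | hz
        · have e1 := τsph i z hi hz (sideb s hz')
          subst e1
          rcases ptsph (hkun _) (hkun _) hz' (distpt i hi) with hh | hh <;>
          · rw [hh]; exact rng _ ⟨_, rfl⟩
        · obtain ⟨w, hw, rfl⟩ := hz
          obtain ⟨w', hw', hww⟩ := hz'
          have := ptinj hww
          subst this
          exact rng _ (hcs i hi s _ hw hw')
      · rw [Bn i hi] at hz
        exact absurd (sideb s hz') (Set.disjoint_left.1 (h.far i hi) hz)
    have c3 : ∀ i j, none ∈ e i → none ∉ e j → ∀ z, z ∈ B (Sum.inl i) → z ∈ B (Sum.inl j) → z ∈ range pos' := by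
      intro i j hi hj z hz hz'
      rw [Bi i hi] at hz
      rw [Bn j hj] at hz'
      have hij : i ≠ j := fun hh => hj (hh ▸ hi)
      have hzn := Set.disjoint_left.1 (h.far j hj) hz'
      rcases hz with hz | hz
      · exact rngA i j z hij hz.1 hz' (fun hh => hzn (ball_subset_closedBall hh))
      · exact absurd (chb i hi hz) hzn
    rintro (i | s) (j | s') hij z ⟨hz, hz'⟩
    · have hij' : i ≠ j := fun hh => hij (by rw [hh])
      by_cases hi : none ∈ e i <;> by_cases hj : none ∈ e j
      · rw [Bi i hi] at hz
        rw [Bi j hj] at hz'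
        rcases hz with hz | hz <;> rcases hz' with hz' | hz'
        · exact rngA i j z hij' hz.1 hz'.1 hz.2
        · exact c1 i j hij' hi hj z hz hz'
        · exact c1 j i hij'.symm hj hi z hz' hz
        · obtain ⟨w, hw, rfl⟩ := hz
          obtain ⟨w', hw', hww⟩ := hz'
          have := ptinj hww
          subst this
          exact rng _ (hcc i j hij' hi hj _ hw hw')
      · exact c3 i j hi hj z hz hz'
      · exact c3 j i hj hi z hz' hz
      · rw [Bn i hi] at hz
        rw [Bn j hj] at hz'
        exact rngA i j z hij' hz hz' (fun hh => Set.disjoint_left.1 (h.far j hj) hz' (ball_subset_closedBall hh))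
    · exact c2 i s' z hz hz'
    · exact c2 j s z hz' hz
    · obtain ⟨w, hw, rfl⟩ := hz
      obtain ⟨w', hw', hww⟩ := hz'
      have := ptinj hww
      subst this
      exact rng _ (hT.side_side (fun hh => hij (by rw [hh])) hw hw')
end
end TG

namespace TG
open Set Complex Filter Topology Metric
open scoped ComplexConjugate

variable {X ι : Type*} {pos : X → ℂ} {e : ι → Sym2 X} {A : ι → Set ℂ} {v : X} {r : ℝ} {dir : ι → ℂ}

def dw (pos : X → ℂ) (A : ι → Set ℂ) : Set ℂ := range pos ∪ ⋃ i, A i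

lemma mem_spoke {c d : ℂ} {r s : ℝ} (hr : 0 < r) (h0 : 0 ≤ s) (h1 : s ≤ r) : c + s * d ∈ segment ℝ (c + r * d) c := by
  rw [sub_seg h0 hr h1]; exact Or.inl (right_mem_segment ℝ _ _)

lemma spoke_form {c d z : ℂ} {r : ℝ} (hr : 0 < r) (h : z ∈ segment ℝ (c + r * d) c) (hz : z ≠ c) :
    ∃ s : ℝ, 0 < s ∧ s ≤ r ∧ z = c + s * d := by
  obtain ⟨a, b, ha, hb, hab, rfl⟩ := h
  have e1 : a • (c + r * d) + b • c = c + ((a * r : ℝ) : ℂ) * d := by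
    rw [show b = 1 - a by linarith]; simp only [real_smul]; push_cast; ring
  rw [e1] at hz ⊢
  refine ⟨a * r, ?_, by nlinarith, rfl⟩
  rcases ha.eq_or_lt with h | h
  · subst h; simp at hz
  · positivity

lemma Rad.mem_A (h : Rad pos e A v r dir) {j} (hj : v ∈ e j) {s : ℝ} (h0 : 0 ≤ s) (h1 : s ≤ r) :
    pos v + s * dir j ∈ A j := by
  obtain ⟨y, hy⟩ := Sym2.mem_iff_exists.1 hj
  rw [(h.tau hy).2.2]
  exact Or.inr (mem_spoke h.rpos h0 h1)

lemma Rad.in_A (h : Rad pos e A v r dir) {j} {s : ℝ} (h0 : 0 < s) (h1 : s < r) {d : ℂ} (hd : ‖d‖ = 1)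
    (hm : pos v + s * d ∈ A j) : v ∈ e j ∧ d = dir j := by
  have hb : dist (pos v + s * d) (pos v) = s := by
    rw [dist_eq_norm, add_sub_cancel_left, norm_mul, hd]; simp [abs_of_pos h0]
  have hv : v ∈ e j := by
    by_contra hc
    exact (Set.disjoint_left.1 (h.far j hc)) hm (by rw [mem_closedBall, hb]; exact h1.le)
  refine ⟨hv, ?_⟩
  obtain ⟨y, hy⟩ := Sym2.mem_iff_exists.1 hv
  rw [(h.tau hy).2.2] at hm
  rcases hm with hm | hm
  · exact absurd (by rw [mem_ball, hb]; exact h1) hm.2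
  have hne : pos v + s * d ≠ pos v := by
    intro hh; rw [hh, dist_self] at hb; linarith
  obtain ⟨s', h3, h4, h5⟩ := spoke_form h.rpos hm hne
  have h6 : (s : ℂ) * d = s' * dir j := add_left_cancel h5
  have h7 : s = s' := by
    have := congrArg norm h6
    simpa [hd, h.unit j hv, abs_of_pos h0, abs_of_pos h3] using this
  subst h7
  have hs : (s : ℂ) ≠ 0 := by exact_mod_cast h0.ne'
  exact mul_left_cancel₀ hs h6

lemma Rad.in_dw (h : Rad pos e A v r dir) {s : ℝ} (h0 : 0 < s) (h1 : s < r) {d : ℂ} (hd : ‖d‖ = 1)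
    (hne : ∀ j, v ∈ e j → d ≠ dir j) : pos v + s * d ∉ dw pos A := by
  have hb : dist (pos v + s * d) (pos v) = s := by
    rw [dist_eq_norm, add_sub_cancel_left, norm_mul, hd]; simp [abs_of_pos h0]
  rintro (⟨y, hy⟩ | hm)
  · by_cases hyv : y = v
    · subst hyv; rw [← hy, dist_self] at hb; linarith
    · exact h.vert y hyv (by rw [hy, mem_closedBall, hb]; exact h1.le)
  · obtain ⟨j, hj⟩ := mem_iUnion.1 hm
    obtain ⟨a, b⟩ := h.in_A h0 h1 hd hj
    exact hne j a b

lemma Sys.dw_compact [Finite X] [Finite ι] (h : Sys pos e A) : IsCompact (dw pos A) :=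
  (Set.finite_range pos).isCompact.union (isCompact_iUnion fun i => h.compact i)

lemma double_arc [Finite X] [Finite ι] {x : X} {rx : ℝ} {dx : ι → ℂ} (hs : Sys pos e A) (hv : Rad pos e A v r dir)
    (hx : Rad pos e A x rx dx) {i0 : ι} (hi0 : e i0 = s(v, x)) (hvx : v ≠ x) {η : ℝ}
    (hη : ∀ t : ℝ, 0 < t → t ≤ 1 → ∀ j, v ∈ e j → dir i0 * exp ((t * η : ℝ) * I) ≠ dir j) :
    ∃ (T : Set ℂ) (ρ : ℝ), 0 < ρ ∧ ρ < r ∧ IsArc T (pos x) (pos v + ρ * (dir i0 * exp (η * I))) ∧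
      T ⊆ (dw pos A)ᶜ ∪ {pos x} ∧
      T ∩ segment ℝ (pos v + ρ * (dir i0 * exp (η * I))) (pos v) ⊆ {pos v + ρ * (dir i0 * exp (η * I))} := by
  have hvi : v ∈ e i0 := by rw [hi0]; simp
  have hxi : x ∈ e i0 := by rw [hi0]; simp
  have hdu : ∀ t : ℝ, ‖dir i0 * exp ((t * η : ℝ) * I)‖ = 1 := fun t => by
    rw [norm_mul, hv.unit i0 hvi, norm_exp_ofReal_mul_I, one_mul]
  set d' := dir i0 * exp (η * I) with hd'
  have hd1 : d' = dir i0 * exp ((1 * η : ℝ) * I) := by rw [one_mul]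
  have hd'u : ‖d'‖ = 1 := by rw [hd1]; exact hdu 1
  have hd'n : ∀ j, v ∈ e j → d' ≠ dir j := by rw [hd1]; exact hη 1 one_pos le_rfl
  have hr := hv.rpos
  set ρ := r / 2 with hρ
  have hρ0 : 0 < ρ := by positivity
  have hρr : ρ < r := by rw [hρ]; linarith
  set p := pos v + ρ * d' with hp
  have hpD : p ∉ dw pos A := hv.in_dw hρ0 hρr hd'u hd'n
  set Δ := dw pos A with hΔ
  have hΔc : IsCompact Δ := hs.dw_compact
  set A0 : Set ℂ := range pos ∪ ⋃ i : {i // i ≠ i0}, A i with hA0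
  have hA0c : IsCompact A0 := (Set.finite_range pos).isCompact.union (isCompact_iUnion fun i => hs.compact i)
  have hA0Δ : A0 ⊆ Δ := by
    refine union_subset_union_right _ (iUnion_subset fun i => subset_iUnion A i.1)
  have harc : IsArc (A i0) (pos v) (pos x) := hs.arc _ _ _ hi0
  have hAA : A i0 ∩ A0 ⊆ {pos v, pos x} := by
    rintro z ⟨hz, hz'⟩
    have : z ∈ range pos := by
      rcases hz' with hz' | hz'
      · exact hz'
      · obtain ⟨i, hi⟩ := mem_iUnion.1 hz'
        exact hs.inter _ _ i.2 ⟨hi, hz⟩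
    obtain ⟨y, rfl⟩ := this
    have := hs.on _ _ hz
    rw [hi0, Sym2.mem_iff] at this
    rcases this with rfl | rfl <;> simp
  -- x-spoke
  have hi0' : e i0 = s(x, v) := by rw [hi0, Sym2.eq_swap]
  obtain ⟨hτ, hτb, hτA⟩ := hx.tau hi0'
  set τ := A i0 \ ball (pos x) rx with hτd
  set s := pos x + rx * dx i0 with hsd
  have hrx := hx.rpos
  set s' := pos x + ((rx / 2 : ℝ) : ℂ) * dx i0 with hs'
  have hs'A : s' ∈ A i0 := hx.mem_A hxi (by positivity) (by linarith)
  have hs'd : dist s' (pos x) = rx / 2 := by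
    rw [hs', dist_eq_norm, add_sub_cancel_left, norm_mul, hx.unit i0 hxi]; simp [abs_of_pos hrx]
  have hs'τ : s' ∉ τ := fun h => h.2 (by rw [mem_ball, hs'd]; linarith)
  have hs'x : s' ≠ pos x := fun h => by rw [h, dist_self] at hs'd; linarith
  have hs'v : s' ≠ pos v := fun h => hx.vert v hvx (by rw [← h, mem_closedBall, hs'd]; linarith)
  have hpA : p ∉ A i0 := fun h => hpD (Or.inr (mem_iUnion.2 ⟨_, h⟩))
  -- link
  have L1 : Lk A0 p s' := by
    let W : Set ℂ := (fun t : ℝ => pos v + ρ * (dir i0 * exp ((t * η : ℝ) * I))) '' Icc 0 1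
    have hW : IsPreconnected W := isPreconnected_Icc.image _ (by fun_prop)
    have hm : pos v + ρ * dir i0 ∈ A i0 := hv.mem_A hvi hρ0.le hρr.le
    have hmd : dist (pos v + ρ * dir i0) (pos v) = ρ := by
      rw [dist_eq_norm, add_sub_cancel_left, norm_mul, hv.unit i0 hvi]; simp [abs_of_pos hρ0]
    have hmv : pos v + ρ * dir i0 ≠ pos v := fun h => by rw [h, dist_self] at hmd; linarith
    have hmx : pos v + ρ * dir i0 ≠ pos x := fun h => hv.vert x hvx.symm (by
      rw [← h, mem_closedBall, hmd]; exact hρr.le)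
    have hm2 : pos v + ρ * dir i0 ∈ A i0 \ {pos v, pos x} := ⟨hm, by simp [hmv, hmx]⟩
    have hsub : A i0 \ {pos v, pos x} ⊆ A0ᶜ := fun z hz hz' => hz.2 (hAA ⟨hz.1, hz'⟩)
    refine ⟨W ∪ (A i0 \ {pos v, pos x}), hW.union _ ⟨0, by simp, by simp⟩ hm2 harc.diff_both, union_subset ?_ hsub,
      Or.inl ⟨1, by simp, by simp [hp, hd']⟩, Or.inr ⟨hs'A, by simp [hs'v, hs'x]⟩⟩
    rintro _ ⟨t, ht, rfl⟩
    rcases ht.1.eq_or_lt with h | h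
    · subst h; simp only [zero_mul, ofReal_zero, exp_zero, mul_one]; exact hsub hm2
    · exact fun hh => hv.in_dw hρ0 hρr (hdu t) (hη t h ht.2) (hA0Δ hh)
  have L2 : Lk (A0 ∪ τ) p s' := by
    refine janiszewski hA0c hτ.isCompact ?_ L1 (hτ.Lk (fun h => hpA h.1) hs'τ)
    have : A0 ∩ τ ⊆ {pos v} := by
      rintro z ⟨h1, h2⟩
      rcases hAA ⟨h2.1, h1⟩ with h | h
      · exact h
      · rw [mem_singleton_iff] at h; subst h; exact absurd (mem_ball_self hrx) h2.2
    exact (subsingleton_singleton.anti this).isPreconnected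
  set F := connectedComponentIn Δᶜ p with hF
  have hFo : IsOpen F := hΔc.isClosed.isOpen_compl.connectedComponentIn
  have hFp : IsPreconnected F := isPreconnected_connectedComponentIn
  have hFΔ : F ⊆ Δᶜ := connectedComponentIn_subset _ _
  have hpF : p ∈ F := mem_connectedComponentIn hpD
  have hτΔ : A0 ∪ τ ⊆ Δ := union_subset hA0Δ (fun z hz => Or.inr (mem_iUnion.2 ⟨i0, hz.1⟩))
  obtain ⟨C, hC, hCc, hpC, hsC⟩ := L2
  obtain ⟨y, hyF, hyC, hyn⟩ : ∃ y, y ∈ closure F ∧ y ∈ C ∧ y ∉ F := by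
    by_contra hcon
    push Not at hcon
    have : C ⊆ F := by
      refine hC.subset_of_closure_inter_subset hFo ⟨p, hpC, hpF⟩ ?_
      rintro z ⟨h1, h2⟩; exact hcon z h1 h2
    exact hFΔ (this hsC) (Or.inr (mem_iUnion.2 ⟨i0, hs'A⟩))
  have hyΔ : y ∈ Δ := frontier_comp hΔc.isClosed p (by rw [hFo.frontier_eq]; exact ⟨hyF, hyn⟩)
  have hyA : y ∉ A0 ∪ τ := hCc hyC
  have hyi : y ∈ A i0 := by
    rcases hyΔ with h | h
    · exact absurd (Or.inl (Or.inl h)) hyA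
    · obtain ⟨j, hj⟩ := mem_iUnion.1 h
      by_cases hji : j = i0
      · exact hji ▸ hj
      · exact absurd (Or.inl (Or.inr (mem_iUnion.2 ⟨⟨j, hji⟩, hj⟩))) hyA
  have hyb : y ∈ ball (pos x) rx := by
    by_contra h; exact hyA (Or.inr ⟨hyi, h⟩)
  have hyx : y ≠ pos x := by rintro rfl; exact hyA (Or.inl (Or.inl ⟨x, rfl⟩))
  obtain ⟨z, ⟨hzb, hzx⟩, hzF⟩ := mem_closure_iff.1 hyF (ball (pos x) rx ∩ {pos x}ᶜ)
    (isOpen_ball.inter isOpen_compl_singleton) ⟨hyb, hyx⟩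
  have hxD : pos x ∈ Δ := Or.inl ⟨x, rfl⟩
  have hzn : (0:ℝ) < ‖z - pos x‖ := norm_pos_iff.2 (sub_ne_zero.2 hzx)
  set δ := ‖z - pos x‖ with hδ
  have hδr : δ < rx := by rw [mem_ball, dist_eq_norm] at hzb; exact hzb
  have hδc : (δ : ℂ) ≠ 0 := by exact_mod_cast hzn.ne'
  set dz := (z - pos x) / δ with hdz
  have hdzu : ‖dz‖ = 1 := by
    rw [hdz, norm_div, ← hδ]; simp [abs_of_pos hzn, hzn.ne']
  have hzf : z = pos x + δ * dz := by rw [hdz]; field_simp; ring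
  have hdzn : ∀ j, x ∈ e j → dz ≠ dx j := by
    intro j hj hh
    apply hFΔ hzF
    rw [hzf, hh]
    exact Or.inr (mem_iUnion.2 ⟨j, hx.mem_A hj hzn.le hδr.le⟩)
  have hseg : segment ℝ z (pos x) \ {pos x} ⊆ F := by
    have hpc : IsPreconnected (segment ℝ z (pos x) \ {pos x}) := by
      rw [segment_symm]; exact (isArc_segment (Ne.symm hzx)).diff_left
    have hzs : z ∈ segment ℝ z (pos x) \ {pos x} := ⟨left_mem_segment ℝ _ _, hzx⟩
    rw [hF, connectedComponentIn_eq hzF]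
    refine hpc.subset_connectedComponentIn hzs ?_
    rintro w ⟨hw, hwx⟩
    rw [hzf] at hw
    obtain ⟨t, t0, t1, rfl⟩ := spoke_form hzn hw hwx
    exact hx.in_dw t0 (t1.trans_lt hδr) hdzu hdzn
  obtain ⟨S, hS, hSF⟩ := exists_arc hFo hFp (fun h => hFΔ h hxD) hzF hpF hseg
  have hvS : pos v ∉ S := by
    intro h
    rcases hSF h with h | h
    · exact hFΔ h (Or.inl ⟨v, rfl⟩)
    · exact hvx (hs.inj h)
  have hxp : pos x ∉ segment ℝ p (pos v) := by
    intro h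
    have hpd : dist p (pos v) = ρ := by
      rw [hp, dist_eq_norm, add_sub_cancel_left, norm_mul, hd'u]; simp [abs_of_pos hρ0]
    have := seg_in_ball hpd hρ0 h
    exact hv.vert x hvx.symm (closedBall_subset_closedBall hρr.le this)
  obtain ⟨q, T, h1, h2, h3, h4, h5, h6⟩ := hS.extend_seg hvS hxp
  obtain ⟨t, t0, t1, rfl⟩ := spoke_form hρ0 h3 h4
  exact ⟨T, t, t0, t1.trans_lt hρr, h1, (h2.trans hSF).trans (union_subset_union_left _ hFΔ), h5⟩

lemma double_eta [Finite ι] (hs : Sys pos e A) (hv : Rad pos e A v r dir) {i0 : ι} (hi0 : v ∈ e i0) :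
    ∃ η0 > 0, ∀ η : ℝ, 0 < |η| → |η| < η0 → ∀ t : ℝ, 0 < t → t ≤ 1 → ∀ j, v ∈ e j →
      dir i0 * exp ((t * η : ℝ) * I) ≠ dir j := by
  have hu := hv.unit i0 hi0
  have h0 : dir i0 ≠ 0 := by intro h; rw [h] at hu; simp at hu
  have key : ∀ᶠ θ : ℝ in 𝓝 0, θ ≠ 0 → ∀ j, v ∈ e j → dir i0 * exp (θ * I) ≠ dir j := by
    have h1 : ∀ j, ∀ᶠ θ : ℝ in 𝓝 0, θ ≠ 0 → v ∈ e j → dir i0 * exp (θ * I) ≠ dir j := by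
      intro j
      by_cases hj : j = i0
      · subst hj
        filter_upwards [Ioo_mem_nhds (a := -1) (b := 1) (by norm_num) (by norm_num)] with θ hθ hne _ hh
        have : exp (θ * I) = 1 := mul_left_cancel₀ h0 (by rw [hh, mul_one])
        obtain ⟨n, hn⟩ := Complex.exp_eq_one_iff.1 this
        have h2 : θ = n * (2 * Real.pi) := by
          have := congrArg Complex.im hn
          simpa using this
        have hn0 : n ≠ 0 := by rintro rfl; simp at h2; exact hne h2
        have h3 : (1:ℝ) ≤ |(n:ℝ)| := by exact_mod_cast Int.one_le_abs hn0
        have h4 : |θ| < 1 := abs_lt.2 hθ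
        rw [h2, abs_mul, abs_of_pos Real.two_pi_pos] at h4
        nlinarith [Real.pi_gt_three]
      · by_cases hvj : v ∈ e j
        · have hd := hv.dir_ne hs (Ne.symm hj) hi0 hvj
          have : Tendsto (fun θ : ℝ => dir i0 * exp (θ * I)) (𝓝 0) (𝓝 (dir i0)) := by
            have : Continuous (fun θ : ℝ => dir i0 * exp (θ * I)) := by fun_prop
            simpa using this.tendsto 0
          filter_upwards [this.eventually_ne hd] with θ h _ _ using h
        · exact Filter.Eventually.of_forall fun θ _ h => absurd h hvj
    filter_upwards [Filter.eventually_all.2 h1] with θ h hθ j hj using h j hθ hj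
  obtain ⟨ε, hε, hb⟩ := Metric.eventually_nhds_iff.1 key
  refine ⟨ε, hε, fun η h1 h2 t t0 t1 j hj => hb ?_ (mul_ne_zero t0.ne' (abs_pos.1 h1)) j hj⟩
  rw [dist_zero_right, Real.norm_eq_abs, abs_mul, abs_of_pos t0]
  nlinarith

def exE (e : ι → Sym2 X) (s : Sym2 X) : Option ι → Sym2 X := fun o => o.elim s e
def exA (A : ι → Set ℂ) (B : Set ℂ) : Option ι → Set ℂ := fun o => o.elim B A
def exD (dir : ι → ℂ) (d : ℂ) : Option ι → ℂ := fun o => o.elim d dir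

lemma ext_sys (hs : Sys pos e A) {v x : X} {B : Set ℂ} (hB : IsArc B (pos v) (pos x))
    (hBd : B ∩ dw pos A ⊆ {pos v, pos x}) : Sys pos (exE e s(v, x)) (exA A B) := by
  have hmem : ∀ z ∈ ({pos v, pos x} : Set ℂ), z ∈ range pos := by rintro z (rfl | rfl) <;> exact ⟨_, rfl⟩
  refine ⟨hs.inj, ?_, ?_, ?_⟩
  · rintro (_ | i) a b hab
    · simp only [exE, Option.elim] at hab
      rcases Sym2.eq_iff.1 hab with ⟨rfl, rfl⟩ | ⟨rfl, rfl⟩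
      · exact hB
      · exact hB.symm
    · exact hs.arc i a b hab
  · rintro (_ | i) a ha
    · have := hBd ⟨ha, Or.inl ⟨a, rfl⟩⟩
      rcases this with h | h
      · rw [hs.inj h]; simp [exE]
      · rw [hs.inj h]; simp [exE]
    · exact hs.on i a ha
  · rintro (_ | i) (_ | j) hij
    · exact absurd rfl hij
    · rintro z ⟨h1, h2⟩; exact hmem z (hBd ⟨h1, Or.inr (mem_iUnion.2 ⟨j, h2⟩)⟩)
    · rintro z ⟨h2, h1⟩; exact hmem z (hBd ⟨h1, Or.inr (mem_iUnion.2 ⟨i, h2⟩)⟩)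
    · exact hs.inter i j (fun h => hij (by rw [h]))

lemma ext_rad_far {y : X} {r : ℝ} {dir : ι → ℂ} (hR : Rad pos e A y r dir) {v x : X} {B : Set ℂ}
    (hB : IsCompact B) (hy : pos y ∉ B) (hyv : y ≠ v) (hyx : y ≠ x) (d : ℂ) :
    ∃ r', Rad pos (exE e s(v, x)) (exA A B) y r' (exD dir d) := by
  obtain ⟨ε, hε, hb⟩ := Metric.isOpen_iff.1 hB.isClosed.isOpen_compl _ hy
  have hr := hR.rpos
  have hR' := hR.mono (r' := min r (ε / 2)) (by positivity) (min_le_left _ _)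
  have hno : y ∉ s(v, x) := by simp [hyv, hyx]
  refine ⟨min r (ε / 2), hR'.rpos, ?_, ?_, ?_, hR'.vert⟩
  · rintro (_ | i) hi
    · exact absurd hi hno
    · exact hR'.unit i hi
  · rintro (_ | i) z hi
    · exact absurd (by simp only [exE, Option.elim] at hi; rw [hi]; simp) hno
    · exact hR'.spoke i z hi
  · rintro (_ | i) hi
    · rw [Set.disjoint_left]
      intro z hz hz'
      exact hb (closedBall_subset_ball ((min_le_right _ _).trans_lt (by linarith)) hz') hz
    · exact hR'.far i hi

lemma ext_rad_v {x : X} (hR : Rad pos e A v r dir) (hvx : v ≠ x) {T : Set ℂ} {ρ : ℝ} {d : ℂ} (hd : ‖d‖ = 1)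
    (hρ : 0 < ρ) (hT : IsArc T (pos x) (pos v + ρ * d)) (hvT : pos v ∉ T) (hTs : T ∩ segment ℝ (pos v + ρ * d) (pos v) ⊆ {pos v + ρ * d}) :
    ∃ r', Rad pos (exE e s(v, x)) (exA A (T ∪ segment ℝ (pos v + ρ * d) (pos v))) v r' (exD dir d) := by
  obtain ⟨ε, hε, hb⟩ := Metric.isOpen_iff.1 hT.isCompact.isClosed.isOpen_compl _ hvT
  have hr := hR.rpos
  set r' := min r (min (ε / 2) (ρ / 2)) with hr'
  have hr0 : 0 < r' := by positivity
  have hR' := hR.mono (r' := r') hr0 (min_le_left _ _)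
  have hrε : r' ≤ ε / 2 := (min_le_right _ _).trans (min_le_left _ _)
  have hrρ : r' ≤ ρ / 2 := (min_le_right _ _).trans (min_le_right _ _)
  have hdist : ∀ s : ℝ, 0 ≤ s → dist (pos v + s * d) (pos v) = s := fun s hs => by
    rw [dist_eq_norm, add_sub_cancel_left, norm_mul, hd]; simp [abs_of_nonneg hs]
  have hTb : ∀ z ∈ T, z ∉ closedBall (pos v) r' := fun z hz hz' =>
    hb (closedBall_subset_ball (by linarith) hz') hz
  have hne : pos v + ρ * d ≠ pos v + r' * d := by
    intro h
    have h1 := hdist ρ hρ.le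
    rw [h, hdist r' hr0.le] at h1; linarith
  have hsub := sub_seg (c := pos v) (d := d) hr0.le hρ (by linarith : r' ≤ ρ)
  have hspoke : ∀ z, z ∈ segment ℝ (pos v + ρ * d) (pos v + r' * d) → z ∈ closedBall (pos v) r' → z = pos v + r' * d := by
    intro z hz hzb
    obtain ⟨a, b, ha, hb, hab, rfl⟩ := hz
    have e1 : a • (pos v + ρ * d) + b • (pos v + r' * d) = pos v + ((a * ρ + b * r' : ℝ) : ℂ) * d := by
      rw [show b = 1 - a by linarith]; simp only [real_smul]; push_cast; ring
    rw [e1, mem_closedBall, hdist _ (by positivity)] at hzb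
    have : a = 0 := by
      by_contra h
      have : 0 < a := lt_of_le_of_ne ha (Ne.symm h)
      nlinarith
    subst this
    have : b = 1 := by linarith
    subst this; simp
  refine ⟨r', hr0, ?_, ?_, ?_, hR'.vert⟩
  · rintro (_ | i) hi
    · exact hd
    · exact hR'.unit i hi
  · rintro (_ | i) z hi
    · have hz : z = x := by
        simp only [exE, Option.elim] at hi
        rcases Sym2.eq_iff.1 hi with ⟨_, h⟩ | ⟨h, h'⟩
        · exact h.symm
        · exact absurd h'.symm hvx
      subst hz
      have hc := hT.concat (isArc_segment hne) (by
        refine subset_trans (inter_subset_inter_right _ ?_) hTs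
        rw [hsub]; exact subset_union_left)
      refine ⟨_, hc, ?_, ?_⟩
      · apply subset_antisymm
        · rintro w ⟨hw | hw, hwb⟩
          · exact absurd hwb (hTb w hw)
          · exact hspoke w hw hwb
        · rintro _ rfl
          exact ⟨Or.inr (right_mem_segment ℝ _ _), by
            simp only [exD, Option.elim]; rw [mem_closedBall, hdist r' hr0.le]⟩
      · simp only [exA, exD, Option.elim]; rw [hsub, union_assoc]
    · exact hR'.spoke i z hi
  · rintro (_ | i) hi
    · exact absurd (by simp [exE]) hi
    · exact hR'.far i hi

lemma double [Finite X] [Finite ι] {x : X} {rx : ℝ} {dx : ι → ℂ} (hs : Sys pos e A) (hv : Rad pos e A v r dir)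
    (hx : Rad pos e A x rx dx) {i0 : ι} (hi0 : e i0 = s(v, x)) (hvx : v ≠ x) :
    ∃ η0 > 0, ∀ η : ℝ, 0 < |η| → |η| < η0 → ∃ B r', Sys pos (exE e s(v, x)) (exA A B) ∧
      Rad pos (exE e s(v, x)) (exA A B) v r' (exD dir (dir i0 * exp (η * I))) ∧
      ∀ y, y ≠ v → y ≠ x → ∀ ry dy, Rad pos e A y ry dy →
        ∃ r'', Rad pos (exE e s(v, x)) (exA A B) y r'' (exD dy 0) := by
  have hvi : v ∈ e i0 := by rw [hi0]; simp
  obtain ⟨η0, h0, hη0⟩ := double_eta hs hv hvi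
  refine ⟨η0, h0, fun η h1 h2 => ?_⟩
  have hη := hη0 η h1 h2
  obtain ⟨T, ρ, hρ, hρr, hT, hTD, hTs⟩ := double_arc hs hv hx hi0 hvx hη
  set d := dir i0 * exp (η * I) with hd
  have hdu : ‖d‖ = 1 := by rw [hd, norm_mul, hv.unit i0 hvi, norm_exp_ofReal_mul_I, one_mul]
  have hdn : ∀ j, v ∈ e j → d ≠ dir j := fun j hj => by simpa [hd] using hη 1 one_pos le_rfl j hj
  have hvT : pos v ∉ T := by
    intro h
    rcases hTD h with h | h
    · exact h (Or.inl ⟨v, rfl⟩)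
    · exact hvx (hs.inj h)
  have hne : pos v + ρ * d ≠ pos v := by
    intro h; exact hvT (h ▸ hT.right_mem)
  set B := T ∪ segment ℝ (pos v + ρ * d) (pos v) with hB
  have hBa : IsArc B (pos x) (pos v) := hT.concat (isArc_segment hne) hTs
  have hBd : B ∩ dw pos A ⊆ {pos v, pos x} := by
    rintro z ⟨hz | hz, hzD⟩
    · rcases hTD hz with h | h
      · exact absurd hzD h
      · exact Or.inr h
    · by_cases hzv : z = pos v
      · exact Or.inl hzv
      · obtain ⟨s, s0, s1, rfl⟩ := spoke_form hρ hz hzv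
        exact absurd hzD (hv.in_dw s0 (s1.trans_lt hρr) hdu hdn)
  obtain ⟨r', hr'⟩ := ext_rad_v hv hvx hdu hρ hT hvT hTs
  refine ⟨B, r', ext_sys hs hBa.symm hBd, hr', fun y hyv hyx ry dy hy => ext_rad_far hy hBa.isCompact ?_ hyv hyx _⟩
  intro h
  rcases hBd ⟨h, Or.inl ⟨y, rfl⟩⟩ with h | h
  · exact hyv (hs.inj h)
  · exact hyx (hs.inj h)

end TG

namespace TG
open Set Complex Filter Topology Metric
open scoped ComplexConjugate

lemma planar_of_inj {V W : Type*} {G : SimpleGraph V} (hG : G.IsPlanar) (H : SimpleGraph W) (φ : W → V)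
    (hφ : Function.Injective φ) (hH : ∀ u v, H.Adj u v → G.Adj (φ u) (φ v)) : H.IsPlanar := by
  obtain ⟨E⟩ := hG
  obtain ⟨A, hA, -⟩ := Sys.of_embedding E
  exact hA.planar H φ hφ fun u v h => ⟨⟨s(φ u, φ v), hH u v h⟩, rfl⟩

variable {O : Type*}

def TgRel (K : SimpleGraph (Option O)) (n : Fin 3 → O) (u w : O) (p q : Fin 3) : O ⊕ Fin 3 → O ⊕ Fin 3 → Prop
  | Sum.inl x, Sum.inl y => K.Adj (some x) (some y)
  | Sum.inl x, Sum.inr j => x = n j ∨ (x = u ∧ j = p) ∨ (x = w ∧ j = q)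
  | Sum.inr _, Sum.inl _ => False
  | Sum.inr _, Sum.inr _ => True

def Tg (K : SimpleGraph (Option O)) (n : Fin 3 → O) (u w : O) (p q : Fin 3) : SimpleGraph (O ⊕ Fin 3) :=
  SimpleGraph.fromRel (TgRel K n u w p q)

lemma Tg_swap (K : SimpleGraph (Option O)) (n : Fin 3 → O) (u w : O) (p q : Fin 3) :
    Tg K n u w p q = Tg K n w u q p := by
  unfold Tg; congr 1; funext a b
  rcases a with a | a <;> rcases b with b | b <;> simp only [TgRel]
  rw [or_comm (a := _ ∧ _)]

lemma f3e : ∀ a b : Fin 3, a ≠ b → ∃ s : Fin 3, (s + 1 = a ∧ s + 2 = b) ∨ (s + 1 = b ∧ s + 2 = a) := by decide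

lemma f3m : ∀ m su sw : Fin 3, su ≠ sw → ∃ p q : Fin 3, p ≠ q ∧ p ≠ m ∧ q ≠ m ∧ p ≠ su ∧ q ≠ sw := by decide

variable {ι : Type*} {pos : Option O → ℂ} {e : ι → Sym2 (Option O)} {A : ι → Set ℂ} {r : ℝ} {dir : ι → ℂ}

lemma planar_Tg {K : SimpleGraph (Option O)} {n : Fin 3 → O} {u w : O} (hs : Sys pos e A) (hR : Rad pos e A none r dir)
    (hK : ∀ x y, K.Adj (some x) (some y) → ∃ i, e i = s(some x, some y)) {k : Fin 3 → ι} {iu iw : ι}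
    (hk : ∀ j, e (k j) = s(none, some (n j))) (hn : Function.Injective n)
    (hu : e iu = s(none, some u)) (hw : e iw = s(none, some w)) (huw : iu ≠ iw) (huk : ∀ j, iu ≠ k j)
    (hwk : ∀ j, iw ≠ k j) {su sw p q : Fin 3} (hsu : bt (dir ∘ k) su (dir iu) < 0) (hsw : bt (dir ∘ k) sw (dir iw) < 0)
    (hp : p ≠ su) (hq : q ≠ sw)
    (hpq : ∀ z, z ∈ segment ℝ (dir iu) (dir (k p)) → z ∈ segment ℝ (dir iw) (dir (k q)) → z ∈ range (dir ∘ k)) :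
    (Tg K n u w p q).IsPlanar := by
  classical
  have kinj : Function.Injective k := fun a b hab => by
    apply hn
    have := hk a
    rw [hab, hk b] at this
    simpa using this.symm
  let κ := {i : ι // none ∉ e i ∨ i ∈ range k ∨ i = iu ∨ i = iw}
  let f : κ → ι := Subtype.val
  have hs' := hs.reindex f Subtype.val_injective
  have hR' := hR.reindex f
  let k' : Fin 3 → κ := fun j => ⟨k j, Or.inr (Or.inl ⟨j, rfl⟩)⟩
  let u' : κ := ⟨iu, by simp⟩
  let w' : κ := ⟨iw, by simp⟩
  let g : κ → Fin 3 := fun i => if (i : ι) = iu then p else if (i : ι) = iw then q else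
    if h : ∃ j, k j = i then h.choose else 0
  have gk : ∀ j, g (k' j) = j := by
    intro j
    have hex : ∃ j', k j' = k j := ⟨j, rfl⟩
    have : g (k' j) = hex.choose := by
      simp only [g, k', (huk j).symm, (hwk j).symm, if_false]
      rw [dif_pos hex]
    rw [this]; exact kinj hex.choose_spec
  have gu : g u' = p := by simp [g, u']
  have gw : g w' = q := by simp [g, w', huw.symm]
  have hcls : ∀ i : κ, none ∈ (e ∘ f) i → (∃ j, i = k' j) ∨ i = u' ∨ i = w' := by
    rintro ⟨i, hi⟩ hi'
    rcases hi with h | ⟨j, rfl⟩ | rfl | rfl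
    · exact absurd hi' h
    · exact Or.inl ⟨j, rfl⟩
    · exact Or.inr (Or.inl rfl)
    · exact Or.inr (Or.inr rfl)
  have hdk : ∀ (j : Fin 3) z, z ∈ segment ℝ ((dir ∘ f) (k' j)) ((dir ∘ f) (k' (g (k' j)))) → z ∈ range ((dir ∘ f) ∘ k') := by
    intro j z hz
    rw [gk j, segment_same] at hz
    exact ⟨j, hz.symm⟩
  have hpu : ∀ z, z ∈ segment ℝ ((dir ∘ f) u') ((dir ∘ f) (k' (g u'))) → z ∈ segment ℝ ((dir ∘ f) w') ((dir ∘ f) (k' (g w')))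
      → z ∈ range ((dir ∘ f) ∘ k') := by
    rw [gu, gw]; exact hpq
  obtain ⟨pos', A', hS⟩ := hR'.explode hs' g k' (fun j => by show none ∈ e (k j); rw [hk j]; simp) gk (by
    intro i j hij hi hj z hz hz'
    rcases hcls i hi with ⟨a, rfl⟩ | rfl | rfl
    · exact hdk a z hz
    · rcases hcls j hj with ⟨b, rfl⟩ | rfl | rfl
      · exact hdk b z hz'
      · exact absurd rfl hij
      · exact hpu z hz hz'
    · rcases hcls j hj with ⟨b, rfl⟩ | rfl | rfl
      · exact hdk b z hz'
      · exact hpu z hz' hz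
      · exact absurd rfl hij) (by
    intro i hi s z hz hz'
    rcases hcls i hi with ⟨a, rfl⟩ | rfl | rfl
    · exact hdk a z hz
    · rw [gu] at hz
      exact Tri.chord_side (T := dir ∘ k) hsu hp hz hz'
    · rw [gw] at hz
      exact Tri.chord_side (T := dir ∘ k) hsw hq hz hz')
  have key : ∀ a b, a ≠ b → TgRel K n u w p q a b → ∃ i : κ ⊕ Fin 3,
      (Sum.elim (fun i => ((e ∘ f) i).map (exMap (g i))) (fun s => s(Sum.inr (s + 1), Sum.inr (s + 2)))) i = s(a, b) := by
    rintro (x | i) (y | j) hne h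
    · obtain ⟨i, hi⟩ := hK x y h
      refine ⟨Sum.inl ⟨i, Or.inl (by rw [hi]; simp)⟩, ?_⟩
      exact (congrArg (Sym2.map (exMap _)) hi).trans (by simp [exMap])
    · rcases h with rfl | ⟨rfl, rfl⟩ | ⟨rfl, rfl⟩
      · refine ⟨Sum.inl (k' j), ?_⟩
        show Sym2.map (exMap (g (k' j))) (e (k j)) = _
        rw [hk j, gk j]; simp [exMap, Sym2.eq_swap]
      · refine ⟨Sum.inl u', ?_⟩
        show Sym2.map (exMap (g u')) (e iu) = _
        rw [hu, gu]; simp [exMap, Sym2.eq_swap]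
      · refine ⟨Sum.inl w', ?_⟩
        show Sym2.map (exMap (g w')) (e iw) = _
        rw [hw, gw]; simp [exMap, Sym2.eq_swap]
    · exact absurd h id
    · obtain ⟨s, hs⟩ := f3e i j (fun h => hne (by rw [h]))
      refine ⟨Sum.inr s, ?_⟩
      rcases hs with ⟨rfl, rfl⟩ | ⟨rfl, rfl⟩
      · rfl
      · exact Sym2.eq_swap
  refine hS.planar _ id Function.injective_id fun a b hab => ?_
  rcases (SimpleGraph.fromRel_adj _ _ _).1 hab with ⟨hne, h | h⟩
  · exact key a b hne h
  · obtain ⟨i, hi⟩ := key b a hne.symm h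
    exact ⟨i, hi.trans Sym2.eq_swap⟩

lemma planar_diff {K : SimpleGraph (Option O)} {n : Fin 3 → O} {u w : O} (hs : Sys pos e A) (hR : Rad pos e A none r dir)
    (hK : ∀ x y, K.Adj (some x) (some y) → ∃ i, e i = s(some x, some y)) {k : Fin 3 → ι} {iu iw : ι}
    (hk : ∀ j, e (k j) = s(none, some (n j))) (hn : Function.Injective n) (hT : Tri (dir ∘ k))
    (hu : e iu = s(none, some u)) (hw : e iw = s(none, some w)) (huw : iu ≠ iw) (huk : ∀ j, iu ≠ k j)
    (hwk : ∀ j, iw ≠ k j) {su sw : Fin 3} (hsu : bt (dir ∘ k) su (dir iu) < 0) (hsw : bt (dir ∘ k) sw (dir iw) < 0)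
    (hss : su ≠ sw) (m : Fin 3) : ∃ p q, p ≠ q ∧ p ≠ m ∧ q ≠ m ∧ (Tg K n u w p q).IsPlanar := by
  obtain ⟨p, q, h1, h2, h3, h4, h5⟩ := f3m m su sw hss
  refine ⟨p, q, h1, h2, h3, planar_Tg hs hR hK hk hn hu hw huw huk hwk hsu hsw h4 h5 fun z hz hz' => ?_⟩
  exact hT.chord_chord hsu h4 hsw h5 hss (hR.unit _ (by rw [hu]; simp)).le hz hz'

lemma Cn.map {X Y : Type*} {R : X → X → Prop} {R' : Y → Y → Prop} {f : X → Y} (hf : ∀ a b, R a b → R' (f a) (f b))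
    {Q : Set X} (h : Cn R Q) : Cn R' (f '' Q) := by
  rintro _ ⟨x, hx, rfl⟩ _ ⟨y, hy, rfl⟩
  exact (h x hx y hy).lift f (fun a b hab => ⟨hf a b hab.1, b, hab.2, rfl⟩)

lemma rad_tri {n : Fin 3 → O} (hs : Sys pos e A) (hR : Rad pos e A none r dir) {k : Fin 3 → ι}
    (hk : ∀ j, e (k j) = s(none, some (n j))) (hn : Function.Injective n) : Tri (dir ∘ k) := by
  have kinj : Function.Injective k := fun a b hab => by
    apply hn
    have := hk a
    rw [hab, hk b] at this
    simpa using this.symm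
  have hm : ∀ j, none ∈ e (k j) := fun j => by rw [hk j]; simp
  refine ⟨fun a b hab => ?_, fun j => hR.unit _ (hm j)⟩
  by_contra hne
  exact hR.dir_ne hs (kinj.ne hne) (hm a) (hm b) hab

lemma dbl_side [Finite O] [Finite ι] {n : Fin 3 → O} (hs : Sys pos e A) (hR : Rad pos e A none r dir) {k : Fin 3 → ι}
    (hk : ∀ j, e (k j) = s(none, some (n j))) (hn : Function.Injective n) (i : Fin 3) {rx dx}
    (hx : Rad pos e A (some (n i)) rx dx) (s0 : Fin 3) :
    ∃ d s B r', s ≠ s0 ∧ bt (dir ∘ k) s d < 0 ∧ Sys pos (exE e s(none, some (n i))) (exA A B) ∧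
      Rad pos (exE e s(none, some (n i))) (exA A B) none r' (exD dir d) ∧
      ∀ y, y ≠ none → y ≠ some (n i) → ∀ ry dy, Rad pos e A y ry dy →
        ∃ r'', Rad pos (exE e s(none, some (n i))) (exA A B) y r'' (exD dy 0) := by
  have hT := rad_tri hs hR hk hn
  obtain ⟨η1, h1, s, s', hss, hrot⟩ := hT.rot i
  obtain ⟨η0, h0, hd⟩ := double hs hR hx (hk i) (by simp)
  have hmin : 0 < min η0 η1 := lt_min h0 h1
  set η := min η0 η1 / 2 with hη
  have hη0 : 0 < η := by positivity
  have a1 : η < η0 := by have := min_le_left η0 η1; linarith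
  have a2 : η < η1 := by have := min_le_right η0 η1; linarith
  obtain ⟨b1, b2⟩ := hrot η hη0 a2
  by_cases hc : s = s0
  · obtain ⟨B, r', c1, c2, c3⟩ := hd (-η) (by rw [abs_neg, abs_of_pos hη0]; exact hη0)
      (by rw [abs_neg, abs_of_pos hη0]; exact a1)
    exact ⟨_, s', B, r', fun h => hss (hc.trans h.symm), b2, c1, c2, c3⟩
  · obtain ⟨B, r', c1, c2, c3⟩ := hd η (by rw [abs_of_pos hη0]; exact hη0)
      (by rw [abs_of_pos hη0]; exact a1)
    exact ⟨_, s, B, r', hc, b1, c1, c2, c3⟩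

theorem core_in [Finite O] {K : SimpleGraph (Option O)} (hK : K.IsPlanar) {n : Fin 3 → O} (hn : Function.Injective n)
    {u w : O} (huw : u ≠ w) (kn : ∀ j, K.Adj none (some (n j))) (ku : K.Adj none (some u)) (kw : K.Adj none (some w))
    (hu : u ∈ range n) (m : Fin 3) : ∃ p q, p ≠ q ∧ p ≠ m ∧ q ≠ m ∧ (Tg K n u w p q).IsPlanar := by
  obtain ⟨E⟩ := hK
  obtain ⟨A0, hA0, -⟩ := Sys.of_embedding E
  obtain ⟨r0, hr0, hst⟩ := hA0.straighten
  obtain ⟨A, D, hs, hR, -⟩ := hst (r0 / 2) (by positivity) (by linarith)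
  let k : Fin 3 → K.edgeSet := fun j => ⟨s(none, some (n j)), kn j⟩
  have hk : ∀ j, ((k j : K.edgeSet) : Sym2 (Option O)) = s(none, some (n j)) := fun j => rfl
  have hKe : ∀ x y, K.Adj (some x) (some y) → ∃ i : K.edgeSet, (i : Sym2 _) = s(some x, some y) :=
    fun x y h => ⟨⟨s(some x, some y), h⟩, rfl⟩
  obtain ⟨i, rfl⟩ := hu
  have hT := rad_tri hs (hR none) hk hn
  by_cases hw : w ∈ range n
  · obtain ⟨j, rfl⟩ := hw
    obtain ⟨d, su, B, r', -, hsu, hs', hR', hpr⟩ := dbl_side hs (hR none) hk hn i (hR _) 0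
    obtain ⟨r2, hR2⟩ := hpr (some (n j)) (by simp) (by simpa using huw.symm) _ _ (hR _)
    obtain ⟨d2, sw, B2, r3, hsw', hsw, hs'', hR'', -⟩ := dbl_side (k := fun j => some (k j)) hs' hR' (fun j => hk j) hn j hR2 su
    refine planar_diff (k := fun j => some (some (k j))) (iu := some none) (iw := none) hs'' hR'' ?_ (fun j => hk j) hn ?_ rfl rfl
      (by simp) (by simp) (by simp) (su := su) (sw := sw) hsu hsw hsw'.symm m
    · intro x y h
      obtain ⟨i, hi⟩ := hKe x y h
      exact ⟨some (some i), hi⟩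
    · exact hT
  · let iw : K.edgeSet := ⟨s(none, some w), kw⟩
    have hwk : ∀ j, iw ≠ k j := fun j h => hw ⟨j, by
      have := congrArg Subtype.val h
      simpa [iw, k] using this.symm⟩
    have hiw : none ∈ (iw : Sym2 (Option O)) := by simp [iw]
    obtain ⟨sw, hsw⟩ := hT.sector ((hR none).unit iw hiw)
      (fun j => (hR none).dir_ne hs (hwk j) hiw (by rw [hk j]; simp))
    obtain ⟨d, su, B, r', hne, hsu, hs', hR', -⟩ := dbl_side hs (hR none) hk hn i (hR _) sw
    refine planar_diff (k := fun j => some (k j)) (iu := none) (iw := some iw) hs' hR' ?_ (fun j => hk j) hn hT rfl rfl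
      (by simp) (by simp) (fun j h => hwk j (Option.some.inj h)) (su := su) (sw := sw) hsu hsw hne m
    · intro x y h
      obtain ⟨i, hi⟩ := hKe x y h
      exact ⟨some i, hi⟩

lemma f3o : ∀ s : Fin 3, s + 1 ≠ s ∧ s + 2 ≠ s ∧ s + 1 ≠ s + 2 := by decide

theorem core [Finite O] {K : SimpleGraph (Option O)} (hK : K.IsPlanar) {n : Fin 3 → O} (hn : Function.Injective n)
    {u w : O} (huw : u ≠ w) (kn : ∀ j, K.Adj none (some (n j))) (ku : K.Adj none (some u)) (kw : K.Adj none (some w)) :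
    (∀ m, ∃ p q, p ≠ q ∧ p ≠ m ∧ q ≠ m ∧ (Tg K n u w p q).IsPlanar) ∨
    (u ∉ range n ∧ w ∉ range n ∧ (∃ m p q, p ≠ q ∧ p ≠ m ∧ q ≠ m ∧ (Tg K n u w p q).IsPlanar) ∧
      ∃ k0 : Fin 3, ∀ y, (y = u ∨ y = w) → ∀ Q Q' : Set O, Cn (fun a b => K.Adj (some a) (some b)) Q →
        Cn (fun a b => K.Adj (some a) (some b)) Q' → Disjoint Q Q' → n (k0 + 1) ∈ Q → n (k0 + 2) ∈ Q →
        n k0 ∈ Q' → y ∈ Q' → False) := by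
  by_cases hu : u ∈ range n
  · exact Or.inl fun m => core_in hK hn huw kn ku kw hu m
  by_cases hw : w ∈ range n
  · left; intro m
    obtain ⟨p, q, h1, h2, h3, h4⟩ := core_in hK hn huw.symm kn kw ku hw m
    exact ⟨q, p, h1.symm, h3, h2, by rw [Tg_swap]; exact h4⟩
  obtain ⟨E⟩ := hK
  obtain ⟨A0, hA0, -⟩ := Sys.of_embedding E
  obtain ⟨r0, hr0, hst⟩ := hA0.straighten
  obtain ⟨A, D, hs, hR, -⟩ := hst (r0 / 2) (by positivity) (by linarith)
  let k : Fin 3 → K.edgeSet := fun j => ⟨s(none, some (n j)), kn j⟩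
  have hk : ∀ j, ((k j : K.edgeSet) : Sym2 (Option O)) = s(none, some (n j)) := fun j => rfl
  have hkm : ∀ j, none ∈ ((k j : K.edgeSet) : Sym2 (Option O)) := fun j => by rw [hk j]; simp
  have hKe : ∀ x y, K.Adj (some x) (some y) → ∃ i : K.edgeSet, (i : Sym2 _) = s(some x, some y) :=
    fun x y h => ⟨⟨s(some x, some y), h⟩, rfl⟩
  have hT := rad_tri hs (hR none) hk hn
  let iu : K.edgeSet := ⟨s(none, some u), ku⟩
  let iw : K.edgeSet := ⟨s(none, some w), kw⟩
  have hsec : ∀ y (ky : K.Adj none (some y)), y ∉ range n → (∀ j, (⟨s(none, some y), ky⟩ : K.edgeSet) ≠ k j) := by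
    intro y ky hy j h
    exact hy ⟨j, by
      have := congrArg Subtype.val h
      simpa [k] using this.symm⟩
  have huk : ∀ j, iu ≠ k j := hsec u ku hu
  have hwk : ∀ j, iw ≠ k j := hsec w kw hw
  have hium : none ∈ (iu : Sym2 (Option O)) := by simp [iu]
  have hiwm : none ∈ (iw : Sym2 (Option O)) := by simp [iw]
  have hne : iu ≠ iw := fun h => huw (by
      have := congrArg Subtype.val h
      simpa [iu, iw] using this)
  have dne := fun {a b} => (hR none).dir_ne hs (i := a) (j := b)
  have un := (hR none).unit
  obtain ⟨su, hsu⟩ := hT.sector (un iu hium) (fun j => dne (huk j) hium (hkm j))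
  obtain ⟨sw, hsw⟩ := hT.sector (un iw hiwm) (fun j => dne (hwk j) hiwm (hkm j))
  by_cases hss : su = sw
  swap
  · exact Or.inl fun m => planar_diff hs (hR none) hKe hk hn hT rfl rfl hne huk hwk hsu hsw hss m
  right
  subst hss
  obtain ⟨f1, f2, f3⟩ := f3o su
  refine ⟨hu, hw, ?_, su, ?_⟩
  · have kk : k (su + 1) ≠ k (su + 2) := fun h => f3 (hT.inj (congrArg (D none) h))
    rcases chords_alt (un iu hium) (un _ (hkm (su + 1))) (un iw hiwm) (un _ (hkm (su + 2)))
      (dne (huk _) hium (hkm _)) (dne hne hium hiwm) (dne (huk _) hium (hkm _)) (dne (hwk _).symm (hkm _) hiwm)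
      (dne kk (hkm _) (hkm _)) (dne (hwk _) hiwm (hkm _)) with h | h
    · exact ⟨su, su + 1, su + 2, f3, f1, f2, planar_Tg hs (hR none) hKe hk hn rfl rfl hne huk hwk hsu hsw f1 f2
        fun z a b => (h z a b).elim⟩
    · exact ⟨su, su + 2, su + 1, f3.symm, f2, f1, planar_Tg hs (hR none) hKe hk hn rfl rfl hne huk hwk hsu hsw f2 f1
        fun z a b => (h z a b).elim⟩
  · have main : ∀ iy : K.edgeSet, ∀ y, (iy : Sym2 _) = s(none, some y) → bt (D none ∘ k) su (D none iy) < 0 →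
        ∀ Q Q' : Set O, Cn (fun a b => K.Adj (some a) (some b)) Q →
        Cn (fun a b => K.Adj (some a) (some b)) Q' → Disjoint Q Q' → n (su + 1) ∈ Q → n (su + 2) ∈ Q →
        n su ∈ Q' → y ∈ Q' → False := by
      intro iy y hy hb Q Q' cQ cQ' hd m1 m2 m3 m4
      have := (hR none).alt2 hs (R := K.Adj) (Q := some '' Q) (Q' := some '' Q')
        (fun a b h => ⟨⟨s(a, b), h⟩, rfl⟩) (Cn.map (f := some) (fun a b h => h) cQ) (Cn.map (f := some) (fun a b h => h) cQ')
        ((Set.disjoint_image_iff (Option.some_injective _)).2 hd) (hk (su + 1)) (hk su) (hk (su + 2)) hy (by simp) (by simp)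
        ⟨_, m1, rfl⟩ ⟨_, m2, rfl⟩ ⟨_, m3, rfl⟩ ⟨_, m4, rfl⟩
      have e1 := bt_T_eq (D none ∘ k) su
      have e2 : dt (D none (k (su + 1))) (D none (k (su + 2))) (D none (k su)) ≠ 0 :=
        dt_ne (hT.unit _) (hT.unit _) (hT.unit _) (hT.inj.ne f3) (hT.inj.ne f1) (hT.inj.ne f2)
      have e3 := hT.D_ne
      simp only [bt, Function.comp] at e1 e3 hb
      set x := dt (D none (k (su + 1))) (D none (k (su + 2))) (D none (k su))
      set y := dt (D none (k (su + 1))) (D none (k (su + 2))) (D none iy)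
      set z := dt (D none (k 0)) (D none (k 1)) (D none (k 2))
      have e4 : 0 < x * z := lt_of_le_of_ne e1 (Ne.symm (mul_ne_zero e2 e3))
      have e5 : x * z * (y * z) < 0 := mul_neg_of_pos_of_neg e4 hb
      nlinarith [mul_nonneg this (sq_nonneg z)]
    rintro y (rfl | rfl)
    · exact main iu _ rfl hsu
    · exact main iw _ rfl hsw

end TG

namespace TG
open Set Complex Filter Topology Metric
open scoped ComplexConjugate

section cn
variable {X : Type*} {R : X → X → Prop}

def cmp (R : X → X → Prop) (Q : Set X) (y : X) : Set X := {z | Relation.ReflTransGen (fun a b => R a b ∧ b ∈ Q) y z}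

lemma cmp_self {Q : Set X} {y} : y ∈ cmp R Q y := Relation.ReflTransGen.refl

lemma cmp_sub {Q : Set X} {y} (hy : y ∈ Q) : cmp R Q y ⊆ Q := by
  intro z hz
  rcases Relation.ReflTransGen.cases_tail hz with h | ⟨c, _, h⟩
  · exact h ▸ hy
  · exact h.2

lemma cmp_step {Q : Set X} {y a b} (ha : a ∈ cmp R Q y) (h : R a b) (hb : b ∈ Q) : b ∈ cmp R Q y :=
  Relation.ReflTransGen.tail ha ⟨h, hb⟩

lemma cn_of_root (hs : ∀ a b, R a b → R b a) {C : Set X} {y : X} (hy : y ∈ C)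
    (h : ∀ z ∈ C, Relation.ReflTransGen (fun a b => R a b ∧ b ∈ C) y z) : Cn R C := by
  have key : ∀ z, Relation.ReflTransGen (fun a b => R a b ∧ b ∈ C) y z → z ∈ C ∧ Relation.ReflTransGen (fun a b => R a b ∧ b ∈ C) z y := by
    intro z hz
    induction hz with
    | refl => exact ⟨hy, Relation.ReflTransGen.refl⟩
    | tail h1 h2 ih => exact ⟨h2.2, Relation.ReflTransGen.head ⟨hs _ _ h2.1, ih.1⟩ ih.2⟩
  intro x hx z hz
  exact (key x (h x hx)).2.trans (h z hz)

lemma cmp_cn (hs : ∀ a b, R a b → R b a) {Q : Set X} {y} : Cn R (cmp R Q y) := by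
  refine cn_of_root hs cmp_self fun z hz => ?_
  have : ∀ z, Relation.ReflTransGen (fun a b => R a b ∧ b ∈ Q) y z →
      Relation.ReflTransGen (fun a b => R a b ∧ b ∈ cmp R Q y) y z := by
    intro z hz
    induction hz with
    | refl => exact Relation.ReflTransGen.refl
    | tail h1 h2 ih => exact ih.tail ⟨h2.1, cmp_step h1 h2.1 h2.2⟩
  exact this z hz

lemma cn_mono_path {Q Q' : Set X} (h : Q ⊆ Q') {x y} (hp : Relation.ReflTransGen (fun a b => R a b ∧ b ∈ Q) x y) :
    Relation.ReflTransGen (fun a b => R a b ∧ b ∈ Q') x y :=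
  Relation.ReflTransGen.mono (r := fun a b => R a b ∧ b ∈ Q) (fun _ _ hab => ⟨hab.1, h hab.2⟩) _ _ hp

lemma Cn.union (hs : ∀ a b, R a b → R b a) {Q Q' : Set X} (h : Cn R Q) (h' : Cn R Q') {a b} (ha : a ∈ Q) (hb : b ∈ Q')
    (hab : R a b) : Cn R (Q ∪ Q') := by
  refine cn_of_root hs (Or.inl ha) ?_
  rintro z (hz | hz)
  · exact cn_mono_path subset_union_left (h a ha z hz)
  · exact Relation.ReflTransGen.head ⟨hab, Or.inr hb⟩ (cn_mono_path subset_union_right (h' b hb z hz))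

lemma Cn.singleton (a : X) : Cn R {a} := by
  rintro _ rfl _ rfl; exact Relation.ReflTransGen.refl

end cn

section cut
variable {V : Type*} {G : SimpleGraph V}

lemma reach_closed {W : Type*} {H : SimpleGraph W} {P : W → Prop} (hP : ∀ x y, H.Adj x y → P x → P y) {a b}
    (h : H.Reachable a b) (ha : P a) : P b := by
  obtain ⟨w⟩ := h
  induction w with
  | nil => exact ha
  | cons h' _ ih => exact ih (hP _ _ h' ha)

lemma cut (h3 : G.IsTriconnected) {Q : Set V} {q x y z : V} (hq : q ∈ Q) (hx : x ∉ Q) (hy : y ∉ Q) (hz : z ∉ Q)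
    (hzx : z ≠ x) (hzy : z ≠ y) (h : ∀ s ∈ Q, ∀ t, G.Adj s t → t ∈ Q ∨ t = x ∨ t = y) : False := by
  have hc := (h3.2.2 x y).preconnected ⟨q, fun h => hx (h ▸ hq), fun h => hy (h ▸ hq)⟩ ⟨z, hzx, hzy⟩
  refine hz (reach_closed (H := G.induce {w : V | w ≠ x ∧ w ≠ y}) (P := fun v => (v : V) ∈ Q) ?_ hc hq)
  rintro ⟨s, hs⟩ ⟨t, ht⟩ hst hsQ
  rcases h s hsQ t hst with h | h | h
  · exact h
  · exact absurd h ht.1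
  · exact absurd h ht.2

end cut

lemma Tri.opp {T} (h : Tri T) {s : Fin 3} {P : ℂ} (hP : bt T s P < 0) :
    dt (T (s + 1)) (T (s + 2)) (T s) * dt (T (s + 1)) (T (s + 2)) P < 0 := by
  obtain ⟨f1, f2, f3⟩ := f3o s
  have e1 := bt_T_eq T s
  have e2 : dt (T (s + 1)) (T (s + 2)) (T s) ≠ 0 :=
    dt_ne (h.unit _) (h.unit _) (h.unit _) (h.inj.ne f3) (h.inj.ne f1) (h.inj.ne f2)
  have e3 := h.D_ne
  simp only [bt] at e1 hP
  set x := dt (T (s + 1)) (T (s + 2)) (T s)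
  set y := dt (T (s + 1)) (T (s + 2)) P
  set z := dt (T 0) (T 1) (T 2)
  have e4 : 0 < x * z := lt_of_le_of_ne e1 (Ne.symm (mul_ne_zero e2 e3))
  have e5 : x * z * (y * z) < 0 := mul_neg_of_pos_of_neg e4 hP
  by_contra hc
  push Not at hc
  nlinarith [mul_nonneg hc (sq_nonneg z)]

section sep
variable {V : Type*} {G : SimpleGraph V}

lemma cE_bdd (S : Set (ℝ × ℝ)) : Bornology.IsBounded (cE '' S) ↔ Bornology.IsBounded S := by
  constructor
  · intro h
    have := cE.symm.lipschitz.isBounded_image h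
    rwa [← image_comp, show (cE.symm : ℂ → ℝ × ℝ) ∘ cE = id from funext fun x => cE.symm_apply_apply x, image_id] at this
  · exact cE.lipschitz.isBounded_image

lemma cE_comp (S : Set (ℝ × ℝ)) {p : ℝ × ℝ} (hp : p ∉ S) :
    cE '' connectedComponentIn Sᶜ p = connectedComponentIn (cE '' S)ᶜ (cE p) := by
  have := cE.toHomeomorph.image_connectedComponentIn (s := Sᶜ) (x := p) hp
  rw [← image_compl_eq cE.bijective]
  exact this

/-- two components of the complement of the triangle are not on the same side -/
lemma two_sides [Finite V] {A : G.edgeSet → Set ℂ} {pos : V → ℂ} (hs : Sys pos (fun i : G.edgeSet => (i : Sym2 V)) A)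
    {a b c : V} (hab : G.Adj a b) (hbc : G.Adj b c) (hac : G.Adj a c) {C1 C2 : Set V} (c1 : Cn G.Adj C1) (c2 : Cn G.Adj C2)
    (hd : Disjoint C1 C2) (hT1 : ∀ x ∈ C1, x ≠ a ∧ x ≠ b ∧ x ≠ c) (hT2 : ∀ x ∈ C2, x ≠ a ∧ x ≠ b ∧ x ≠ c)
    {a1 b1 d1 a2 b2 d2 y1 y2 : V} (ha1 : a1 ∈ C1) (hb1 : b1 ∈ C1) (hd1 : d1 ∈ C1) (ha2 : a2 ∈ C2) (hb2 : b2 ∈ C2) (hd2 : d2 ∈ C2)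
    (a1' : G.Adj a a1) (b1' : G.Adj b b1) (d1' : G.Adj c d1) (a2' : G.Adj a a2) (b2' : G.Adj b b2) (d2' : G.Adj c d2)
    (hy1 : y1 ∈ C1) (hy2 : y2 ∈ C2)
    (hL : Lk (A ⟨s(a, b), hab⟩ ∪ A ⟨s(b, c), hbc⟩ ∪ A ⟨s(a, c), hac⟩) (pos y1) (pos y2)) : False := by
  set X := A ⟨s(a, b), hab⟩ ∪ A ⟨s(b, c), hbc⟩ ∪ A ⟨s(a, c), hac⟩ with hX
  have hXc : IsCompact X := ((hs.compact _).union (hs.compact _)).union (hs.compact _)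
  have hU : IsOpen (connectedComponentIn Xᶜ (pos y1)) := hXc.isClosed.isOpen_compl.connectedComponentIn
  have hy2U := hL.mem_comp
  have hy1X : pos y1 ∉ X := by
    obtain ⟨C, _, h2, h3, _⟩ := hL; exact h2 h3
  have hy1U : pos y1 ∈ connectedComponentIn Xᶜ (pos y1) := mem_connectedComponentIn hy1X
  have hUc : IsConnected (connectedComponentIn Xᶜ (pos y1)) := ⟨⟨_, hy1U⟩, isPreconnected_connectedComponentIn⟩
  obtain ⟨γ, hγ⟩ := (hU.isConnected_iff_isPathConnected.1 hUc).joinedIn _ hy1U _ hy2U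
  set Γ := range γ with hΓ
  have hΓc : IsCompact Γ := isCompact_range γ.continuous
  have hΓp : IsPreconnected Γ := isPreconnected_range γ.continuous
  have hΓX : Disjoint Γ X := by
    rw [Set.disjoint_left]
    rintro _ ⟨t, rfl⟩ h
    exact connectedComponentIn_subset _ _ (hγ t) h
  have m1 : pos y1 ∈ Γ := ⟨0, γ.source⟩
  have m2 : pos y2 ∈ Γ := ⟨1, γ.target⟩
  have hdist : ∀ x, pos x ∈ X → ∃ ε > 0, ∀ r, r < ε → Disjoint Γ (closedBall (pos x) r) := by
    intro x hx
    obtain ⟨ε, hε, hb⟩ := Metric.isOpen_iff.1 hΓc.isClosed.isOpen_compl (pos x) (fun h => Set.disjoint_left.1 hΓX h hx)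
    refine ⟨ε, hε, fun r hr => ?_⟩
    rw [Set.disjoint_right]
    intro z hz; exact hb (closedBall_subset_ball hr hz)
  have aX : pos a ∈ X := Or.inl (Or.inl (hs.mem (i := ⟨s(a, b), hab⟩) (by simp)))
  have bX : pos b ∈ X := Or.inl (Or.inl (hs.mem (i := ⟨s(a, b), hab⟩) (by simp)))
  have cX : pos c ∈ X := Or.inr (hs.mem (i := ⟨s(a, c), hac⟩) (by simp))
  obtain ⟨ra, ra0, hra⟩ := hdist a aX
  obtain ⟨rb, rb0, hrb⟩ := hdist b bX
  obtain ⟨rc, rc0, hrc⟩ := hdist c cX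
  obtain ⟨r0, hr0, hst⟩ := hs.straighten
  have hm0 : 0 < min (min ra rb) (min rc r0) := by positivity
  set r := min (min ra rb) (min rc r0) / 2 with hr
  have l1 : r < ra := by have := (min_le_left (min ra rb) (min rc r0)).trans (min_le_left _ _); linarith
  have l2 : r < rb := by have := (min_le_left (min ra rb) (min rc r0)).trans (min_le_right _ _); linarith
  have l3 : r < rc := by have := (min_le_right (min ra rb) (min rc r0)).trans (min_le_left _ _); linarith
  have l4 : r < r0 := by have := (min_le_right (min ra rb) (min rc r0)).trans (min_le_right _ _); linarith
  obtain ⟨A', D, hs', hR, hA'⟩ := hst r (by positivity) l4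
  have ga := hra r l1
  have gb := hrb r l2
  have gc := hrc r l3
  have gA : ∀ (x y : V) (h : G.Adj x y), (A ⟨s(x, y), h⟩ ⊆ X) → Disjoint Γ (closedBall (pos x) r) →
      Disjoint Γ (closedBall (pos y) r) → Disjoint Γ (A' ⟨s(x, y), h⟩) := by
    intro x y h hsub h1 h2
    rw [Set.disjoint_left]
    intro z hz hz'
    rcases hA' _ hz' with h' | h'
    · exact Set.disjoint_left.1 hΓX hz (hsub h')
    · simp only [mem_iUnion] at h'
      obtain ⟨w, hw, hwz⟩ := h'
      simp only [Sym2.mem_iff] at hw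
      rcases hw with rfl | rfl
      · exact Set.disjoint_left.1 h1 hz hwz
      · exact Set.disjoint_left.1 h2 hz hwz
  have gab : Disjoint Γ (A' ⟨s(a, b), hab⟩) := gA a b hab (fun z hz => Or.inl (Or.inl hz)) ga gb
  have gbc : Disjoint Γ (A' ⟨s(b, c), hbc⟩) := gA b c hbc (fun z hz => Or.inl (Or.inr hz)) gb gc
  have gac : Disjoint Γ (A' ⟨s(a, c), hac⟩) := gA a c hac (fun z hz => Or.inr hz) ga gc
  -- spokes
  have hsym : ∀ x y, G.Adj x y → G.Adj y x := fun _ _ h => h.symm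
  have hab' := hab.ne; have hbc' := hbc.ne; have hac' := hac.ne
  let ia : G.edgeSet := ⟨s(a, b), hab⟩
  let ic : G.edgeSet := ⟨s(b, c), hbc⟩
  let i1 : G.edgeSet := ⟨s(b, b1), b1'⟩
  let i2 : G.edgeSet := ⟨s(b, b2), b2'⟩
  have eia : (ia : Sym2 V) = s(b, a) := Sym2.eq_swap
  have eic : (ic : Sym2 V) = s(b, c) := rfl
  have ei1 : (i1 : Sym2 V) = s(b, b1) := rfl
  have ei2 : (i2 : Sym2 V) = s(b, b2) := rfl
  have ne_of : ∀ {i j : G.edgeSet} {x y : V}, (i : Sym2 V) = s(b, x) → (j : Sym2 V) = s(b, y) → x ≠ y → D b i ≠ D b j := by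
    intro i j x y hi hj hxy
    refine (hR b).dir_ne hs' (fun h => hxy ?_) (by rw [hi]; simp) (by rw [hj]; simp)
    rw [h, hj] at hi
    have := hi.symm
    simp only [Sym2.eq_iff, true_and] at this
    rcases this with h | ⟨h1, h2⟩
    · exact h
    · exact h2.trans h1
  have un : ∀ {i : G.edgeSet} {x : V}, (i : Sym2 V) = s(b, x) → ‖D b i‖ = 1 := fun {i x} hi =>
    (hR b).unit _ (by rw [hi]; simp)
  have b12 : b1 ≠ b2 := fun h => Set.disjoint_left.1 hd hb1 (h ▸ hb2)
  obtain ⟨na1, -, nc1⟩ := hT1 b1 hb1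
  obtain ⟨na2, -, nc2⟩ := hT2 b2 hb2
  have hT : Tri ![D b ia, D b ic, D b i1] := by
    constructor
    · intro i j hij
      fin_cases i <;> fin_cases j <;> first | rfl | exfalso
      · exact ne_of eia eic hac' hij
      · exact ne_of eia ei1 na1.symm hij
      · exact ne_of eic eia hac'.symm hij
      · exact ne_of eic ei1 nc1.symm hij
      · exact ne_of ei1 eia na1 hij
      · exact ne_of ei1 eic nc1 hij
    · intro i; fin_cases i
      · exact un eia
      · exact un eic
      · exact un ei1
  have hRA : ∀ x y, G.Adj x y → ∃ i : G.edgeSet, (i : Sym2 V) = s(x, y) := fun x y h => ⟨⟨s(x, y), h⟩, rfl⟩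
  have bC1 : b ∉ C1 := fun h => (hT1 b h).2.1 rfl
  have bC2 : b ∉ C2 := fun h => (hT2 b h).2.1 rfl
  have aC1 : a ∉ C1 := fun h => (hT1 a h).1 rfl
  have aC2 : a ∉ C2 := fun h => (hT2 a h).1 rfl
  have cC1 : c ∉ C1 := fun h => (hT1 c h).2.2 rfl
  have cC2 : c ∉ C2 := fun h => (hT2 c h).2.2 rfl
  obtain ⟨s, hsP⟩ := hT.sector (p := D b i2) (un ei2) (by
    intro i; fin_cases i
    · exact ne_of ei2 eia na2
    · exact ne_of ei2 eic nc2
    · exact ne_of ei2 ei1 b12.symm)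
  have hopp := hT.opp hsP
  have hdis : ∀ {Q Q' : Set V} {x y : V}, Disjoint Q Q' → x ∉ Q' → y ∉ Q → x ≠ y → Disjoint ({x} ∪ Q) ({y} ∪ Q') := by
    intro Q Q' x y h1 h2 h3 h4
    rw [Set.disjoint_left] at h1 ⊢
    rintro z (rfl | hz) (hz' | hz')
    · exact h4 hz'
    · exact h2 hz'
    · exact h3 (hz' ▸ hz)
    · exact h1 hz hz'
  fin_cases s
  · have := (hR b).alt2 hs' hRA (Q := {c} ∪ C1) (Q' := {a} ∪ C2) ((Cn.singleton c).union hsym c1 rfl hd1 d1')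
      ((Cn.singleton a).union hsym c2 rfl ha2 a2') (hdis hd cC2 aC1 hac'.symm) eic eia ei1 ei2
      (by simp [hbc', bC1]) (by simp [hab'.symm, bC2]) (by simp) (by simp [hb1]) (by simp) (by simp [hb2])
    exact absurd hopp (not_lt.2 this)
  · have := (hR b).alt2 hs' hRA (Q := {a} ∪ C1) (Q' := {c} ∪ C2) ((Cn.singleton a).union hsym c1 rfl ha1 a1')
      ((Cn.singleton c).union hsym c2 rfl hd2 d2') (hdis hd aC2 cC1 hac') ei1 eic eia ei2
      (by simp [hab'.symm, bC1]) (by simp [hbc', bC2]) (by simp [hb1]) (by simp) (by simp) (by simp [hb2])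
    exact absurd hopp (not_lt.2 this)
  · have dQ : ∀ {C : Set V}, a ∉ C → c ∉ C → Disjoint C {a, c} := by
      intro C h1 h2
      rw [Set.disjoint_right]; rintro z (rfl | rfl) <;> assumption
    have p1 := hs'.Dr_preconn hRA c1
    have p2 := hs'.Dr_preconn hRA c2
    have dm : ∀ {C : Set V} {x}, x ∈ C → pos x ∈ Dr pos (fun i : G.edgeSet => (i : Sym2 V)) A' C := fun {C x} h =>
      Or.inl ⟨x, h, rfl⟩
    have := (hR b).alt hs' hRA (Q := {a, c}) (by
        have := (Cn.singleton (R := G.Adj) a).union hsym (Cn.singleton c) rfl rfl hac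
        rwa [singleton_union] at this) eia ei1 eic ei2
      (by simp [hab'.symm, hbc']) (by simp) (by simp) (by simp [na1, nc1]) (by simp [na2, nc2])
      (Z := Dr pos (fun i : G.edgeSet => (i : Sym2 V)) A' C1 ∪ (Γ ∪ Dr pos (fun i : G.edgeSet => (i : Sym2 V)) A' C2))
      (p1.union (pos y1) (dm hy1) (Or.inl m1) (hΓp.union (pos y2) m2 (dm hy2) p2)) (Or.inl (dm hb1)) (Or.inr (Or.inr (dm hb2)))
      (by
        simp only [disjoint_union_left]
        exact ⟨(hR b).Dr_ball bC1, gb, (hR b).Dr_ball bC2⟩)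
      (by
        simp only [disjoint_union_left]
        refine ⟨hs'.Dr_disj (dQ aC1 cC1), ?_, hs'.Dr_disj (dQ aC2 cC2)⟩
        rw [Set.disjoint_left]
        rintro z hz (⟨x, hx, rfl⟩ | hz')
        · rcases hx with rfl | rfl
          · exact Set.disjoint_left.1 hΓX hz aX
          · exact Set.disjoint_left.1 hΓX hz cX
        · simp only [mem_iUnion] at hz'
          obtain ⟨i, hi, hzi⟩ := hz'
          have : i = ⟨s(a, c), hac⟩ := by
            obtain ⟨i, hi'⟩ := i
            induction i with | _ x y
            have hx := hi x (by simp)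
            have hy := hi y (by simp)
            have hxy : x ≠ y := G.ne_of_adj hi'
            simp only [mem_insert_iff, mem_singleton_iff] at hx hy
            rcases hx with rfl | rfl <;> rcases hy with rfl | rfl
            · exact absurd rfl hxy
            · rfl
            · exact Subtype.ext Sym2.eq_swap
            · exact absurd rfl hxy
          subst this
          exact Set.disjoint_left.1 gac hz hzi)
      (by
        simp only [disjoint_union_left]
        exact ⟨hs'.Dr_arc eia bC1 aC1, gab, hs'.Dr_arc eia bC2 aC2⟩)
      (by
        simp only [disjoint_union_left]
        exact ⟨hs'.Dr_arc eic bC1 cC1, gbc, hs'.Dr_arc eic bC2 cC2⟩)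
    exact absurd hopp (not_lt.2 this)

end sep
end TG

namespace TG
open Set Complex Filter Topology Metric
open scoped ComplexConjugate

section struct
variable {V : Type*} {G : SimpleGraph V}

lemma deg5 [Finite V] {p x1 x2 x3 x4 x5 : V} (hd : (G.neighborSet p).ncard ≤ 4) (h1 : G.Adj p x1) (h2 : G.Adj p x2)
    (h3 : G.Adj p x3) (h4 : G.Adj p x4) (h5 : G.Adj p x5) (n : [x1, x2, x3, x4, x5].Nodup) : False := by
  classical
  have h6 : (([x1, x2, x3, x4, x5].toFinset : Finset V) : Set V) ⊆ G.neighborSet p := by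
    intro y hy
    simp only [List.coe_toFinset, List.mem_cons, List.not_mem_nil, or_false, mem_ofPred_eq] at hy
    rcases hy with rfl | rfl | rfl | rfl | rfl <;> assumption
  have h7 := Set.ncard_le_ncard h6 (Set.toFinite _)
  rw [Set.ncard_coe_finset, List.toFinset_card_of_nodup n] at h7
  simp at h7
  omega

structure Struct (G : SimpleGraph V) (O : Set V) (t : Fin 3 → V) (n : Fin 3 → V) : Prop where
  mem : ∀ j, n j ∈ O
  adj : ∀ j, ∀ x ∈ O, G.Adj x (t j) ↔ x = n j
  tO : ∀ j, t j ∉ O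
  closed : ∀ q ∈ O, ∀ s, G.Adj q s → s ∈ O ∨ ∃ j, s = t j
  z : ∃ z, z ∉ O ∧ ∀ j, z ≠ t j

lemma cmp_nb (h3 : G.IsTriconnected) {a b c y : V} (hb : a ≠ b) (hc : a ≠ c) {C : Set V} (hy : y ∈ C)
    (ha : a ∉ C) (hbC : b ∉ C) (hcC : c ∉ C)
    (hcl : ∀ s ∈ C, ∀ t, G.Adj s t → t ∈ C ∨ t = a ∨ t = b ∨ t = c) : ∃ x ∈ C, G.Adj a x := by
  by_contra hcon
  push Not at hcon
  refine cut h3 hy hbC hcC ha hb hc fun s hs t hst => ?_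
  rcases hcl s hs t hst with h | rfl | h
  · exact Or.inl h
  · exact absurd hst.symm (hcon s hs)
  · exact Or.inr h

lemma exists_struct {V : Type u} {G : SimpleGraph V} (h3 : G.IsTriconnected) (hdeg : G.MaxDegreeLE 4) (E : PlaneEmbedding G) {a b c : V} (hT : G.IsSepTriangle a b c)
    (hne : (outsideTriangle E hT.1 hT.2.1 hT.2.2.1).Nonempty) :
    ∃ n, Struct G (outsideTriangle E hT.1 hT.2.1 hT.2.2.1) ![a, b, c] n := by
  have : Finite V := Nat.finite_of_card_ne_zero (by have := h3.1; omega)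
  obtain ⟨hab, hbc, hac, hsep⟩ := hT
  change (outsideTriangle E hab hbc hac).Nonempty at hne
  change ∃ n, Struct G (outsideTriangle E hab hbc hac) ![a, b, c] n
  have hab' := hab.ne; have hbc' := hbc.ne; have hac' := hac.ne
  set O := outsideTriangle E hab hbc hac with hO
  obtain ⟨A, hs, hA⟩ := Sys.of_embedding E
  set X := A ⟨s(a, b), hab⟩ ∪ A ⟨s(b, c), hbc⟩ ∪ A ⟨s(a, c), hac⟩ with hX
  have hXe : cE '' triangleDrawing E hab hbc hac = X := by
    simp only [triangleDrawing, image_union, hX, hA]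
  have hXc : IsCompact X := ((hs.compact _).union (hs.compact _)).union (hs.compact _)
  have hXv : ∀ v, cE (E.pos v) ∈ X → v = a ∨ v = b ∨ v = c := by
    rintro v ((h | h) | h) <;> have := hs.on _ _ h <;> simp at this <;> tauto
  have hOm : ∀ v, v ∈ O ↔ (v ≠ a ∧ v ≠ b ∧ v ≠ c) ∧ ¬ Bornology.IsBounded (connectedComponentIn Xᶜ (cE (E.pos v))) := by
    intro v
    constructor
    · rintro ⟨h1, h2, h3, h4⟩
      refine ⟨⟨h1, h2, h3⟩, ?_⟩
      rw [← hXe, ← cE_comp, cE_bdd]; · exact h4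
      intro h
      have := hXv v (hXe ▸ mem_image_of_mem _ h)
      tauto
    · rintro ⟨⟨h1, h2, h3⟩, h4⟩
      refine ⟨h1, h2, h3, ?_⟩
      rwa [← hXe, ← cE_comp, cE_bdd] at h4
      intro h
      have := hXv v (hXe ▸ mem_image_of_mem _ h)
      tauto
  have hnX : ∀ v, (v ≠ a ∧ v ≠ b ∧ v ≠ c) → cE (E.pos v) ∉ X := fun v h h' => by
    have := hXv v h'; tauto
  have oadj : ∀ q ∈ O, ∀ t, G.Adj q t → (t ≠ a ∧ t ≠ b ∧ t ≠ c) → t ∈ O := by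
    intro q hq t hqt ht
    have hq' := (hOm q).1 hq
    refine (hOm t).2 ⟨ht, ?_⟩
    have hL : Lk X (cE (E.pos q)) (cE (E.pos t)) := by
      refine ⟨A ⟨s(q, t), hqt⟩, hs.preconn _, ?_, hs.mem (by simp), hs.mem (by simp)⟩
      intro z hz hzX
      have key : ∀ (x y : V) (h : G.Adj x y), (q ≠ x ∧ q ≠ y ∧ t ≠ x ∧ t ≠ y) → z ∈ A ⟨s(x, y), h⟩ → False := by
        intro x y h ⟨h1, h2, h3, h4⟩ hz'
        have hne : (⟨s(q, t), hqt⟩ : G.edgeSet) ≠ ⟨s(x, y), h⟩ := by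
          intro h'; have h' := congrArg Subtype.val h'; simp only [Sym2.eq_iff] at h'; tauto
        obtain ⟨v, rfl⟩ := hs.inter _ _ hne ⟨hz, hz'⟩
        have e1 := hs.on _ _ hz
        have e2 := hs.on _ _ hz'
        simp only [Sym2.mem_iff] at e1 e2
        rcases e1 with rfl | rfl <;> tauto
      rcases hzX with (h | h) | h
      · exact key a b hab (by tauto) h
      · exact key b c hbc (by tauto) h
      · exact key a c hac (by tauto) h
    rw [← connectedComponentIn_eq hL.mem_comp]
    exact hq'.2
  set Tc : Set V := {v | v ≠ a ∧ v ≠ b ∧ v ≠ c} with hTc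
  have hsym : ∀ x y, G.Adj x y → G.Adj y x := fun _ _ h => h.symm
  have ccl : ∀ y, ∀ s ∈ cmp G.Adj Tc y, ∀ t, G.Adj s t → t ∈ cmp G.Adj Tc y ∨ t = a ∨ t = b ∨ t = c := by
    intro y s hs t hst
    by_cases h : t ∈ Tc
    · exact Or.inl (cmp_step hs hst h)
    · right; simp only [hTc, mem_ofPred_eq] at h; tauto
  have nb : ∀ y ∈ Tc, (∃ x ∈ cmp G.Adj Tc y, G.Adj a x) ∧ (∃ x ∈ cmp G.Adj Tc y, G.Adj b x) ∧ ∃ x ∈ cmp G.Adj Tc y, G.Adj c x := by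
    intro y hy
    have na : a ∉ cmp G.Adj Tc y := fun h => (cmp_sub hy h).1 rfl
    have nb : b ∉ cmp G.Adj Tc y := fun h => (cmp_sub hy h).2.1 rfl
    have nc : c ∉ cmp G.Adj Tc y := fun h => (cmp_sub hy h).2.2 rfl
    refine ⟨cmp_nb h3 hab' hac' cmp_self na nb nc (ccl y), cmp_nb h3 hab'.symm hbc' cmp_self nb na nc ?_,
      cmp_nb h3 hac'.symm hbc'.symm cmp_self nc na nb ?_⟩
    · intro s hs t hst; have := ccl y s hs t hst; tauto
    · intro s hs t hst; have := ccl y s hs t hst; tauto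
  have cdis : ∀ y y', y' ∉ cmp G.Adj Tc y → y ∈ Tc → y' ∈ Tc → Disjoint (cmp G.Adj Tc y) (cmp G.Adj Tc y') := by
    intro y y' h hy hy'
    rw [Set.disjoint_left]
    intro x hx hx'
    have := cmp_cn hsym x hx' y' cmp_self
    exact h (Relation.ReflTransGen.trans hx (cn_mono_path (cmp_sub hy') this))
  obtain ⟨y1, hy1⟩ := hne
  have hy1T := ((hOm y1).1 hy1).1
  have C1O : cmp G.Adj Tc y1 ⊆ O := by
    intro z hz
    change Relation.ReflTransGen _ _ _ at hz
    induction hz with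
    | refl => exact hy1
    | tail h1 h2 ih => exact oadj _ ih _ h2.1 h2.2
  have OC1 : O ⊆ cmp G.Adj Tc y1 := by
    intro y2 hy2
    by_contra hc
    have hy2T := ((hOm y2).1 hy2).1
    obtain ⟨⟨x1, x1', x1''⟩, ⟨x2, x2', x2''⟩, ⟨x3, x3', x3''⟩⟩ := nb y1 hy1T
    obtain ⟨⟨z1, z1', z1''⟩, ⟨z2, z2', z2''⟩, ⟨z3, z3', z3''⟩⟩ := nb y2 hy2T
    exact two_sides hs hab hbc hac (cmp_cn hsym) (cmp_cn hsym) (cdis y1 y2 hc hy1T hy2T) (fun x hx => (cmp_sub (Q := Tc) hy1T hx : x ∈ Tc))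
      (fun x hx => (cmp_sub (Q := Tc) hy2T hx : x ∈ Tc)) x1' x2' x3' z1' z2' z3' x1'' x2'' x3'' z1'' z2'' z3'' cmp_self cmp_self
      (unbdd_Lk hXc (hnX _ hy1T) (hnX _ hy2T) ((hOm y1).1 hy1).2 ((hOm y2).1 hy2).2)
  have hz : ∃ z ∈ Tc, z ∉ O := by
    by_contra hc
    push Not at hc
    apply hsep
    have : Nonempty ↥{v | v ≠ a ∧ v ≠ b ∧ v ≠ c} := ⟨⟨y1, hy1T⟩⟩
    have key : ∀ (z : V), Relation.ReflTransGen (fun a b => G.Adj a b ∧ b ∈ Tc) y1 z → ∀ hz : z ∈ Tc,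
        (G.induce {v | v ≠ a ∧ v ≠ b ∧ v ≠ c}).Reachable ⟨y1, hy1T⟩ ⟨z, hz⟩ := by
      intro z h
      induction h with
      | refl => exact fun _ => SimpleGraph.Reachable.refl _
      | @tail x y h1 h2 ih =>
        intro hz
        have hx : x ∈ Tc := cmp_sub (R := G.Adj) hy1T h1
        exact (ih hx).trans (SimpleGraph.Adj.reachable (show G.Adj x y from h2.1))
    refine SimpleGraph.Connected.mk fun x y => ?_
    exact (key x (OC1 (hc x x.2)) x.2).symm.trans (key y (OC1 (hc y y.2)) y.2)
  obtain ⟨z, hzT, hzO⟩ := hz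
  have hdz := cdis y1 z (fun h => hzO (C1O h)) hy1T hzT
  obtain ⟨⟨x1, x1', x1''⟩, ⟨x2, x2', x2''⟩, ⟨x3, x3', x3''⟩⟩ := nb y1 hy1T
  obtain ⟨⟨z1, z1', z1''⟩, ⟨z2, z2', z2''⟩, ⟨z3, z3', z3''⟩⟩ := nb z hzT
  have uniq : ∀ p q r x x' w : V, G.Adj p q → G.Adj p r → q ≠ r → (q = a ∨ q = b ∨ q = c) → (r = a ∨ r = b ∨ r = c) →
      x ∈ O → x' ∈ O → G.Adj p x → G.Adj p x' → w ∈ cmp G.Adj Tc z → G.Adj p w → x = x' := by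
    intro p q r x x' w h1 h2 h3 h4 h5 h6 h7 h8 h9 h10 h11
    by_contra hne
    have hx := ((hOm x).1 h6).1
    have hx' := ((hOm x').1 h7).1
    have hw : w ∈ Tc := cmp_sub hzT h10
    have hxw : x ≠ w := fun h => Set.disjoint_left.1 hdz (OC1 h6) (h ▸ h10)
    have hxw' : x' ≠ w := fun h => Set.disjoint_left.1 hdz (OC1 h7) (h ▸ h10)
    have tt : ∀ u v : V, (u = a ∨ u = b ∨ u = c) → (v ≠ a ∧ v ≠ b ∧ v ≠ c) → u ≠ v := by
      rintro u v hu hv rfl; tauto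
    refine deg5 (hdeg p) h1 h2 h8 h9 h11 ?_
    simp only [List.nodup_cons, List.mem_cons, List.not_mem_nil, or_false, not_or, not_false_eq_true, List.nodup_nil, and_true]
    exact ⟨⟨h3, tt _ _ h4 hx, tt _ _ h4 hx', tt _ _ h4 hw⟩, ⟨tt _ _ h5 hx, tt _ _ h5 hx', tt _ _ h5 hw⟩, ⟨hne, hxw⟩, hxw'⟩
  refine ⟨![x1, x2, x3], ?_, ?_, ?_, ?_, z, hzO, ?_⟩
  · intro j; fin_cases j
    exacts [C1O x1', C1O x2', C1O x3']
  · intro j x hx; fin_cases j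
    · exact ⟨fun h => uniq a b c x x1 z1 hab hac hbc' (by simp) (by simp) hx (C1O x1') h.symm x1'' z1' z1'', fun h => h ▸ x1''.symm⟩
    · exact ⟨fun h => uniq b a c x x2 z2 hab.symm hbc hac' (by simp) (by simp) hx (C1O x2') h.symm x2'' z2' z2'', fun h => h ▸ x2''.symm⟩
    · exact ⟨fun h => uniq c a b x x3 z3 hac.symm hbc.symm hab' (by simp) (by simp) hx (C1O x3') h.symm x3'' z3' z3'', fun h => h ▸ x3''.symm⟩
  · intro j hj; have := ((hOm _).1 hj).1; fin_cases j <;> simp at this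
  · intro q hq s hqs
    by_cases h : s ∈ Tc
    · exact Or.inl (oadj q hq s hqs h)
    · right; simp only [hTc, mem_ofPred_eq] at h
      have : s = a ∨ s = b ∨ s = c := by tauto
      rcases this with h | h | h
      exacts [⟨0, h⟩, ⟨1, h⟩, ⟨2, h⟩]
  · intro j; fin_cases j
    exacts [hzT.1, hzT.2.1, hzT.2.2]

end struct
end TG

namespace TG
open Set Complex Filter Topology Metric
open scoped ComplexConjugate

section whit
variable {X : Type*} {R : X → X → Prop}

structure Pth (R : X → X → Prop) (Q : Set X) (a b : X) (L : ℕ) (p : ℕ → X) : Prop where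
  z : p 0 = a
  e : p L = b
  mem : ∀ i ≤ L, p i ∈ Q
  adj : ∀ i < L, R (p i) (p (i + 1))

lemma exists_pth {Q : Set X} {a b : X} (ha : a ∈ Q) (h : Relation.ReflTransGen (fun a b => R a b ∧ b ∈ Q) a b) :
    ∃ L p, Pth R Q a b L p := by
  induction h with
  | refl => exact ⟨0, fun _ => a, rfl, rfl, fun _ _ => ha, fun _ h => absurd h (by omega)⟩
  | @tail x y h1 h2 ih =>
    obtain ⟨L, p, hp⟩ := ih
    refine ⟨L + 1, fun i => if i ≤ L then p i else y, by simp [hp.z], by simp, ?_, ?_⟩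
    · intro i hi
      by_cases h : i ≤ L
      · simp [h, hp.mem i h]
      · simp [h, h2.2]
    · intro i hi
      by_cases h : i + 1 ≤ L
      · simpa [h, show i ≤ L by omega] using hp.adj i (by omega)
      · have : i = L := by omega
        subst this
        simpa [hp.e] using h2.1

lemma Pth.rt {Q : Set X} {a b : X} {L p} (h : Pth R Q a b L p) (Q' : Set X) {i j : ℕ} (hij : i ≤ j) (hj : j ≤ L)
    (hQ : ∀ k, i < k → k ≤ j → p k ∈ Q') : Relation.ReflTransGen (fun a b => R a b ∧ b ∈ Q') (p i) (p j) := by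
  induction j, hij using Nat.le_induction with
  | base => exact Relation.ReflTransGen.refl
  | succ j hij ih =>
    exact (ih (by omega) fun k h1 h2 => hQ k h1 (by omega)).tail ⟨h.adj j (by omega), hQ _ (by omega) le_rfl⟩

lemma Pth.short {Q : Set X} {a b : X} {L p} (h : Pth R Q a b L p) {i m : ℕ} (him : i < m) (hm : m ≤ L) (hadj : R (p i) (p m)) :
    ∃ p', Pth R Q a b (L - m + i + 1) p' := by
  refine ⟨fun k => if k ≤ i then p k else p (k + m - i - 1), by simp [h.z], ?_, ?_, ?_⟩
  · have : ¬ (L - m + i + 1 ≤ i) := by omega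
    simp only [this, if_false]
    rw [← h.e]; congr 1; omega
  · intro k hk
    by_cases h' : k ≤ i
    · simp [h', h.mem k (by omega)]
    · simp only [h', if_false]; exact h.mem _ (by omega)
  · intro k hk
    by_cases h1 : k + 1 ≤ i
    · simpa [h1, show k ≤ i by omega] using h.adj k (by omega)
    · by_cases h2 : k ≤ i
      · have : k = i := by omega
        subst this
        simpa [show k + 1 + m - k - 1 = m by omega] using hadj
      · simp only [h1, h2, if_false]
        have := h.adj (k + m - i - 1) (by omega)
        rwa [show k + m - i - 1 + 1 = k + 1 + m - i - 1 by omega] at this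

lemma exists_shortest {Q : Set X} {a b : X} (h : ∃ L p, Pth R Q a b L p) (hs : ∀ a b, R a b → R b a) :
    ∃ L p, Pth R Q a b L p ∧ (∀ i ≤ L, ∀ j ≤ L, p i = p j → i = j) ∧
      ∀ i ≤ L, ∀ j ≤ L, R (p i) (p j) → i = j ∨ i + 1 = j ∨ j + 1 = i := by
  classical
  obtain ⟨p, hp⟩ := Nat.find_spec h
  set L := Nat.find h with hL
  have hmin : ∀ L' < L, ∀ p', ¬ Pth R Q a b L' p' := fun L' hL' p' h' => Nat.find_min h hL' ⟨p', h'⟩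
  refine ⟨L, p, hp, ?_, ?_⟩
  · have : ∀ i j, j ≤ L → p i = p j → ¬ i < j := by
      intro i j hj hij hlt
      by_cases hjL : j = L
      · exact hmin i (by omega) p ⟨hp.z, by rw [hij, hjL, hp.e], fun k hk => hp.mem k (by omega), fun k hk => hp.adj k (by omega)⟩
      · obtain ⟨p', hp'⟩ := hp.short (i := i) (m := j + 1) (by omega) (by omega) (hij ▸ hp.adj j (by omega))
        exact hmin _ (by omega) p' hp'
    intro i hi j hj hij
    have h1 := this i j hj hij
    have h2 := this j i hi hij.symm
    omega
  · have : ∀ i j, j ≤ L → R (p i) (p j) → ¬ i + 1 < j := by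
      intro i j hj hij hlt
      obtain ⟨p', hp'⟩ := hp.short (i := i) (m := j) (by omega) (by omega) hij
      exact hmin _ (by omega) p' hp'
    intro i hi j hj hij
    have h1 := this i j hj hij
    have h2 := this j i hi (hs _ _ hij)
    omega

lemma whitney [Finite X] (hs : ∀ a b, R a b → R b a) {a b c : X} (hab : a ≠ b) (hac : a ≠ c) (hbc : b ≠ c)
    (s1 : ∀ Q : Set X, Q.Nonempty → a ∉ Q → b ∉ Q → c ∉ Q → ∀ x y, x ∉ Q → y ∉ Q → ∃ s ∈ Q, ∃ r, r ∉ Q ∧ R s r ∧ r ≠ x ∧ r ≠ y)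
    (s2 : ∀ Q : Set X, a ∈ Q → b ∉ Q → c ∉ Q → ∀ x, x ∉ Q → ∃ s ∈ Q, ∃ r, r ∉ Q ∧ R s r ∧ r ≠ x) :
    ∃ (K : Set X) (L : ℕ) (p : ℕ → X), Pth R Kᶜ a b L p ∧ (∀ i ≤ L, ∀ j ≤ L, p i = p j → i = j) ∧
      (∀ i ≤ L, ∀ j ≤ L, R (p i) (p j) → i = j ∨ i + 1 = j ∨ j + 1 = i) ∧ c ∈ K ∧ Cn R K ∧ ∀ x, x ∈ K ∨ ∃ i ≤ L, x = p i := by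
  classical
  set S : Set (Set X) := {K | c ∈ K ∧ Cn R K ∧ a ∉ K ∧ b ∉ K ∧ Relation.ReflTransGen (fun a b => R a b ∧ b ∈ Kᶜ) a b} with hS
  have hne : S.Nonempty := by
    refine ⟨{c}, rfl, Cn.singleton c, hac, hbc, ?_⟩
    change b ∈ cmp R {c}ᶜ a
    by_contra hb
    have hsub : cmp R {c}ᶜ a ⊆ {c}ᶜ := cmp_sub hac
    obtain ⟨s, hs', r, hr, hsr, hrc⟩ := s2 (cmp R {c}ᶜ a) cmp_self hb (fun h => hsub h rfl) c (fun h => hsub h rfl)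
    exact hr (cmp_step hs' hsr hrc)
  obtain ⟨K, hKS, hmax⟩ := Set.Finite.exists_maximal (Set.toFinite S) hne
  obtain ⟨hc, hcn, ha, hb, hrt⟩ := hKS
  have claim1 : ∀ z, z ∉ K → z ≠ a → z ≠ b → (∃ k ∈ K, R k z) → ¬ Relation.ReflTransGen (fun a b => R a b ∧ b ∈ (K ∪ {z})ᶜ) a b := by
    rintro z hz hza hzb ⟨k, hk, hkz⟩ hrt'
    have : K ∪ {z} ∈ S := ⟨Or.inl hc, hcn.union hs (Cn.singleton z) hk rfl hkz, by simp [ha, hza.symm], by simp [hb, hzb.symm], hrt'⟩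
    exact hz (hmax this subset_union_left (Or.inr rfl))
  obtain ⟨L, p, hp, hinj, hind⟩ := exists_shortest (exists_pth (show a ∈ Kᶜ from ha) hrt) hs
  refine ⟨K, L, p, hp, hinj, hind, hc, hcn, ?_⟩
  have hA : ∀ z, z ∉ K → z ≠ a → z ≠ b → (∃ k ∈ K, R k z) → ∃ i ≤ L, z = p i := by
    intro z hz hza hzb hk
    by_contra hcon
    push Not at hcon
    apply claim1 z hz hza hzb hk
    have := hp.rt (K ∪ {z})ᶜ (Nat.zero_le L) le_rfl (fun k _ hk' => by
      simp only [mem_compl_iff, mem_union, mem_singleton_iff, not_or]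
      exact ⟨hp.mem k hk', fun h => hcon k hk' h.symm⟩)
    rwa [hp.z, hp.e] at this
  set B : Set X := {z | z ∉ K ∧ z ≠ a ∧ z ≠ b ∧ ¬ ∃ k ∈ K, R k z} with hB
  suffices hBe : ∀ z, z ∉ B by
    intro x
    by_cases hx : x ∈ K
    · exact Or.inl hx
    right
    by_cases h1 : x = a
    · exact ⟨0, Nat.zero_le _, by rw [hp.z, h1]⟩
    by_cases h2 : x = b
    · exact ⟨L, le_rfl, by rw [hp.e, h2]⟩
    by_cases h3 : ∃ k ∈ K, R k x
    · exact hA x hx h1 h2 h3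
    · exact absurd ⟨hx, h1, h2, h3⟩ (hBe x)
  intro z hz
  set Q := cmp R B z with hQ
  have hQB : Q ⊆ B := cmp_sub hz
  have hQn : ∀ s ∈ Q, ∀ r, r ∉ Q → R s r → ∃ i ≤ L, r = p i := by
    intro s hsQ r hr hsr
    have hrK : r ∉ K := fun h => (hQB hsQ).2.2.2 ⟨r, h, hs _ _ hsr⟩
    by_cases h1 : r = a
    · exact ⟨0, Nat.zero_le _, by rw [hp.z, h1]⟩
    by_cases h2 : r = b
    · exact ⟨L, le_rfl, by rw [hp.e, h2]⟩
    by_cases h3 : ∃ k ∈ K, R k r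
    · exact hA r hrK h1 h2 h3
    · exact absurd (cmp_step hsQ hsr ⟨hrK, h1, h2, h3⟩) hr
  have t1 := s1 Q ⟨z, cmp_self⟩ (fun h => (hQB h).2.1 rfl) (fun h => (hQB h).2.2.1 rfl) (fun h => (hQB h).1 hc)
  set I : Set ℕ := {i | i ≤ L ∧ p i ∉ Q ∧ ∃ s ∈ Q, R s (p i)} with hI
  have hIf : I.Finite := (Set.finite_Iic L).subset fun i hi => hi.1
  have hIn : I.Nonempty := by
    obtain ⟨s, hsQ, r, hr, hsr, -⟩ := t1 c c (fun h => (hQB h).1 hc) (fun h => (hQB h).1 hc)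
    obtain ⟨i, hi, rfl⟩ := hQn s hsQ r hr hsr
    exact ⟨i, hi, hr, s, hsQ, hsr⟩
  obtain ⟨i, hiI, hi⟩ := Set.exists_min_image I id hIf hIn
  obtain ⟨k, hkI, hk⟩ := Set.exists_max_image I id hIf hIn
  obtain ⟨s, hsQ, r, hr, hsr, hri, hrk⟩ := t1 (p i) (p k) hiI.2.1 hkI.2.1
  obtain ⟨j, hjL, rfl⟩ := hQn s hsQ r hr hsr
  have hjI : j ∈ I := ⟨hjL, hr, s, hsQ, hsr⟩
  have hij : i < j := lt_of_le_of_ne (hi j hjI) (fun h => hri (by rw [h]))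
  have hjk : j < k := lt_of_le_of_ne (hk j hjI) (fun h => hrk (by rw [h]))
  obtain ⟨hiL, -, x, hx, hxi⟩ := hiI
  obtain ⟨hkL, -, y, hy, hyk⟩ := hkI
  have hja : p j ≠ a := fun h => by
    have := hinj j hjL 0 (Nat.zero_le _) (by rw [h, hp.z]); omega
  have hjb : p j ≠ b := fun h => by
    have := hinj j hjL L le_rfl (by rw [h, hp.e]); omega
  have hjA : ∃ k ∈ K, R k (p j) := by
    by_contra hcon
    exact hr (cmp_step hsQ hsr ⟨hp.mem j hjL, hja, hjb, hcon⟩)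
  refine claim1 (p j) (hp.mem j hjL) hja hjb hjA ?_
  have av : ∀ l ≤ L, l ≠ j → p l ∈ (K ∪ {p j})ᶜ := by
    intro l hl hlj
    simp only [mem_compl_iff, mem_union, mem_singleton_iff, not_or]
    exact ⟨hp.mem l hl, fun h => hlj (hinj l hl j hjL h)⟩
  have hQs : Q ⊆ (K ∪ {p j})ᶜ := by
    intro l hl
    simp only [mem_compl_iff, mem_union, mem_singleton_iff, not_or]
    exact ⟨(hQB hl).1, fun h => hr (h ▸ hl)⟩
  have r1 := hp.rt (K ∪ {p j})ᶜ (Nat.zero_le i) hiL (fun l _ hl => av l (by omega) (by omega))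
  have r2 := hp.rt (K ∪ {p j})ᶜ hkL le_rfl (fun l h1 h2 => av l (by omega) (by omega))
  rw [hp.z] at r1
  rw [hp.e] at r2
  have r3 := cn_mono_path hQs (cmp_cn hs x hx y hy)
  exact ((r1.tail ⟨hs _ _ hxi, hQs hx⟩).trans r3).trans (Relation.ReflTransGen.head ⟨hyk, av k hkL (by omega)⟩ r2)

end whit
end TG

namespace TG
open Set Complex Filter Topology Metric
open scoped ComplexConjugate

lemma pth_arc {X ι : Type*} {pos : X → ℂ} {e : ι → Sym2 X} {A : ι → Set ℂ} (hs : Sys pos e A) {L : ℕ} {p : ℕ → X} {ix : ℕ → ι}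
    (hi : ∀ i < L, e (ix i) = s(p i, p (i + 1))) (hinj : ∀ i ≤ L, ∀ j ≤ L, p i = p j → i = j) (m : ℕ) (hm : m + 1 ≤ L) :
    IsArc (⋃ i ∈ {i | i < m + 1}, A (ix i)) (pos (p 0)) (pos (p (m + 1))) := by
  induction m with
  | zero =>
    have : (⋃ i ∈ {i | i < 0 + 1}, A (ix i)) = A (ix 0) := by
      have : {i | i < 0 + 1} = {0} := by ext i; simp
      rw [this, biUnion_singleton]
    rw [this]
    exact hs.arc _ _ _ (hi 0 (by omega))
  | succ m ih =>
    have : (⋃ i ∈ {i | i < m + 1 + 1}, A (ix i)) = (⋃ i ∈ {i | i < m + 1}, A (ix i)) ∪ A (ix (m + 1)) := by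
      have : {i | i < m + 1 + 1} = insert (m + 1) {i | i < m + 1} := by ext i; simp; omega
      rw [this, biUnion_insert, union_comm]
    rw [this]
    refine (ih (by omega)).concat (hs.arc _ _ _ (hi (m + 1) (by omega))) ?_
    rintro z ⟨h1, h2⟩
    simp only [mem_iUnion] at h1
    obtain ⟨i, hi', h1⟩ := h1
    change i < m + 1 at hi'
    have e1 := hi i (by omega)
    have e2 := hi (m + 1) (by omega)
    have hne : ix i ≠ ix (m + 1) := by
      intro h
      rw [h, e2] at e1
      simp only [Sym2.eq_iff] at e1
      rcases e1 with ⟨h1, h2⟩ | ⟨h1, h2⟩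
      · have := hinj _ (by omega) _ (by omega) h1; omega
      · have := hinj _ (by omega) _ (by omega) h2; omega
    obtain ⟨x, rfl⟩ := hs.inter _ _ hne ⟨h1, h2⟩
    have h3 := hs.on _ _ h1
    have h4 := hs.on _ _ h2
    rw [e1] at h3
    rw [e2] at h4
    simp only [Sym2.mem_iff] at h3 h4
    have : x = p (m + 1) := by
      rcases h4 with h4 | h4
      · exact h4
      · rcases h3 with h3 | h3
        · have := hinj _ (by omega) _ (by omega) (h3.symm.trans h4); omega
        · have := hinj _ (by omega) _ (by omega) (h3.symm.trans h4); omega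
    rw [this]; rfl

lemma same_face {O : Type u} [Finite O] {S : SimpleGraph (Option O)} (Es : PlaneEmbedding S) {a b c : O} (hab : a ≠ b)
    (na : S.Adj none (some a)) (nb : S.Adj none (some b)) (nn : ∀ x, S.Adj none (some x) → x = a ∨ x = b ∨ x = c)
    {K : Set O} {L : ℕ} {p : ℕ → O} (hp : Pth (fun x y => S.Adj (some x) (some y)) Kᶜ a b L p)
    (hinj : ∀ i ≤ L, ∀ j ≤ L, p i = p j → i = j)
    (hind : ∀ i ≤ L, ∀ j ≤ L, S.Adj (some (p i)) (some (p j)) → i = j ∨ i + 1 = j ∨ j + 1 = i) (hc : c ∈ K)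
    (hcn : Cn (fun x y => S.Adj (some x) (some y)) K) (hall : ∀ x, x ∈ K ∨ ∃ i ≤ L, x = p i) :
    ∃ F, Es.IsFace F ∧ Es.VertexOnFace none F ∧ ∀ i ≤ L, Es.VertexOnFace (some (p i)) F := by
  obtain ⟨A, hs, hA⟩ := Sys.of_embedding Es
  set pos : Option O → ℂ := fun v => cE (Es.pos v) with hpos
  have hL : 0 < L := by
    rcases Nat.eq_zero_or_pos L with h | h
    · exact absurd (hp.z.symm.trans (by rw [← hp.e, h])) hab
    · exact h
  have hex : ∀ i, ∃ e : S.edgeSet, i < L → (e : Sym2 (Option O)) = s(some (p i), some (p (i + 1))) := by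
    intro i
    by_cases h : i < L
    · exact ⟨⟨s(some (p i), some (p (i + 1))), hp.adj i h⟩, fun _ => rfl⟩
    · exact ⟨⟨s(none, some a), na⟩, fun h' => absurd h' h⟩
  choose ix hix using hex
  set β := ⋃ i ∈ {i | i < L}, A (ix i) with hβ
  have hβa : IsArc β (pos (some a)) (pos (some b)) := by
    have := pth_arc hs (L := L) (p := fun i => some (p i)) (ix := ix) hix
      (fun i hi j hj h => hinj i hi j hj (Option.some.inj h)) (L - 1) (by omega)
    rw [show L - 1 + 1 = L by omega] at this
    simpa only [hp.z, hp.e] using this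
  let ea : S.edgeSet := ⟨s(none, some a), na⟩
  let eb : S.edgeSet := ⟨s(none, some b), nb⟩
  have hea : (ea : Sym2 (Option O)) = s(some a, none) := Sym2.eq_swap
  have hab' : ea ≠ eb := by
    intro h
    have h := congrArg Subtype.val h
    simp [ea, eb, hab] at h
  have hαa : IsArc (A ea ∪ A eb) (pos (some a)) (pos (some b)) := by
    refine (hs.arc ea _ _ hea).concat (hs.arc eb _ _ rfl) ?_
    rintro z ⟨h1, h2⟩
    obtain ⟨x, rfl⟩ := hs.inter _ _ hab' ⟨h1, h2⟩
    have h3 := hs.on _ _ h1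
    have h4 := hs.on _ _ h2
    simp only [ea, eb, Sym2.mem_iff] at h3 h4
    rcases h3 with rfl | rfl
    · rfl
    · rcases h4 with h | h
      · cases h
      · exact absurd (Option.some.inj h) hab
  set α := A ea ∪ A eb with hα
  have hαβ : α ∩ β ⊆ {pos (some a), pos (some b)} := by
    rintro z ⟨h1, h2⟩
    simp only [hβ, mem_iUnion] at h2
    obtain ⟨i, hi, h2⟩ := h2
    change i < L at hi
    have key : ∀ x : O, ∀ h : S.Adj none (some x), z ∈ A ⟨s(none, some x), h⟩ → z = pos (some x) := by
      intro x h hz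
      have hne : (⟨s(none, some x), h⟩ : S.edgeSet) ≠ ix i := by
        intro h'
        have h' := congrArg Subtype.val h'
        rw [hix i hi] at h'
        simp at h'
      obtain ⟨y, rfl⟩ := hs.inter _ _ hne ⟨hz, h2⟩
      have h3 := hs.on _ _ hz
      have h4 := hs.on _ _ h2
      rw [hix i hi] at h4
      simp only [Sym2.mem_iff] at h3 h4
      rcases h3 with rfl | rfl
      · rcases h4 with h | h <;> cases h
      · rfl
    rcases h1 with h1 | h1
    · exact Or.inl (key a na h1)
    · exact Or.inr (key b nb h1)
  set J := α ∪ β with hJ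
  -- edges of J
  have hJE : ∀ z ∈ J, ∃ e : S.edgeSet, z ∈ A e ∧ A e ⊆ J ∧ ∀ x ∈ K, some x ∉ (e : Sym2 (Option O)) := by
    rintro z ((hz | hz) | hz)
    · refine ⟨ea, hz, fun w hw => Or.inl (Or.inl hw), fun x hx h => ?_⟩
      simp only [ea, Sym2.mem_iff, reduceCtorEq, false_or, Option.some.injEq] at h
      exact hp.mem 0 (Nat.zero_le _) (by rw [hp.z, ← h]; exact hx)
    · refine ⟨eb, hz, fun w hw => Or.inl (Or.inr hw), fun x hx h => ?_⟩
      simp only [eb, Sym2.mem_iff, reduceCtorEq, false_or, Option.some.injEq] at h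
      exact hp.mem L le_rfl (by rw [hp.e, ← h]; exact hx)
    · simp only [hβ, mem_iUnion] at hz
      obtain ⟨i, hi, hz⟩ := hz
      refine ⟨ix i, hz, fun w hw => Or.inr (mem_biUnion hi hw), fun x hx h => ?_⟩
      change i < L at hi
      rw [hix i hi] at h
      simp only [Sym2.mem_iff, Option.some.injEq] at h
      rcases h with rfl | rfl
      · exact hp.mem i (by omega) hx
      · exact hp.mem (i + 1) (by omega) hx
  have hKJ : ∀ x ∈ K, pos (some x) ∉ J := by
    intro x hx h
    obtain ⟨e, he, -, h'⟩ := hJE _ h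
    exact h' x hx (hs.on _ _ he)
  have hpJ : ∀ i ≤ L, pos (some (p i)) ∈ J := by
    intro i hi
    by_cases h : i = L
    · rw [h, hp.e]; exact Or.inl hαa.right_mem
    · have hi' : i < L := by omega
      refine Or.inr (mem_biUnion (show i ∈ {i | i < L} from hi') (hs.mem ?_))
      rw [hix i hi']; simp
  have hnJ : pos none ∈ J := Or.inl (Or.inl (hs.mem (by simp [ea])))
  have hKL : ∀ x ∈ K, Lk J (pos (some c)) (pos (some x)) := by
    intro x hx
    refine ⟨Dr pos (fun i : S.edgeSet => (i : Sym2 (Option O))) A (some '' K),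
      hs.Dr_preconn (R := fun x y => S.Adj x y) (fun x y h => ⟨⟨s(x, y), h⟩, rfl⟩) (hcn.map (f := some) (fun _ _ h => h)), ?_,
      Or.inl ⟨_, ⟨c, hc, rfl⟩, rfl⟩, Or.inl ⟨_, ⟨x, hx, rfl⟩, rfl⟩⟩
    intro z hz hzJ
    obtain ⟨e, he, -, h'⟩ := hJE _ hzJ
    obtain ⟨u, v, huv⟩ := s2_ex (e : Sym2 (Option O))
    refine Set.disjoint_left.1 (hs.Dr_arc (Q := some '' K) (i := e) huv ?_ ?_) hz he
    · rintro ⟨y, hy, rfl⟩; exact h' y hy (by rw [huv]; simp)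
    · rintro ⟨y, hy, rfl⟩; exact h' y hy (by rw [huv]; simp)
  have hdw : ∀ z ∈ dw pos A, z ∈ J ∨ Lk J (pos (some c)) z := by
    have hv : ∀ x, pos x ∈ J ∨ Lk J (pos (some c)) (pos x) := by
      rintro (_ | x)
      · exact Or.inl hnJ
      · rcases hall x with h | ⟨i, hi, rfl⟩
        · exact Or.inr (hKL x h)
        · exact Or.inl (hpJ i hi)
    have he : ∀ (e : S.edgeSet) (x : O) (v : Option O), x ∈ K → (e : Sym2 (Option O)) = s(v, some x) → ∀ z ∈ A e, z ∈ J ∨ Lk J (pos (some c)) z := by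
      intro e x v hx he z hz
      by_cases hzv : z = pos v
      · rw [hzv]; exact hv v
      right
      have harc := hs.arc e _ _ he
      refine (hKL x hx).trans ⟨A e \ {pos v}, harc.diff_left, ?_, ⟨harc.right_mem, harc.ne.symm⟩, ⟨hz, hzv⟩⟩
      rintro w ⟨hw, hwv⟩ hwJ
      obtain ⟨e', he', -, h'⟩ := hJE _ hwJ
      have hne : e ≠ e' := by
        rintro rfl
        exact h' x hx (by rw [he]; simp)
      obtain ⟨y, rfl⟩ := hs.inter _ _ hne ⟨hw, he'⟩
      have h3 := hs.on _ _ hw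
      rw [he] at h3
      simp only [Sym2.mem_iff] at h3
      rcases h3 with rfl | rfl
      · exact hwv rfl
      · exact h' x hx (hs.on _ _ he')
    rintro z (⟨x, rfl⟩ | hz)
    · exact hv x
    · simp only [mem_iUnion] at hz
      obtain ⟨⟨e, he'⟩, hz⟩ := hz
      obtain ⟨u, v, rfl⟩ := s2_ex e
      have huv : S.Adj u v := he'
      have nkey : ∀ (x : O) (h : S.Adj none (some x)), z ∈ A ⟨s(none, some x), h⟩ → z ∈ J ∨ Lk J (pos (some c)) z := by
        intro x h hz
        rcases nn x h with rfl | rfl | rfl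
        · exact Or.inl (Or.inl (Or.inl hz))
        · exact Or.inl (Or.inl (Or.inr hz))
        · exact he _ x none hc rfl z hz
      rcases u with _ | x
      · rcases v with _ | y
        · exact absurd huv (S.loopless.irrefl _)
        · exact nkey y huv hz
      · rcases v with _ | y
        · refine nkey x huv.symm ?_
          have : (⟨s(some x, none), he'⟩ : S.edgeSet) = ⟨s(none, some x), huv.symm⟩ := Subtype.ext Sym2.eq_swap
          rwa [this] at hz
        · rcases hall x with hx | ⟨i, hi, rfl⟩
          · exact he _ x (some y) hx Sym2.eq_swap z hz
          · rcases hall y with hy | ⟨j, hj, rfl⟩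
            · exact he _ y (some (p i)) hy rfl z hz
            · left; right
              rcases hind i hi j hj huv with rfl | rfl | rfl
              · exact absurd huv (S.loopless.irrefl _)
              · refine mem_biUnion (show i ∈ {i | i < L} from by change i < L; omega) ?_
                have : ix i = ⟨s(some (p i), some (p (i + 1))), he'⟩ := Subtype.ext (hix i (by omega))
                rwa [this]
              · refine mem_biUnion (show j ∈ {i | i < L} from by change j < L; omega) ?_
                have : ix j = ⟨s(some (p (j + 1)), some (p j)), he'⟩ := Subtype.ext ((hix j (by omega)).trans Sym2.eq_swap)
                rwa [this]
  obtain ⟨p0, q0, hp0, hq0, hn⟩ := jordan_sep hαa hβa (by rw [pair_comm]; exact hαβ)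
  have : ∃ p1, p1 ∉ J ∧ ¬ Lk J p1 (pos (some c)) := by
    by_contra hcon
    push Not at hcon
    exact hn ((hcon p0 hp0).trans (hcon q0 hq0).symm)
  obtain ⟨p1, hp1, hn1⟩ := this
  have hcl := comp_closure hαa hβa hαβ hp1 hn1 (hKJ c hc)
  have hFd : connectedComponentIn Jᶜ p1 ⊆ (dw pos A)ᶜ := by
    intro z hz hzd
    rcases hdw z hzd with h | h
    · exact connectedComponentIn_subset _ _ hz h
    · exact hn1 ((Lk_of_mem_comp hp1 hz).trans h.symm)
  have hp1F : p1 ∈ connectedComponentIn Jᶜ p1 := mem_connectedComponentIn hp1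
  have hJd : J ⊆ dw pos A := by
    intro z hz
    obtain ⟨e, he, -⟩ := hJE z hz
    exact Or.inr (mem_iUnion.2 ⟨e, he⟩)
  have hFe : connectedComponentIn (dw pos A)ᶜ p1 = connectedComponentIn Jᶜ p1 :=
    subset_antisymm (connectedComponentIn_mono _ (compl_subset_compl.2 hJd))
      (isPreconnected_connectedComponentIn.subset_connectedComponentIn hp1F hFd)
  have hdr : cE '' Es.drawing = dw pos A := by
    simp only [PlaneEmbedding.drawing, dw, image_union, image_iUnion]
    congr 1
    · rw [← range_comp]; rfl
    · ext z
      simp only [mem_iUnion]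
      constructor
      · rintro ⟨u, v, h, hz⟩
        exact ⟨⟨s(u, v), h⟩, by rwa [hA]⟩
      · rintro ⟨⟨e, he⟩, hz⟩
        obtain ⟨u, v, rfl⟩ := s2_ex e
        exact ⟨u, v, he, by rwa [hA u v he] at hz⟩
  have hp1d : cE.symm p1 ∉ Es.drawing := by
    intro h
    apply hFd hp1F
    rw [← hdr]
    exact ⟨_, h, cE.apply_symm_apply p1⟩
  have hFim : cE '' connectedComponentIn Es.drawingᶜ (cE.symm p1) = connectedComponentIn Jᶜ p1 := by
    rw [cE_comp _ hp1d, hdr, cE.apply_symm_apply, hFe]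
  have hon : ∀ v, pos v ∈ J → Es.VertexOnFace v (connectedComponentIn Es.drawingᶜ (cE.symm p1)) := by
    intro v hv
    have h1 := hcl hv
    rw [← hFim] at h1
    have h2 : closure (cE '' connectedComponentIn Es.drawingᶜ (cE.symm p1)) = cE '' closure (connectedComponentIn Es.drawingᶜ (cE.symm p1)) :=
      (cE.toHomeomorph.image_closure _).symm
    rw [h2] at h1
    obtain ⟨y, hy, hye⟩ := h1
    rw [cE.injective hye] at hy
    exact hy
  exact ⟨_, ⟨_, hp1d, rfl⟩, hon _ hnJ, fun i hi => hon _ (hpJ i hi)⟩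

end TG

namespace TG
open Set Complex Filter Topology Metric
open scoped ComplexConjugate

lemma zmod_succ_val {M : ℕ} (hM : 1 < M) (i : ZMod M) :
    (i.val + 1 < M ∧ (i + 1).val = i.val + 1) ∨ (i.val + 1 = M ∧ (i + 1).val = 0) := by
  have : NeZero M := ⟨by omega⟩
  have : Fact (1 < M) := ⟨hM⟩
  have h := ZMod.val_lt i
  rw [ZMod.val_add, ZMod.val_one]
  rcases Nat.lt_or_ge (i.val + 1) M with h1 | h1
  · exact Or.inl ⟨h1, Nat.mod_eq_of_lt h1⟩
  · have : i.val + 1 = M := by omega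
    right; rw [this]; simp

lemma build {W W' : Type u} [Finite W'] (π : W → W') (σ' : ZMod (Nat.card W') ≃ W') (i0 : ZMod (Nat.card W'))
    {x y z : W} (hxy : x ≠ y) (hyz : y ≠ z) (hxz : x ≠ z) (hx : π x = σ' i0) (hy : π y = σ' i0) (hz : π z = σ' i0)
    (hf : ∀ w, π w = σ' i0 → w = x ∨ w = y ∨ w = z) (s : W' → W) (s1 : ∀ v, v ≠ σ' i0 → π (s v) = v)
    (s2 : ∀ w, π w ≠ σ' i0 → s (π w) = w) :
    ∃ σ : ZMod (Nat.card W) ≃ W, CoarsensTo π σ σ' ∧ (∃ i, σ i = x ∧ σ (i + 1) = y) ∧ (∃ i, σ i = y ∧ σ (i + 1) = z) ∧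
      (1 < Nat.card W' → ∀ i, (σ i = x ∧ σ (i + 1) = y) ∨ (σ i = y ∧ σ (i + 1) = z) ∨
        (σ i = z ∧ σ (i + 1) = s (σ' (i0 + 1)) ∧ σ' (i0 + 1) ≠ σ' i0) ∨
        (σ i = s (σ' (i0 - 1)) ∧ σ (i + 1) = x ∧ σ' (i0 - 1) ≠ σ' i0) ∨
        ∃ k, σ' k ≠ σ' i0 ∧ σ' (k + 1) ≠ σ' i0 ∧ σ i = s (σ' k) ∧ σ (i + 1) = s (σ' (k + 1))) := by
  classical
  have hne : Nonempty W' := ⟨σ' i0⟩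
  have hN0 : 0 < Nat.card W' := Nat.card_pos
  have : NeZero (Nat.card W') := ⟨by omega⟩
  let g : ℕ → W := fun k => if k = 0 then x else if k = 1 then y else if k = 2 then z else s (σ' (i0 + ((k - 2 : ℕ) : ZMod (Nat.card W'))))
  have g0 : g 0 = x := rfl
  have g1 : g 1 = y := rfl
  have g2 : g 2 = z := rfl
  have g3 : ∀ k, 3 ≤ k → g k = s (σ' (i0 + ((k - 2 : ℕ) : ZMod (Nat.card W')))) := by
    intro k hk
    simp only [g, show k ≠ 0 by omega, show k ≠ 1 by omega, show k ≠ 2 by omega, if_false]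
  have nz : ∀ j : ℕ, 1 ≤ j → j < Nat.card W' → σ' (i0 + (j : ZMod (Nat.card W'))) ≠ σ' i0 := by
    intro j h1 h2 h
    have h := σ'.injective h
    have h' : (j : ZMod (Nat.card W')) = 0 := by simpa using h
    have := (ZMod.natCast_eq_zero_iff j (Nat.card W')).1 h'
    exact absurd (Nat.le_of_dvd (by omega) this) (by omega)
  have gπ : ∀ k, k < Nat.card W' + 2 → π (g k) = σ' (i0 + ((k - 2 : ℕ) : ZMod (Nat.card W'))) := by
    intro k hk
    rcases Nat.lt_or_ge k 3 with h | h
    · interval_cases k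
      · rw [g0, hx]; simp
      · rw [g1, hy]; simp
      · rw [g2, hz]; simp
    · rw [g3 k h, s1 _ (nz (k - 2) (by omega) (by omega))]
  have gnz : ∀ k, 3 ≤ k → k < Nat.card W' + 2 → π (g k) ≠ σ' i0 := by
    intro k h1 h2
    rw [gπ k h2]; exact nz _ (by omega) (by omega)
  have gz : ∀ k, k < 3 → π (g k) = σ' i0 := by
    intro k h
    interval_cases k
    exacts [hx, hy, hz]
  have ginj : ∀ k < Nat.card W' + 2, ∀ l < Nat.card W' + 2, g k = g l → k = l := by
    intro k hk l hl h
    rcases Nat.lt_or_ge k 3 with h1 | h1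
    · rcases Nat.lt_or_ge l 3 with h2 | h2
      · interval_cases k <;> interval_cases l <;> simp only [g0, g1, g2] at h <;> first | rfl | exact absurd h ‹_› | exact absurd h.symm ‹_›
      · exact absurd (h ▸ gz k h1) (gnz l h2 hl)
    · rcases Nat.lt_or_ge l 3 with h2 | h2
      · exact absurd (h.symm ▸ gz l h2) (gnz k h1 hk)
      · have h3 := gπ k hk
        rw [h, gπ l hl] at h3
        have h3 := add_left_cancel (σ'.injective h3)
        have h4 := congrArg ZMod.val h3
        rw [ZMod.val_cast_of_lt (by omega), ZMod.val_cast_of_lt (by omega)] at h4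
        omega
  have gsurj : ∀ w, ∃ k < Nat.card W' + 2, g k = w := by
    intro w
    by_cases h : π w = σ' i0
    · rcases hf w h with rfl | rfl | rfl
      exacts [⟨0, by omega, g0⟩, ⟨1, by omega, g1⟩, ⟨2, by omega, g2⟩]
    · set j := σ'.symm (π w) - i0 with hj
      have hj0 : j ≠ 0 := by
        intro h0
        apply h
        have : σ'.symm (π w) = i0 := sub_eq_zero.1 h0
        rw [← this]; simp
      have hjv : j.val ≠ 0 := by rwa [Ne, ZMod.val_eq_zero]
      have hjl := ZMod.val_lt j
      refine ⟨j.val + 2, by omega, ?_⟩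
      rw [g3 _ (by omega), Nat.add_sub_cancel, ZMod.natCast_zmod_val, hj, add_sub_cancel, σ'.apply_symm_apply, s2 w h]
  have hM : Nat.card W = Nat.card W' + 2 := by
    have hb : Function.Bijective (fun k : Fin (Nat.card W' + 2) => g k) := by
      constructor
      · intro k l h; exact Fin.ext (ginj k k.2 l l.2 h)
      · intro w; obtain ⟨k, hk, h⟩ := gsurj w; exact ⟨⟨k, hk⟩, h⟩
    rw [← Nat.card_eq_of_bijective _ hb, Nat.card_fin]
  have hM1 : 1 < Nat.card W := by omega
  have : NeZero (Nat.card W) := ⟨by omega⟩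
  have hb : Function.Bijective (fun i : ZMod (Nat.card W) => g i.val) := by
    constructor
    · intro i j h
      have h1 := ZMod.val_lt i
      have h2 := ZMod.val_lt j
      exact ZMod.val_injective _ (ginj _ (by omega) _ (by omega) h)
    · intro w; obtain ⟨k, hk, h⟩ := gsurj w
      refine ⟨(k : ZMod (Nat.card W)), ?_⟩
      simp only
      rw [ZMod.val_cast_of_lt (by omega), h]
  have vk : ∀ k : ℕ, k < Nat.card W' + 2 → ((k : ZMod (Nat.card W))).val = k := fun k hk => ZMod.val_cast_of_lt (by omega)
  have hneg : (((Nat.card W' - 1 : ℕ)) : ZMod (Nat.card W')) = -1 := by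
    have : (((Nat.card W' - 1 : ℕ)) : ZMod (Nat.card W')) + 1 = 0 := by
      rw [← Nat.cast_succ, Nat.succ_eq_add_one, Nat.sub_add_cancel hN0]; simp
    exact eq_neg_of_add_eq_zero_left this
  refine ⟨Equiv.ofBijective _ hb, ⟨fun i => i0 + ((i.val - 2 : ℕ) : ZMod (Nat.card W')), ?_, ?_, ?_⟩, ?_, ?_, ?_⟩
  · intro j
    have hl := ZMod.val_lt (j - i0)
    refine ⟨(((j - i0).val + 2 : ℕ) : ZMod (Nat.card W)), ?_⟩
    simp only
    rw [vk _ (by omega), Nat.add_sub_cancel, ZMod.natCast_zmod_val]; ring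
  · intro i
    have h1 := ZMod.val_lt i
    exact gπ _ (by omega)
  · intro i
    simp only
    have h1 := ZMod.val_lt i
    rcases zmod_succ_val hM1 i with ⟨h2, h3⟩ | ⟨h2, h3⟩
    · rw [h3]
      rcases Nat.lt_or_ge i.val 2 with h4 | h4
      · left; rw [show i.val + 1 - 2 = i.val - 2 by omega]
      · right; rw [show i.val + 1 - 2 = i.val - 2 + 1 by omega]; push_cast; ring
    · right
      rw [h3, show i.val - 2 = Nat.card W' - 1 by omega, hneg]; simp
  · refine ⟨((0 : ℕ) : ZMod (Nat.card W)), ?_, ?_⟩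
    · simp only [Equiv.ofBijective_apply, vk 0 (by omega), g0]
    · simp only [Equiv.ofBijective_apply]
      rw [← Nat.cast_succ, vk 1 (by omega), g1]
  · refine ⟨((1 : ℕ) : ZMod (Nat.card W)), ?_, ?_⟩
    · simp only [Equiv.ofBijective_apply, vk 1 (by omega), g1]
    · simp only [Equiv.ofBijective_apply]
      rw [← Nat.cast_succ, vk 2 (by omega), g2]
  · intro hN1 i
    have h1 := ZMod.val_lt i
    simp only [Equiv.ofBijective_apply]
    rcases zmod_succ_val hM1 i with ⟨h2, h3⟩ | ⟨h2, h3⟩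
    · rw [h3]
      rcases Nat.lt_or_ge i.val 3 with h4 | h4
      · have : i.val = 0 ∨ i.val = 1 ∨ i.val = 2 := by omega
        rcases this with h | h | h
        · left; rw [h]; exact ⟨g0, g1⟩
        · right; left; rw [h]; exact ⟨g1, g2⟩
        · right; right; left; rw [h]
          refine ⟨g2, ?_, ?_⟩
          · rw [g3 _ (by omega)]; simp
          · simpa using nz 1 le_rfl hN1
      · right; right; right; right
        refine ⟨i0 + ((i.val - 2 : ℕ) : ZMod (Nat.card W')), nz _ (by omega) (by omega), ?_, g3 _ h4, ?_⟩
        · have := nz (i.val - 2 + 1) (by omega) (by omega)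
          push_cast at this
          rwa [← add_assoc] at this
        · rw [g3 _ (by omega), show i.val + 1 - 2 = i.val - 2 + 1 by omega]
          push_cast
          rw [← add_assoc]
    · right; right; right; left
      have h5 := nz (Nat.card W' - 1) (by omega) (by omega)
      rw [hneg, ← sub_eq_add_neg] at h5
      refine ⟨?_, ?_, h5⟩
      · rw [g3 _ (by omega), show i.val - 2 = Nat.card W' - 1 by omega, hneg, ← sub_eq_add_neg]
      · rw [h3, g0]

end TG

namespace TG
open Set Complex Filter Topology Metric
open scoped ComplexConjugate

lemma fin3_cases : ∀ p m q j : Fin 3, p ≠ q → p ≠ m → q ≠ m → j = p ∨ j = m ∨ j = q := by decide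

lemma fin3_abs : ∀ k j : Fin 3, j = k ∨ j = k + 1 ∨ j = k + 2 := by decide

section asm
variable {V : Type u} {G : SimpleGraph V} (E : PlaneEmbedding G) {a b c : V} (hab : G.Adj a b) (hbc : G.Adj b c) (hac : G.Adj a c)

lemma t_inj (hab : G.Adj a b) (hbc : G.Adj b c) (hac : G.Adj a c) : Function.Injective ![a, b, c] := by
  have h1 := hab.ne; have h2 := hbc.ne; have h3 := hac.ne
  intro i j h
  fin_cases i <;> fin_cases j <;> simp_all

lemma t_adj (hab : G.Adj a b) (hbc : G.Adj b c) (hac : G.Adj a c) (i j : Fin 3) (h : i ≠ j) : G.Adj (![a, b, c] i) (![a, b, c] j) := by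
  fin_cases i <;> fin_cases j <;> first | exact absurd rfl h | assumption | (apply SimpleGraph.Adj.symm; assumption)

lemma t_W (j : Fin 3) : ![a, b, c] j ∈ closedOutsideTriangle E hab hbc hac := by
  right; fin_cases j <;> simp

lemma t_O (j : Fin 3) : ![a, b, c] j ∉ outsideTriangle E hab hbc hac := by
  rintro ⟨h1, h2, h3, -⟩
  fin_cases j
  exacts [h1 rfl, h2 rfl, h3 rfl]

lemma W_cases {v : V} (hv : v ∈ closedOutsideTriangle E hab hbc hac) : v ∈ outsideTriangle E hab hbc hac ∨ ∃ j, v = ![a, b, c] j := by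
  rcases hv with h | h | h | h
  · exact Or.inl h
  · exact Or.inr ⟨0, h⟩
  · exact Or.inr ⟨1, h⟩
  · exact Or.inr ⟨2, h⟩

lemma mk_sigma [Finite V] (σstar : ZMod (Nat.card (Option ↥(outsideTriangle E hab hbc hac))) ≃ Option ↥(outsideTriangle E hab hbc hac))
    {p m q : Fin 3} (hpq : p ≠ q) (hpm : p ≠ m) (hqm : q ≠ m) :
    ∃ σ : ZMod (Nat.card ↥(closedOutsideTriangle E hab hbc hac)) ≃ ↥(closedOutsideTriangle E hab hbc hac),
      CoarsensTo (outProj E hab hbc hac) σ σstar ∧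
      s(![a, b, c] p, ![a, b, c] m) ∈ Sym2.map (Subtype.val) '' cycleEdges σ ∧
      s(![a, b, c] m, ![a, b, c] q) ∈ Sym2.map (Subtype.val) '' cycleEdges σ ∧
      (1 < Nat.card (Option ↥(outsideTriangle E hab hbc hac)) → ∀ i,
        ((σ i : V) = ![a, b, c] p ∧ (σ (i + 1) : V) = ![a, b, c] m) ∨ ((σ i : V) = ![a, b, c] m ∧ (σ (i + 1) : V) = ![a, b, c] q) ∨
        ((σ i : V) = ![a, b, c] q ∧ ∃ x, σstar (σstar.symm none + 1) = some x ∧ (σ (i + 1) : V) = x) ∨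
        ((σ (i + 1) : V) = ![a, b, c] p ∧ ∃ x, σstar (σstar.symm none - 1) = some x ∧ (σ i : V) = x) ∨
        ∃ k x y, σstar k = some x ∧ σstar (k + 1) = some y ∧ (σ i : V) = x ∧ (σ (i + 1) : V) = y) := by
  classical
  let tW : Fin 3 → ↥(closedOutsideTriangle E hab hbc hac) := fun j => ⟨_, t_W E hab hbc hac j⟩
  have tWi : Function.Injective tW := fun i j h => t_inj hab hbc hac (congrArg Subtype.val h)
  have hi0 : σstar (σstar.symm none) = none := σstar.apply_symm_apply _
  have pt : ∀ j, outProj E hab hbc hac (tW j) = none := by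
    intro j; simp only [outProj, tW]; exact dif_neg (t_O E hab hbc hac j)
  let s : Option ↥(outsideTriangle E hab hbc hac) → ↥(closedOutsideTriangle E hab hbc hac) := fun v => v.elim (tW 0) (fun x => ⟨x, Or.inl x.2⟩)
  have ss : ∀ x : ↥(outsideTriangle E hab hbc hac), (s (some x) : V) = x := fun x => rfl
  have ps : ∀ x : ↥(outsideTriangle E hab hbc hac), outProj E hab hbc hac (s (some x)) = some x := by
    intro x; simp only [outProj]; exact dif_pos x.2
  have hnn : ∀ v : Option ↥(outsideTriangle E hab hbc hac), v ≠ none → ∃ x, v = some x := fun v hv => Option.ne_none_iff_exists'.1 hv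
  obtain ⟨σ, h1, ⟨i1, h2, h2'⟩, ⟨i2, h3, h3'⟩, h4⟩ := build (outProj E hab hbc hac) σstar (σstar.symm none) (x := tW p) (y := tW m) (z := tW q)
    (tWi.ne hpm) (tWi.ne hqm.symm) (tWi.ne hpq) (by rw [hi0, pt]) (by rw [hi0, pt]) (by rw [hi0, pt])
    (by
      rw [hi0]; intro w hw
      rcases W_cases E hab hbc hac w.2 with h | ⟨j, hj⟩
      · simp only [outProj] at hw; rw [dif_pos h] at hw; cases hw
      · have : w = tW j := Subtype.ext hj
        rcases fin3_cases p m q j hpq hpm hqm with rfl | rfl | rfl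
        exacts [Or.inl this, Or.inr (Or.inl this), Or.inr (Or.inr this)]) s
    (by
      rw [hi0]; intro v hv
      obtain ⟨x, rfl⟩ := hnn v hv
      exact ps x)
    (by
      rw [hi0]; intro w hw
      rcases W_cases E hab hbc hac w.2 with h | ⟨j, hj⟩
      · have : w = s (some ⟨w, h⟩) := rfl
        rw [this, ps]
      · have : w = tW j := Subtype.ext hj
        rw [this] at hw
        exact absurd (pt j) hw)
  refine ⟨σ, h1, ⟨_, ⟨i1, rfl⟩, by rw [h2, h2']; rfl⟩, ⟨_, ⟨i2, rfl⟩, by rw [h3, h3']; rfl⟩, ?_⟩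
  intro hc i
  rw [hi0] at h4
  rcases h4 hc i with ⟨e1, e2⟩ | ⟨e1, e2⟩ | ⟨e1, e2, e3⟩ | ⟨e1, e2, e3⟩ | ⟨k, e1, e2, e3, e4⟩
  · left; rw [e1, e2]; exact ⟨rfl, rfl⟩
  · right; left; rw [e1, e2]; exact ⟨rfl, rfl⟩
  · right; right; left
    obtain ⟨x, hx⟩ := hnn _ e3
    refine ⟨by rw [e1], x, hx, ?_⟩
    rw [e2, hx, ss]
  · right; right; right; left
    obtain ⟨x, hx⟩ := hnn _ e3
    refine ⟨by rw [e2], x, hx, ?_⟩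
    rw [e1, hx, ss]
  · right; right; right; right
    obtain ⟨x, hx⟩ := hnn _ e1
    obtain ⟨y, hy⟩ := hnn _ e2
    exact ⟨k, x, y, hx, hy, by rw [e3, hx, ss], by rw [e4, hy, ss]⟩

lemma S_some {x y : ↥(outsideTriangle E hab hbc hac)} : (outStarGraph E hab hbc hac).Adj (some x) (some y) ↔ G.Adj x y := by
  simp only [outStarGraph, SimpleGraph.fromRel_adj, ne_eq, Option.some.injEq]
  constructor
  · rintro ⟨-, h | h⟩
    exacts [h, h.symm]
  · intro h
    exact ⟨fun h' => h.ne (congrArg Subtype.val h'), Or.inl h⟩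

lemma S_none {n : Fin 3 → V} (hS : Struct G (outsideTriangle E hab hbc hac) ![a, b, c] n) {x : ↥(outsideTriangle E hab hbc hac)} :
    (outStarGraph E hab hbc hac).Adj none (some x) ↔ ∃ j, (x : V) = n j := by
  have h0 := hS.adj 0 x x.2
  have h1 := hS.adj 1 x x.2
  have h2 := hS.adj 2 x x.2
  simp only [Matrix.cons_val] at h0 h1 h2
  simp only [outStarGraph, SimpleGraph.fromRel_adj, ne_eq, reduceCtorEq, not_false_eq_true, true_and, or_self, h0, h1, h2]
  constructor
  · rintro (h | h | h)
    exacts [⟨0, h⟩, ⟨1, h⟩, ⟨2, h⟩]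
  · rintro ⟨j, h⟩
    rcases fin3_abs 0 j with rfl | rfl | rfl
    exacts [Or.inl h, Or.inr (Or.inl h), Or.inr (Or.inr h)]

lemma tg_planar {n : Fin 3 → V} (hS : Struct G (outsideTriangle E hab hbc hac) ![a, b, c] n)
    (σstar : ZMod (Nat.card (Option ↥(outsideTriangle E hab hbc hac))) ≃ Option ↥(outsideTriangle E hab hbc hac))
    (σ : ZMod (Nat.card ↥(closedOutsideTriangle E hab hbc hac)) ≃ ↥(closedOutsideTriangle E hab hbc hac))
    {p m q : Fin 3} (hpm : p ≠ m) (hqm : q ≠ m) {x0 y0 : ↥(outsideTriangle E hab hbc hac)}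
    (hu : σstar (σstar.symm none - 1) = some x0) (hw : σstar (σstar.symm none + 1) = some y0)
    (hpl : (Tg (outStarGraph E hab hbc hac ⊔ cyclicSuccGraph σstar) (fun j => ⟨n j, hS.mem j⟩) x0 y0 p q).IsPlanar)
    (hpairs : ∀ i,
        ((σ i : V) = ![a, b, c] p ∧ (σ (i + 1) : V) = ![a, b, c] m) ∨ ((σ i : V) = ![a, b, c] m ∧ (σ (i + 1) : V) = ![a, b, c] q) ∨
        ((σ i : V) = ![a, b, c] q ∧ ∃ x, σstar (σstar.symm none + 1) = some x ∧ (σ (i + 1) : V) = x) ∨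
        ((σ (i + 1) : V) = ![a, b, c] p ∧ ∃ x, σstar (σstar.symm none - 1) = some x ∧ (σ i : V) = x) ∨
        ∃ k x y, σstar k = some x ∧ σstar (k + 1) = some y ∧ (σ i : V) = x ∧ (σ (i + 1) : V) = y) :
    (G.induce (closedOutsideTriangle E hab hbc hac)).IsSubhamiltonianCycle σ := by
  have hti := t_inj hab hbc hac
  have hφ : ∀ w : ↥(closedOutsideTriangle E hab hbc hac), ∃ y : ↥(outsideTriangle E hab hbc hac) ⊕ Fin 3,
      Sum.elim Subtype.val ![a, b, c] y = (w : V) := by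
    intro w
    rcases W_cases E hab hbc hac w.2 with h | ⟨j, hj⟩
    · exact ⟨Sum.inl ⟨w, h⟩, rfl⟩
    · exact ⟨Sum.inr j, hj.symm⟩
  choose φ hφ using hφ
  have φi : Function.Injective φ := fun w w' h => Subtype.ext (by rw [← hφ w, ← hφ w', h])
  have ei : Function.Injective (Sum.elim Subtype.val ![a, b, c] : ↥(outsideTriangle E hab hbc hac) ⊕ Fin 3 → V) := by
    rintro (x | j) (y | k) h
    · exact congrArg _ (Subtype.ext h)
    · have hh : (x : V) = ![a, b, c] k := h
      exact absurd x.2 (hh ▸ t_O E hab hbc hac k)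
    · have hh : (y : V) = ![a, b, c] j := h.symm
      exact absurd y.2 (hh ▸ t_O E hab hbc hac j)
    · exact congrArg _ (hti h)
  have φl : ∀ (w : ↥(closedOutsideTriangle E hab hbc hac)) (x : ↥(outsideTriangle E hab hbc hac)), (w : V) = x → φ w = Sum.inl x := fun w x h => ei (by rw [hφ, h]; rfl)
  have φr : ∀ (w : ↥(closedOutsideTriangle E hab hbc hac)) j, (w : V) = ![a, b, c] j → φ w = Sum.inr j := fun w j h => ei (by rw [hφ, h]; rfl)
  refine planar_of_inj hpl _ φ φi ?_
  have hG : ∀ w w' : ↥(closedOutsideTriangle E hab hbc hac), G.Adj (w : V) w' → TgRel (outStarGraph E hab hbc hac ⊔ cyclicSuccGraph σstar) (fun j => ⟨n j, hS.mem j⟩) x0 y0 p q (φ w) (φ w') ∨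
      TgRel (outStarGraph E hab hbc hac ⊔ cyclicSuccGraph σstar) (fun j => ⟨n j, hS.mem j⟩) x0 y0 p q (φ w') (φ w) := by
    intro w w' h
    have e1 := hφ w
    have e2 := hφ w'
    rcases hw1 : φ w with x | j <;> rcases hw2 : φ w' with y | k <;> rw [hw1] at e1 <;> rw [hw2] at e2 <;>
      simp only [Sum.elim_inl, Sum.elim_inr] at e1 e2 <;> rw [← e1, ← e2] at h
    · left; exact Or.inl ((S_some E hab hbc hac).2 h)
    · left; left; exact Subtype.ext ((hS.adj k x x.2).1 h)
    · right; left; exact Subtype.ext ((hS.adj j y y.2).1 h.symm)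
    · left; trivial
  have hσ : ∀ i, σ i ≠ σ (i + 1) → TgRel (outStarGraph E hab hbc hac ⊔ cyclicSuccGraph σstar) (fun j => ⟨n j, hS.mem j⟩) x0 y0 p q (φ (σ i)) (φ (σ (i + 1))) ∨
      TgRel (outStarGraph E hab hbc hac ⊔ cyclicSuccGraph σstar) (fun j => ⟨n j, hS.mem j⟩) x0 y0 p q (φ (σ (i + 1))) (φ (σ i)) := by
    intro i hne
    rcases hpairs i with ⟨e1, e2⟩ | ⟨e1, e2⟩ | ⟨e1, x, hx, e2⟩ | ⟨e1, x, hx, e2⟩ | ⟨k, x, y, hx, hy, e1, e2⟩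
    · left; rw [φr _ _ e1, φr _ _ e2]; trivial
    · left; rw [φr _ _ e1, φr _ _ e2]; trivial
    · right; rw [φr _ _ e1, φl _ _ e2]
      rw [hx] at hw
      exact Or.inr (Or.inr ⟨Option.some.inj hw, rfl⟩)
    · left; rw [φr _ _ e1, φl _ _ e2]
      rw [hx] at hu
      exact Or.inr (Or.inl ⟨Option.some.inj hu, rfl⟩)
    · left; rw [φl _ _ e1, φl _ _ e2]
      refine Or.inr ?_
      rw [cyclicSuccGraph, SimpleGraph.fromRel_adj]
      refine ⟨fun h => hne (Subtype.ext ?_), Or.inl ⟨k, hx.symm, hy.symm⟩⟩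
      rw [e1, e2, Option.some.inj h]
  intro w w' h
  rw [Tg, SimpleGraph.fromRel_adj]
  refine ⟨φi.ne h.ne, ?_⟩
  rcases h with h | h
  · exact hG w w' h
  · rw [cyclicSuccGraph, SimpleGraph.fromRel_adj] at h
    obtain ⟨hne, ⟨i, rfl, rfl⟩ | ⟨i, rfl, rfl⟩⟩ := h
    · exact hσ i hne
    · exact (hσ i hne.symm).symm

end asm
end TG

namespace TG
open Set Complex Filter Topology Metric
open scoped ComplexConjugate

lemma fin3_other : ∀ i j : Fin 3, ∃ k : Fin 3, k ≠ i ∧ k ≠ j := by decide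
lemma fin3_two : ∀ m : Fin 3, ∃ p q : Fin 3, p ≠ q ∧ p ≠ m ∧ q ≠ m := by decide
lemma fin3_eq : ∀ m i j p q : Fin 3, i ≠ m → j ≠ m → i ≠ j → p ≠ q → p ≠ m → q ≠ m → (p = i ∧ q = j) ∨ (p = j ∧ q = i) := by decide
lemma fin3_ne : ∀ k0 : Fin 3, k0 + 1 ≠ k0 + 2 ∧ k0 + 1 ≠ k0 ∧ k0 + 2 ≠ k0 := by decide

section fin
variable {V : Type u} {G : SimpleGraph V}

lemma cutO (h3 : G.IsTriconnected) {O : Set V} {t n : Fin 3 → V} (hS : Struct G O t n) {Q : Set V} (hQO : Q ⊆ O) (hne : Q.Nonempty)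
    {x y : V} (hx : x ∉ Q) (hy : y ∉ Q) (hxO : x ∈ O) (hyO : y ∈ O ∨ ∃ k, y = t k) (hj : ∀ j, n j ∈ Q → t j = y) :
    ∃ s ∈ Q, ∃ r ∈ O, r ∉ Q ∧ G.Adj s r ∧ r ≠ x ∧ r ≠ y := by
  by_contra hcon
  push Not at hcon
  obtain ⟨q, hq⟩ := hne
  obtain ⟨z, hz, hzt⟩ := hS.z
  refine cut h3 hq hx hy (z := z) (fun h => hz (hQO h)) (fun h => hz (h ▸ hxO)) ?_ ?_
  · rintro rfl
    rcases hyO with h | ⟨k, h⟩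
    exacts [hz h, hzt k h]
  · intro s hs r hsr
    by_cases hr : r ∈ Q
    · exact Or.inl hr
    right
    rcases hS.closed s (hQO hs) r hsr with h | ⟨j, rfl⟩
    · by_cases hrx : r = x
      · exact Or.inl hrx
      · exact Or.inr (hcon s hs r h hr hsr hrx)
    · right
      have := (hS.adj j s (hQO hs)).1 hsr
      exact hj j (this ▸ hs)

lemma degen (h3 : G.IsTriconnected) {O : Set V} {t n : Fin 3 → V} (hS : Struct G O t n) (hn : ¬ Function.Injective n) :
    ∃ x, ∀ y ∈ O, y = x := by
  rw [Function.Injective] at hn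
  push Not at hn
  obtain ⟨i, j, hij, hne⟩ := hn
  obtain ⟨k, hki, hkj⟩ := fin3_other i j
  refine ⟨n i, ?_⟩
  by_contra hcon
  push Not at hcon
  obtain ⟨y, hy, hyn⟩ := hcon
  obtain ⟨s, hs, r, hr, hrQ, -, h1, -⟩ := cutO h3 hS (Q := O \ {n i}) sdiff_subset ⟨y, hy, hyn⟩ (x := n i) (y := t k)
    (fun h => h.2 rfl) (fun h => hS.tO k h.1) (hS.mem i) (Or.inr ⟨k, rfl⟩) (by
      intro l hl
      rcases fin3_cases i j k l hki.symm hne hkj with rfl | rfl | rfl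
      · exact absurd rfl hl.2
      · exact absurd hij.symm hl.2
      · rfl)
  exact hrQ ⟨hr, h1⟩

variable {a b c : V}

lemma tri_mem {p m : Fin 3} (h : p ≠ m) : s(![a, b, c] p, ![a, b, c] m) ∈ ({s(a, b), s(b, c), s(a, c)} : Set (Sym2 V)) := by
  fin_cases p <;> fin_cases m <;> first | exact absurd rfl h | simp

lemma tri_ne (hi : Function.Injective ![a, b, c]) {p m q : Fin 3} (hpq : p ≠ q) (hpm : p ≠ m) : s(![a, b, c] p, ![a, b, c] m) ≠ s(![a, b, c] m, ![a, b, c] q) := by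
  intro h
  rw [Sym2.eq_iff] at h
  rcases h with h | h
  · exact hpm (hi h.1)
  · exact hpq (hi h.1)

lemma tri_two {e1 e2 : Sym2 V} (h1 : e1 ∈ ({s(a, b), s(b, c), s(a, c)} : Set (Sym2 V)))
    (h2 : e2 ∈ ({s(a, b), s(b, c), s(a, c)} : Set (Sym2 V))) (hne : e1 ≠ e2) :
    ∃ m : Fin 3, ∀ p q, p ≠ q → p ≠ m → q ≠ m → (e1 = s(![a, b, c] p, ![a, b, c] m) ∧ e2 = s(![a, b, c] m, ![a, b, c] q)) ∨
      (e1 = s(![a, b, c] m, ![a, b, c] q) ∧ e2 = s(![a, b, c] p, ![a, b, c] m)) := by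
  have key : ∀ m i j : Fin 3, i ≠ m → j ≠ m → i ≠ j → e1 = s(![a, b, c] m, ![a, b, c] i) → e2 = s(![a, b, c] m, ![a, b, c] j) →
    ∃ m : Fin 3, ∀ p q, p ≠ q → p ≠ m → q ≠ m → (e1 = s(![a, b, c] p, ![a, b, c] m) ∧ e2 = s(![a, b, c] m, ![a, b, c] q)) ∨
      (e1 = s(![a, b, c] m, ![a, b, c] q) ∧ e2 = s(![a, b, c] p, ![a, b, c] m)) := by
    rintro m i j hi hj hij rfl rfl
    refine ⟨m, fun p q hpq hpm hqm => ?_⟩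
    have h := fin3_eq m i j p q hi hj hij hpq hpm hqm
    rcases h with ⟨rfl, rfl⟩ | ⟨rfl, rfl⟩
    · exact Or.inl ⟨Sym2.eq_swap, rfl⟩
    · exact Or.inr ⟨rfl, Sym2.eq_swap⟩
  rcases h1 with rfl | rfl | rfl <;> rcases h2 with rfl | rfl | rfl
  · exact absurd rfl hne
  · exact key 1 0 2 (by decide) (by decide) (by decide) Sym2.eq_swap rfl
  · exact key 0 1 2 (by decide) (by decide) (by decide) rfl rfl
  · exact key 1 2 0 (by decide) (by decide) (by decide) rfl Sym2.eq_swap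
  · exact absurd rfl hne
  · exact key 2 1 0 (by decide) (by decide) (by decide) Sym2.eq_swap Sym2.eq_swap
  · exact key 0 2 1 (by decide) (by decide) (by decide) rfl rfl
  · exact key 2 0 1 (by decide) (by decide) (by decide) Sym2.eq_swap Sym2.eq_swap
  · exact absurd rfl hne

end fin

section main
variable {V : Type u} {G : SimpleGraph V}

lemma main_degen (hplanar : G.IsPlanar) (E : PlaneEmbedding G) {a b c : V} (hab : G.Adj a b) (hbc : G.Adj b c) (hac : G.Adj a c)
    (hO : ∀ x ∈ outsideTriangle E hab hbc hac, ∀ y ∈ outsideTriangle E hab hbc hac, x = y)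
    (ht : ∀ x ∈ outsideTriangle E hab hbc hac, ∀ j, G.Adj x (![a, b, c] j))
    (σ : ZMod (Nat.card ↥(closedOutsideTriangle E hab hbc hac)) ≃ ↥(closedOutsideTriangle E hab hbc hac)) :
    (G.induce (closedOutsideTriangle E hab hbc hac)).IsSubhamiltonianCycle σ := by
  refine planar_of_inj hplanar _ Subtype.val Subtype.val_injective ?_
  intro x y hxy
  have hne : (x : V) ≠ y := fun h => hxy.ne (Subtype.ext h)
  rcases W_cases E hab hbc hac x.2 with h | ⟨i, hi⟩ <;> rcases W_cases E hab hbc hac y.2 with h' | ⟨j, hj⟩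
  · exact absurd (hO _ h _ h') hne
  · rw [hj]; exact ht _ h j
  · rw [hi]; exact (ht _ h' i).symm
  · rw [hi, hj]; refine t_adj hab hbc hac i j ?_
    rintro rfl; exact hne (hi.trans hj.symm)

lemma main_face [Finite V] (h3 : G.IsTriconnected) (E : PlaneEmbedding G) {a b c : V} (hab : G.Adj a b) (hbc : G.Adj b c) (hac : G.Adj a c)
    {n : Fin 3 → V} (hS : Struct G (outsideTriangle E hab hbc hac) ![a, b, c] n) (hn : Function.Injective n)
    (K : SimpleGraph (Option ↥(outsideTriangle E hab hbc hac))) (hK : outStarGraph E hab hbc hac ≤ K)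
    (Es : PlaneEmbedding (outStarGraph E hab hbc hac)) (k0 : Fin 3) (u w : ↥(outsideTriangle E hab hbc hac))
    (hf : ∀ y, (y = u ∨ y = w) → ∀ Q Q' : Set ↥(outsideTriangle E hab hbc hac), Cn (fun a b => K.Adj (some a) (some b)) Q →
        Cn (fun a b => K.Adj (some a) (some b)) Q' → Disjoint Q Q' → (⟨n (k0 + 1), hS.mem (k0 + 1)⟩ : ↥(outsideTriangle E hab hbc hac)) ∈ Q →
        (⟨n (k0 + 2), hS.mem (k0 + 2)⟩ : ↥(outsideTriangle E hab hbc hac)) ∈ Q →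
        (⟨n k0, hS.mem k0⟩ : ↥(outsideTriangle E hab hbc hac)) ∈ Q' → y ∈ Q' → False) :
    ∃ F, Es.IsFace F ∧ Es.VertexOnFace none F ∧ Es.VertexOnFace (some u) F ∧ Es.VertexOnFace (some w) F := by
  obtain ⟨d1, d2, d3⟩ := fin3_ne k0
  have ne : ∀ {i j}, i ≠ j → (⟨n i, hS.mem i⟩ : ↥(outsideTriangle E hab hbc hac)) ≠ ⟨n j, hS.mem j⟩ :=
    fun h h' => h (hn (congrArg Subtype.val h'))
  have mi : ∀ {Q : Set ↥(outsideTriangle E hab hbc hac)} {x : V} (hx : x ∈ outsideTriangle E hab hbc hac),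
      x ∈ Subtype.val '' Q ↔ ⟨x, hx⟩ ∈ Q := by
    intro Q x hx
    constructor
    · rintro ⟨y, hy, rfl⟩; exact hy
    · intro h; exact ⟨_, h, rfl⟩
  have si : ∀ Q : Set ↥(outsideTriangle E hab hbc hac), Subtype.val '' Q ⊆ outsideTriangle E hab hbc hac := by
    rintro Q _ ⟨x, -, rfl⟩; exact x.2
  obtain ⟨Q', L, p, hp, hinj, hind, hc, hcn, hall⟩ := whitney (R := fun x y : ↥(outsideTriangle E hab hbc hac) => (outStarGraph E hab hbc hac).Adj (some x) (some y))
    (fun _ _ h => h.symm) (ne d1) (ne d2) (ne d3)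
    (by
      intro Q hQ h1 h2 h3' x y hx hy
      obtain ⟨s, hs, r, hr, hrQ, hsr, hrx, hry⟩ := cutO h3 hS (si Q) (hQ.image _) (x := x) (y := y) (fun h => hx ((mi x.2).1 h))
        (fun h => hy ((mi y.2).1 h)) x.2 (Or.inl y.2) (by
          intro j hj
          have := (mi (hS.mem j)).1 hj
          rcases fin3_abs k0 j with rfl | rfl | rfl
          exacts [absurd this h3', absurd this h1, absurd this h2])
      refine ⟨⟨s, si Q hs⟩, (mi _).1 hs, ⟨r, hr⟩, fun h => hrQ ((mi hr).2 h), (S_some E hab hbc hac).2 hsr, ?_, ?_⟩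
      · rintro rfl; exact hrx rfl
      · rintro rfl; exact hry rfl)
    (by
      intro Q h1 h2 h3' x hx
      obtain ⟨s, hs, r, hr, hrQ, hsr, hrx, hry⟩ := cutO h3 hS (si Q) ⟨_, _, h1, rfl⟩ (x := x) (y := ![a, b, c] (k0 + 1)) (fun h => hx ((mi x.2).1 h))
        (fun h => hS.tO _ (si Q h)) x.2 (Or.inr ⟨_, rfl⟩) (by
          intro j hj
          have := (mi (hS.mem j)).1 hj
          rcases fin3_abs k0 j with rfl | rfl | rfl
          exacts [absurd this h3', rfl, absurd this h2])
      refine ⟨⟨s, si Q hs⟩, (mi _).1 hs, ⟨r, hr⟩, fun h => hrQ ((mi hr).2 h), (S_some E hab hbc hac).2 hsr, ?_⟩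
      rintro rfl; exact hrx rfl)
  obtain ⟨F, hF, hF0, hFp⟩ := same_face Es (ne d1) ((S_none E hab hbc hac hS).2 ⟨_, rfl⟩) ((S_none E hab hbc hac hS).2 ⟨_, rfl⟩)
    (c := ⟨n k0, hS.mem k0⟩) (by
      intro x hx
      obtain ⟨j, hj⟩ := (S_none E hab hbc hac hS).1 hx
      rcases fin3_abs k0 j with rfl | rfl | rfl
      exacts [Or.inr (Or.inr (Subtype.ext hj)), Or.inl (Subtype.ext hj), Or.inr (Or.inl (Subtype.ext hj))]) hp hinj hind hc hcn hall
  have hm : ∀ y, (y = u ∨ y = w) → Es.VertexOnFace (some y) F := by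
    intro y hy
    rcases hall y with h | ⟨i, hi, rfl⟩
    · exfalso
      have cmap : ∀ {Q : Set ↥(outsideTriangle E hab hbc hac)}, Cn (fun x y => (outStarGraph E hab hbc hac).Adj (some x) (some y)) Q →
          Cn (fun x y => K.Adj (some x) (some y)) Q := by
        intro Q h
        have := Cn.map (f := id) (R' := fun x y => K.Adj (some x) (some y)) (fun a b h => hK h) h
        rwa [image_id] at this
      refine hf y hy Q'ᶜ Q' (cmap ?_) (cmap hcn) disjoint_compl_left ?_ ?_ hc h
      · refine cn_of_root (fun _ _ h => h.symm) (hp.mem 0 (Nat.zero_le _)) ?_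
        intro z hz
        obtain ⟨i, hi, rfl⟩ := (hall z).resolve_left hz
        exact hp.rt _ (Nat.zero_le _) hi fun k _ hk => hp.mem k (hk.trans hi)
      · rw [← hp.z]; exact hp.mem 0 (Nat.zero_le _)
      · rw [← hp.e]; exact hp.mem L le_rfl
    · exact hFp i hi
  exact ⟨F, hF, hF0, hm u (Or.inl rfl), hm w (Or.inr rfl)⟩

end main
end TG

namespace TG
open Set Complex Filter Topology Metric
open scoped ComplexConjugate

lemma zmod_facts {N : ℕ} (hN : 4 ≤ N) (i : ZMod N) : i - 1 ≠ i ∧ i + 1 ≠ i ∧ i - 1 ≠ i + 1 := by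
  have : Fact (1 < N) := ⟨by omega⟩
  refine ⟨fun h => one_ne_zero (α := ZMod N) (by linear_combination -h), fun h => one_ne_zero (α := ZMod N) (by linear_combination h), ?_⟩
  intro h
  have h2 : ((2 : ℕ) : ZMod N) = 0 := by push_cast; linear_combination -h
  rw [ZMod.natCast_eq_zero_iff] at h2
  have := Nat.le_of_dvd (by norm_num) h2
  omega

lemma main_good {V : Type u} {G : SimpleGraph V} (h3 : G.IsTriconnected) (hplanar : G.IsPlanar)
    (hdeg : G.MaxDegreeLE 4) (E : PlaneEmbedding G) {a b c : V} (hT : G.IsSepTriangle a b c)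
    (σstar : ZMod (Nat.card (Option ↥(outsideTriangle E hT.1 hT.2.1 hT.2.2.1))) ≃
      Option ↥(outsideTriangle E hT.1 hT.2.1 hT.2.2.1))
    (hσstar : (outStarGraph E hT.1 hT.2.1 hT.2.2.1).IsSubhamiltonianCycle σstar)
    (Good : Fin 3 → Fin 3 → Fin 3 → Prop)
    (hG : ∀ p m q, Good p m q ↔ ∃ σ : ZMod (Nat.card ↥(closedOutsideTriangle E hT.1 hT.2.1 hT.2.2.1)) ≃
        ↥(closedOutsideTriangle E hT.1 hT.2.1 hT.2.2.1),
      (G.induce (closedOutsideTriangle E hT.1 hT.2.1 hT.2.2.1)).IsSubhamiltonianCycle σ ∧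
      CoarsensTo (outProj E hT.1 hT.2.1 hT.2.2.1) σ σstar ∧
      s(![a, b, c] p, ![a, b, c] m) ∈ Sym2.map (Subtype.val) '' cycleEdges σ ∧
      s(![a, b, c] m, ![a, b, c] q) ∈ Sym2.map (Subtype.val) '' cycleEdges σ) :
    (∃ p m q, p ≠ q ∧ p ≠ m ∧ q ≠ m ∧ Good p m q) ∧
    ((∃ Estar : PlaneEmbedding (outStarGraph E hT.1 hT.2.1 hT.2.2.1),
        ∀ F : Set (ℝ × ℝ), Estar.IsFace F →
          {i | CrossesFaceAt Estar σstar F i}.Subsingleton) → ∀ m, ∃ p q, p ≠ q ∧ p ≠ m ∧ q ≠ m ∧ Good p m q) := by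
  have hfin : Finite V := Nat.finite_of_card_ne_zero (by have := h3.1; omega)
  obtain ⟨hab, hbc, hac, hsep⟩ := id hT
  have hdg : (∀ x ∈ outsideTriangle E hab hbc hac, ∀ y ∈ outsideTriangle E hab hbc hac, x = y) →
      (∀ x ∈ outsideTriangle E hab hbc hac, ∀ j, G.Adj x (![a, b, c] j)) → ∀ p m q, p ≠ q → p ≠ m → q ≠ m → Good p m q := by
    intro h1 h2 p m q hpq hpm hqm
    obtain ⟨σ, hσ, e1, e2, -⟩ := mk_sigma E hab hbc hac σstar hpq hpm hqm
    exact (hG p m q).2 ⟨σ, main_degen hplanar E hab hbc hac h1 h2 σ, hσ, e1, e2⟩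
  have hdg' : (∀ p m q, p ≠ q → p ≠ m → q ≠ m → Good p m q) → (∃ p m q, p ≠ q ∧ p ≠ m ∧ q ≠ m ∧ Good p m q) ∧
    ((∃ Estar : PlaneEmbedding (outStarGraph E hT.1 hT.2.1 hT.2.2.1),
        ∀ F : Set (ℝ × ℝ), Estar.IsFace F →
          {i | CrossesFaceAt Estar σstar F i}.Subsingleton) → ∀ m, ∃ p q, p ≠ q ∧ p ≠ m ∧ q ≠ m ∧ Good p m q) := by
    intro h
    have : ∀ m, ∃ p q, p ≠ q ∧ p ≠ m ∧ q ≠ m ∧ Good p m q := by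
      intro m
      obtain ⟨p, q, h1, h2, h3⟩ := fin3_two m
      exact ⟨p, q, h1, h2, h3, h p m q h1 h2 h3⟩
    obtain ⟨p, q, h'⟩ := this 0
    exact ⟨⟨p, 0, q, h'⟩, fun _ => this⟩
  rcases (outsideTriangle E hab hbc hac).eq_empty_or_nonempty with hO | hO
  · exact hdg' (hdg (fun x hx => absurd hx (by rw [hO]; exact id)) (fun x hx => absurd hx (by rw [hO]; exact id)))
  obtain ⟨n, hS⟩ := exists_struct h3 hdeg E hT hO
  by_cases hn : Function.Injective n
  swap
  · obtain ⟨x, hx⟩ := degen h3 hS hn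
    exact hdg' (hdg (fun y hy z hz => (hx y hy).trans (hx z hz).symm)
      (fun y hy j => (hS.adj j y hy).2 ((hx y hy).trans (hx _ (hS.mem j)).symm)))
  have hcard : 4 ≤ Nat.card (Option ↥(outsideTriangle E hab hbc hac)) := by
    have h1 : Function.Injective (fun j => (⟨n j, hS.mem j⟩ : ↥(outsideTriangle E hab hbc hac))) :=
      fun i j h => hn (congrArg Subtype.val h)
    have h2 := Nat.card_le_card_of_injective _ h1
    rw [Finite.card_option]
    rw [Nat.card_fin] at h2
    exact Nat.succ_le_succ h2
  have hi0 : σstar (σstar.symm none) = none := σstar.apply_symm_apply _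
  obtain ⟨z1, z2, z3⟩ := zmod_facts hcard (σstar.symm none)
  have hu : σstar (σstar.symm none - 1) ≠ none := fun h => z1 (σstar.injective (h.trans hi0.symm))
  have hw : σstar (σstar.symm none + 1) ≠ none := fun h => z2 (σstar.injective (h.trans hi0.symm))
  obtain ⟨u, hu⟩ := Option.ne_none_iff_exists'.1 hu
  obtain ⟨w, hw⟩ := Option.ne_none_iff_exists'.1 hw
  have huw : u ≠ w := by
    rintro rfl
    exact z3 (σstar.injective (hu.trans hw.symm))
  have hgood : ∀ p m q, p ≠ q → p ≠ m → q ≠ m →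
      (Tg (outStarGraph E hab hbc hac ⊔ cyclicSuccGraph σstar) (fun j => ⟨n j, hS.mem j⟩) u w p q).IsPlanar → Good p m q := by
    intro p m q hpq hpm hqm hpl
    obtain ⟨σ, hσ, e1, e2, hpr⟩ := mk_sigma E hab hbc hac σstar hpq hpm hqm
    exact (hG p m q).2 ⟨σ, tg_planar E hab hbc hac hS σstar σ hpm hqm hu hw hpl (hpr (by omega)), hσ, e1, e2⟩
  have hC := core (K := outStarGraph E hab hbc hac ⊔ cyclicSuccGraph σstar) hσstar (n := fun j => ⟨n j, hS.mem j⟩)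
    (fun i j h => hn (congrArg Subtype.val h)) huw (fun j => Or.inl ((S_none E hab hbc hac hS).2 ⟨j, rfl⟩))
    (by
      right
      rw [cyclicSuccGraph, SimpleGraph.fromRel_adj]
      exact ⟨by simp, Or.inr ⟨_, hu.symm, by rw [sub_add_cancel, hi0]⟩⟩)
    (by
      right
      rw [cyclicSuccGraph, SimpleGraph.fromRel_adj]
      exact ⟨by simp, Or.inl ⟨_, hi0.symm, hw.symm⟩⟩)
  rcases hC with hC | ⟨hun, hwn, ⟨m, p, q, h1, h2, h4, h5⟩, k0, hk0⟩
  · have : ∀ m, ∃ p q, p ≠ q ∧ p ≠ m ∧ q ≠ m ∧ Good p m q := by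
      intro m
      obtain ⟨p, q, h1, h2, h3, h4⟩ := hC m
      exact ⟨p, q, h1, h2, h3, hgood p m q h1 h2 h3 h4⟩
    obtain ⟨p, q, h'⟩ := this 0
    exact ⟨⟨p, 0, q, h'⟩, fun _ => this⟩
  · refine ⟨⟨p, m, q, h1, h2, h4, hgood p m q h1 h2 h4 h5⟩, ?_⟩
    rintro ⟨Es, hEs⟩
    exfalso
    obtain ⟨F, hF, f0, fu, fw⟩ := main_face h3 E hab hbc hac hS hn (outStarGraph E hab hbc hac ⊔ cyclicSuccGraph σstar) le_sup_left Es k0 u w hk0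
    have na : ∀ x : ↥(outsideTriangle E hab hbc hac), x ∉ range (fun j => (⟨n j, hS.mem j⟩ : ↥(outsideTriangle E hab hbc hac))) →
        ¬ (outStarGraph E hab hbc hac).Adj none (some x) := by
      intro x hx h
      obtain ⟨j, hj⟩ := (S_none E hab hbc hac hS).1 h
      exact hx ⟨j, Subtype.ext hj.symm⟩
    refine z1 (hEs F hF (x := σstar.symm none - 1) ?_ (y := σstar.symm none) ?_)
    · change CrossesFaceAt Es σstar F _
      rw [CrossesFaceAt, sub_add_cancel, hi0, hu]
      exact ⟨fu, f0, fun h => na u hun h.symm⟩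
    · change CrossesFaceAt Es σstar F _
      rw [CrossesFaceAt, hi0, hw]
      exact ⟨f0, fw, na w hwn⟩

end TG


/-- Any subhamiltonian cycle `σ*` of `out*(T)` can be augmented to a
subhamiltonian cycle of `out⁺(T)` containing two edges of the separating triangle `T`;
if moreover `σ*` crosses every face of `out*(T)` at most once, the two edges of `T` can
be prescribed in advance. -/
theorem augment_subhamiltonian_cycle_through_triangle {V : Type u}
    (G : SimpleGraph V) (h3 : G.IsTriconnected) (hplanar : G.IsPlanar)
    (hdeg : G.MaxDegreeLE 4) (E : PlaneEmbedding G)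
    {a b c : V} (hT : G.IsSepTriangle a b c)
    (σstar : ZMod (Nat.card (Option ↥(outsideTriangle E hT.1 hT.2.1 hT.2.2.1))) ≃
      Option ↥(outsideTriangle E hT.1 hT.2.1 hT.2.2.1))
    (hσstar : (outStarGraph E hT.1 hT.2.1 hT.2.2.1).IsSubhamiltonianCycle σstar) :
    (∃ σ : ZMod (Nat.card ↥(closedOutsideTriangle E hT.1 hT.2.1 hT.2.2.1)) ≃
        ↥(closedOutsideTriangle E hT.1 hT.2.1 hT.2.2.1),
      (G.induce (closedOutsideTriangle E hT.1 hT.2.1 hT.2.2.1)).IsSubhamiltonianCycle σ ∧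
      CoarsensTo (outProj E hT.1 hT.2.1 hT.2.2.1) σ σstar ∧
      ∃ e1 e2 : Sym2 V, e1 ∈ ({s(a, b), s(b, c), s(a, c)} : Set (Sym2 V)) ∧
        e2 ∈ ({s(a, b), s(b, c), s(a, c)} : Set (Sym2 V)) ∧ e1 ≠ e2 ∧
        e1 ∈ Sym2.map (Subtype.val) '' cycleEdges σ ∧
        e2 ∈ Sym2.map (Subtype.val) '' cycleEdges σ) ∧
    ((∃ Estar : PlaneEmbedding (outStarGraph E hT.1 hT.2.1 hT.2.2.1),
        ∀ F : Set (ℝ × ℝ), Estar.IsFace F →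
          {i | CrossesFaceAt Estar σstar F i}.Subsingleton) →
      ∀ e1 e2 : Sym2 V, e1 ∈ ({s(a, b), s(b, c), s(a, c)} : Set (Sym2 V)) →
        e2 ∈ ({s(a, b), s(b, c), s(a, c)} : Set (Sym2 V)) → e1 ≠ e2 →
        ∃ σ : ZMod (Nat.card ↥(closedOutsideTriangle E hT.1 hT.2.1 hT.2.2.1)) ≃
            ↥(closedOutsideTriangle E hT.1 hT.2.1 hT.2.2.1),
          (G.induce (closedOutsideTriangle E hT.1 hT.2.1 hT.2.2.1)).IsSubhamiltonianCycle σ ∧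
          CoarsensTo (outProj E hT.1 hT.2.1 hT.2.2.1) σ σstar ∧
          e1 ∈ Sym2.map (Subtype.val) '' cycleEdges σ ∧
          e2 ∈ Sym2.map (Subtype.val) '' cycleEdges σ) := by
  obtain ⟨⟨p, m, q, hpq, hpm, hqm, σ, hσ, hc, e1, e2⟩, hB⟩ := TG.main_good h3 hplanar hdeg E hT σstar hσstar _ (fun _ _ _ => Iff.rfl)
  refine ⟨⟨σ, hσ, hc, _, _, TG.tri_mem hpm, TG.tri_mem hqm.symm, TG.tri_ne (TG.t_inj hT.1 hT.2.1 hT.2.2.1) hpq hpm, e1, e2⟩, ?_⟩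
  intro hE e1 e2 h1 h2 hne
  obtain ⟨m, hm⟩ := TG.tri_two h1 h2 hne
  obtain ⟨p, q, hpq, hpm, hqm, σ, hσ, hc, g1, g2⟩ := hB hE m
  rcases hm p q hpq hpm hqm with ⟨rfl, rfl⟩ | ⟨rfl, rfl⟩
  · exact ⟨σ, hσ, hc, g1, g2⟩
  · exact ⟨σ, hσ, hc, g2, g1⟩
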